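/- Let n ≥ 1 and let V : ℝ → M_n(ℂ) be a continuously differentiable function whose values are Hermitian nonpositive matrices, such that x ↦ tr(−V(x)), x ↦ tr(V(x)²) and x ↦ tr(V′(x)²) are Lebesgue integrable on ℝ. Then for every δ > 0 there exist an integer N ≥ 0, twice continuously differentiable square-integrable functions ψ_1, …, ψ_N : ℝ → ℂ^n forming an orthonormal family in L²(ℝ, ℂ^n), and numbers E_1, …, E_N > 0 with −ψ_j″ + Vψ_j = −E_j ψ_j on ℝ for each j, such that (3/16) ∫_ℝ tr(V(x)²) dx − ∑_{j=1}^N E_j^{3/2} ≤ (3/16) [∫_ℝ tr(−V(x)) dx]^{1/2} · [∫_ℝ tr(V′(x)²) dx]^{1/2} + δ. -/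

import Mathlib

section

open MeasureTheory Filter Topology Set
open scoped ComplexOrder InnerProductSpace

section calculus
variable {E : Type*} [NormedAddCommGroup E] [NormedSpace ℝ E] [CompleteSpace E]

theorem eq_add_integral_of_off_countable {f f' : ℝ → E} {s : Set ℝ} (hs : s.Countable)
    (hf : Continuous f) (hd : ∀ x ∉ s, HasDerivAt f (f' x) x) (hi : LocallyIntegrable f')
    (a b : ℝ) : ∫ x in a..b, f' x = f b - f a :=
  integral_eq_of_hasDerivAt_off_countable f f' hs hf.continuousOn (fun x hx => hd x hx.2)
    ((hi.integrableOn_isCompact isCompact_uIcc).intervalIntegrable)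

theorem exists_limits_of_integrable_deriv {f f' : ℝ → E} {s : Set ℝ} (hs : s.Countable)
    (hf : Continuous f) (hd : ∀ x ∉ s, HasDerivAt f (f' x) x) (hi : Integrable f') :
    ∃ m n, Tendsto f atBot (𝓝 m) ∧ Tendsto f atTop (𝓝 n) ∧ ∫ x, f' x = n - m := by
  have key := eq_add_integral_of_off_countable hs hf hd hi.locallyIntegrable
  have h1 : Tendsto f atTop (𝓝 (f 0 + ∫ x in Ioi 0, f' x)) := by
    have := (intervalIntegral_tendsto_integral_Ioi (0 : ℝ) (hi.integrableOn) tendsto_id).const_add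
      (f 0)
    refine this.congr fun x => ?_
    simp [key]
  have h2 : Tendsto f atBot (𝓝 (f 0 - ∫ x in Iic 0, f' x)) := by
    have := (intervalIntegral_tendsto_integral_Iic (0 : ℝ) (hi.integrableOn) tendsto_id).const_sub
      (f 0)
    refine this.congr fun x => ?_
    simp [key]
  refine ⟨_, _, h2, h1, ?_⟩
  rw [← integral_add_compl (measurableSet_Iic (a := (0 : ℝ))) hi, compl_Iic]
  abel

theorem integral_deriv_eq_zero {f f' : ℝ → E} {s : Set ℝ} (hs : s.Countable)
    (hf : Continuous f) (hd : ∀ x ∉ s, HasDerivAt f (f' x) x) (hi : Integrable f')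
    (hfi : Integrable f) :
    Tendsto f atBot (𝓝 0) ∧ Tendsto f atTop (𝓝 0) ∧ ∫ x, f' x = 0 := by
  obtain ⟨m, n, hm, hn, h⟩ := exists_limits_of_integrable_deriv hs hf hd hi
  have hn0 : n = 0 := (hfi.integrableAtFilter atTop).eq_zero_of_tendsto
    (by intro s hs; obtain ⟨a, ha⟩ := mem_atTop_sets.1 hs
        rw [← top_le_iff, ← Real.volume_Ici (a := a)]; exact measure_mono ha) hn
  have hm0 : m = 0 := (hfi.integrableAtFilter atBot).eq_zero_of_tendsto
    (by intro s hs; obtain ⟨a, ha⟩ := mem_atBot_sets.1 hs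
        rw [← top_le_iff, ← Real.volume_Iic (a := a)]; exact measure_mono ha) hm
  subst hn0 hm0
  exact ⟨hm, hn, by simpa using h⟩

end calculus

section inner
variable {α : Type*} {m : MeasurableSpace α} {μ : Measure α}
variable {F : Type*} [NormedAddCommGroup F] [InnerProductSpace ℂ F]

theorem MeasureTheory.MemLp.integrable_inner_two {f g : α → F} (hf : MemLp f 2 μ)
    (hg : MemLp g 2 μ) : Integrable (fun x => ⟪f x, g x⟫_ℂ) μ := by
  have h : Integrable (fun x => ‖f x‖ * ‖g x‖) μ := hf.norm.integrable_mul hg.norm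
  exact h.mono' (hf.1.inner hg.1) (ae_of_all _ fun x => norm_inner_le_norm _ _)

theorem MeasureTheory.MemLp.integrable_sq_norm {F : Type*} [NormedAddCommGroup F] {f : α → F} (hf : MemLp f 2 μ) :
    Integrable (fun x => ‖f x‖ ^ 2) μ := (memLp_two_iff_integrable_sq_norm hf.1).1 hf

end inner

section H1
variable (F : Type*) [NormedAddCommGroup F] [InnerProductSpace ℂ F]

/-- Continuous square-integrable functions, paired with a square-integrable derivative that is
classical off a countable set. -/
def H1Submodule : Submodule ℂ ((ℝ → F) × (ℝ → F)) where
  carrier := {p | Continuous p.1 ∧ (∃ s : Set ℝ, s.Countable ∧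
    ∀ x ∉ s, HasDerivAt p.1 (p.2 x) x) ∧ MemLp p.1 2 ∧ MemLp p.2 2}
  add_mem' := by
    rintro p q ⟨h1, ⟨s, hs, h2⟩, h3, h4⟩ ⟨k1, ⟨t, ht, k2⟩, k3, k4⟩
    refine ⟨h1.add k1, ⟨s ∪ t, hs.union ht, fun x hx => ?_⟩, h3.add k3, h4.add k4⟩
    rw [mem_union, not_or] at hx
    exact (h2 x hx.1).add (k2 x hx.2)
  zero_mem' := ⟨continuous_const, ⟨∅, countable_empty, fun x _ => hasDerivAt_const x 0⟩,
    MemLp.zero, MemLp.zero⟩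
  smul_mem' := by
    rintro c p ⟨h1, ⟨s, hs, h2⟩, h3, h4⟩
    exact ⟨h1.const_smul c, ⟨s, hs, fun x hx => (h2 x hx).const_smul c⟩, h3.const_smul c,
      h4.const_smul c⟩

/-- The first-order Sobolev space, as a vector space of pairs `(u, u')`. -/
abbrev H1 : Type _ := H1Submodule F

variable {F}

namespace H1
/-- The underlying function. -/
def fn (u : H1 F) : ℝ → F := u.1.1
/-- The derivative. -/
def dv (u : H1 F) : ℝ → F := u.1.2

theorem continuous (u : H1 F) : Continuous u.fn := u.2.1
theorem exists_deriv (u : H1 F) : ∃ s : Set ℝ, s.Countable ∧ ∀ x ∉ s, HasDerivAt u.fn (u.dv x) x :=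
  u.2.2.1
theorem memLp (u : H1 F) : MemLp u.fn 2 := u.2.2.2.1
theorem memLp' (u : H1 F) : MemLp u.dv 2 := u.2.2.2.2
@[simp] theorem fn_add (u v : H1 F) (x : ℝ) : (u + v).fn x = u.fn x + v.fn x := rfl
@[simp] theorem dv_add (u v : H1 F) (x : ℝ) : (u + v).dv x = u.dv x + v.dv x := rfl
@[simp] theorem fn_smul (c : ℂ) (v : H1 F) (x : ℝ) : (c • v).fn x = c • v.fn x := rfl
@[simp] theorem dv_smul (c : ℂ) (v : H1 F) (x : ℝ) : (c • v).dv x = c • v.dv x := rfl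

/-- Bundling. -/
def mk (f g : ℝ → F) (h : Continuous f) (h2 : ∃ s : Set ℝ, s.Countable ∧
    ∀ x ∉ s, HasDerivAt f (g x) x) (h3 : MemLp f 2) (h4 : MemLp g 2) : H1 F :=
  ⟨(f, g), h, h2, h3, h4⟩

theorem inner_limits (u v : H1 F) : Tendsto (fun x => ⟪u.fn x, v.fn x⟫_ℂ) atBot (𝓝 0) ∧
    Tendsto (fun x => ⟪u.fn x, v.fn x⟫_ℂ) atTop (𝓝 0) ∧
    ∫ x, (⟪u.fn x, v.dv x⟫_ℂ + ⟪u.dv x, v.fn x⟫_ℂ) = 0 := by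
  obtain ⟨s, hs, h⟩ := u.exists_deriv
  obtain ⟨t, ht, k⟩ := v.exists_deriv
  refine integral_deriv_eq_zero (hs.union ht) (u.continuous.inner v.continuous) (fun x hx => ?_)
    ((u.memLp.integrable_inner_two v.memLp').add (u.memLp'.integrable_inner_two v.memLp))
    (u.memLp.integrable_inner_two v.memLp)
  rw [mem_union, not_or] at hx
  exact (h x hx.1).inner ℂ (k x hx.2)

theorem integral_by_parts (u v : H1 F) :
    ∫ x, ⟪u.fn x, v.dv x⟫_ℂ = - ∫ x, ⟪u.dv x, v.fn x⟫_ℂ := by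
  have := (inner_limits u v).2.2
  rw [integral_add (u.memLp.integrable_inner_two v.memLp')
    (u.memLp'.integrable_inner_two v.memLp)] at this
  exact eq_neg_of_add_eq_zero_left this

theorem tendsto_zero (u : H1 F) : Tendsto u.fn atBot (𝓝 0) ∧ Tendsto u.fn atTop (𝓝 0) := by
  have h := inner_limits u u
  have key : ∀ l : Filter ℝ, Tendsto (fun x => ⟪u.fn x, u.fn x⟫_ℂ) l (𝓝 0) →
      Tendsto u.fn l (𝓝 0) := by
    intro l hl
    rw [tendsto_zero_iff_norm_tendsto_zero]
    have := (hl.norm).sqrt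
    simpa [inner_self_eq_norm_sq_to_K] using this
  exact ⟨key _ h.1, key _ h.2.1⟩

end H1
end H1

end

section

open MeasureTheory Filter Topology Set
open scoped ComplexOrder InnerProductSpace

variable (F : Type*) [NormedAddCommGroup F] [InnerProductSpace ℂ F]

/-- A bounded continuous symmetric operator-valued potential on the line. -/
structure Potential where
  /-- the operator at a point -/
  op : ℝ → F →L[ℂ] F
  cont : Continuous op
  symm : ∀ x u v, ⟪op x u, v⟫_ℂ = ⟪u, op x v⟫_ℂ
  bdd : ∃ K, ∀ x, ‖op x‖ ≤ K

variable {F}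

theorem Potential.memLp (V : Potential F) {f : ℝ → F} (hf : MemLp f 2) :
    MemLp (fun x => V.op x (f x)) 2 := by
  obtain ⟨K, hK⟩ := V.bdd
  refine hf.of_le_mul (c := K) ?_ (ae_of_all _ fun x =>
    ((V.op x).le_opNorm _).trans (mul_le_mul_of_nonneg_right (hK x) (norm_nonneg _)))
  have : Continuous fun p : (F →L[ℂ] F) × F => p.1 p.2 := by fun_prop
  exact this.comp_aestronglyMeasurable (V.cont.aestronglyMeasurable.prodMk hf.1)

namespace H1

/-- The `L²` inner product. -/
noncomputable def mass : H1 F →ₗ⋆[ℂ] H1 F →ₗ[ℂ] ℂ :=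
  LinearMap.mk₂'ₛₗ (starRingEnd ℂ) (RingHom.id ℂ) (fun u v => ∫ x, ⟪u.fn x, v.fn x⟫_ℂ)
    (fun u v w => by
      simp only [fn_add, inner_add_left]
      exact integral_add (u.memLp.integrable_inner_two w.memLp)
        (v.memLp.integrable_inner_two w.memLp))
    (fun c u v => by
      simp only [fn_smul, inner_smul_left, smul_eq_mul]; exact integral_const_mul _ _)
    (fun u v w => by
      simp only [fn_add, inner_add_right]
      exact integral_add (u.memLp.integrable_inner_two v.memLp)
        (u.memLp.integrable_inner_two w.memLp))
    (fun c u v => by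
      simp only [fn_smul, inner_smul_right, smul_eq_mul, RingHom.id_apply]
      exact integral_const_mul _ _)

theorem mass_apply (u v : H1 F) : mass u v = ∫ x, ⟪u.fn x, v.fn x⟫_ℂ := rfl

theorem integrable_form (V : Potential F) (u v : H1 F) :
    Integrable fun x => ⟪u.dv x, v.dv x⟫_ℂ + ⟪u.fn x, V.op x (v.fn x)⟫_ℂ :=
  (u.memLp'.integrable_inner_two v.memLp').add (u.memLp.integrable_inner_two (V.memLp v.memLp))

/-- The quadratic form of the Schrödinger operator. -/
noncomputable def form (V : Potential F) : H1 F →ₗ⋆[ℂ] H1 F →ₗ[ℂ] ℂ :=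
  LinearMap.mk₂'ₛₗ (starRingEnd ℂ) (RingHom.id ℂ)
    (fun u v => ∫ x, (⟪u.dv x, v.dv x⟫_ℂ + ⟪u.fn x, V.op x (v.fn x)⟫_ℂ))
    (fun u v w => by
      rw [← integral_add (integrable_form V u w) (integrable_form V v w)]
      congr 1; ext x; simp only [fn_add, dv_add, inner_add_left]; ring)
    (fun c u v => by
      rw [smul_eq_mul, ← integral_const_mul]
      congr 1; ext x; simp only [fn_smul, dv_smul, inner_smul_left]; ring)
    (fun u v w => by
      rw [← integral_add (integrable_form V u v) (integrable_form V u w)]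
      congr 1; ext x; simp only [fn_add, dv_add, inner_add_right, map_add]; ring)
    (fun c u v => by
      rw [smul_eq_mul, ← integral_const_mul]
      congr 1; ext x
      simp only [fn_smul, dv_smul, inner_smul_right, map_smul, RingHom.id_apply]; ring)

theorem form_apply (V : Potential F) (u v : H1 F) :
    form V u v = ∫ x, (⟪u.dv x, v.dv x⟫_ℂ + ⟪u.fn x, V.op x (v.fn x)⟫_ℂ) := rfl

theorem mass_symm (u v : H1 F) : starRingEnd ℂ (mass u v) = mass v u := by
  rw [mass_apply, mass_apply, ← integral_conj]; simp

theorem form_symm (V : Potential F) (u v : H1 F) :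
    starRingEnd ℂ (form V u v) = form V v u := by
  rw [form_apply, form_apply, ← integral_conj]
  simp only [map_add, inner_conj_symm, V.symm]

theorem mass_self (u : H1 F) : mass u u = ((∫ x, ‖u.fn x‖ ^ 2 : ℝ) : ℂ) := by
  rw [mass_apply, ← integral_complex_ofReal]
  simp [inner_self_eq_norm_sq_to_K]

theorem form_self_re (V : Potential F) (u : H1 F) :
    (form V u u).re = ∫ x, (‖u.dv x‖ ^ 2 + (⟪u.fn x, V.op x (u.fn x)⟫_ℂ).re) := by
  rw [form_apply, ← reCLM_apply', ← ContinuousLinearMap.integral_comp_comm]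
  · congr 1; ext x
    simp [inner_self_eq_norm_sq_to_K, ← Complex.ofReal_pow]
  · exact integrable_form V u u
where
  reCLM_apply' : ∀ z : ℂ, Complex.reCLM z = z.re := fun _ => rfl

theorem integrable_form_self (V : Potential F) (u : H1 F) :
    Integrable fun x => ‖u.dv x‖ ^ 2 + (⟪u.fn x, V.op x (u.fn x)⟫_ℂ).re :=
  u.memLp'.integrable_sq_norm.add (u.memLp.integrable_inner_two (V.memLp u.memLp)).re

theorem mass_self_nonneg (u : H1 F) : 0 ≤ (mass u u).re := by
  rw [mass_self, Complex.ofReal_re]; positivity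

theorem mass_self_pos {u : H1 F} {x : ℝ} (hx : u.fn x ≠ 0) : 0 < (mass u u).re := by
  rw [mass_self, Complex.ofReal_re]
  refine integral_pos_of_integrable_nonneg_nonzero (x := x) (by have := u.continuous; fun_prop)
    u.memLp.integrable_sq_norm (fun x => by positivity) (by simpa using hx)

/-- `ψ` solves `-ψ'' + V ψ = -E ψ`. -/
def IsEigen (V : Potential F) (E : ℝ) (ψ : H1 F) : Prop :=
  (∀ x, HasDerivAt ψ.fn (ψ.dv x) x) ∧
    ∀ x, HasDerivAt ψ.dv (V.op x (ψ.fn x) + (E : ℂ) • ψ.fn x) x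

/-- The derivative of an eigenfunction as an element of `H1`. -/
def IsEigen.deriv {V : Potential F} {E : ℝ} {ψ : H1 F} (h : IsEigen V E ψ) : H1 F :=
  H1.mk ψ.dv (fun x => V.op x (ψ.fn x) + (E : ℂ) • ψ.fn x)
    (continuous_iff_continuousAt.2 fun x => (h.2 x).continuousAt)
    ⟨∅, countable_empty, fun x _ => h.2 x⟩ ψ.memLp'
    ((V.memLp ψ.memLp).add (ψ.memLp.const_smul (E : ℂ)))

theorem IsEigen.form_eq {V : Potential F} {E : ℝ} {ψ : H1 F} (h : IsEigen V E ψ) (u : H1 F) :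
    form V ψ u = -(E : ℂ) * mass ψ u := by
  have h1 := H1.integral_by_parts h.deriv u
  have h2 : ∀ x, ⟪h.deriv.dv x, u.fn x⟫_ℂ =
      ⟪ψ.fn x, V.op x (u.fn x)⟫_ℂ + (E : ℂ) * ⟪ψ.fn x, u.fn x⟫_ℂ := by
    intro x
    change ⟪V.op x (ψ.fn x) + (E : ℂ) • ψ.fn x, u.fn x⟫_ℂ = _
    rw [inner_add_left, V.symm, inner_smul_left]; simp
  have i1 := ψ.memLp.integrable_inner_two (V.memLp u.memLp)
  have i2 := ψ.memLp.integrable_inner_two u.memLp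
  simp only [h2] at h1
  rw [integral_add i1 (i2.const_mul _), integral_const_mul] at h1
  rw [form_apply, integral_add (ψ.memLp'.integrable_inner_two u.memLp') i1, mass_apply]
  have h3 : ∫ x, ⟪ψ.dv x, u.dv x⟫_ℂ = ∫ x, ⟪h.deriv.fn x, u.dv x⟫_ℂ := rfl
  rw [h3, h1]; ring

end H1

section regularity

theorem intervalIntegral_sq_deriv_bounded {f f' f'' : ℝ → F} (hf : ∀ x, HasDerivAt f (f' x) x)
    (hf' : ∀ x, HasDerivAt f' (f'' x) x) (h2 : MemLp f 2) (h2'' : MemLp f'' 2) :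
    ∃ C, ∀ x, 0 ≤ x → ∫ t in (0 : ℝ)..x, ‖f' t‖ ^ 2 ≤ C := by
  have cf : Continuous f := continuous_iff_continuousAt.2 fun x => (hf x).continuousAt
  have cf' : Continuous f' := continuous_iff_continuousAt.2 fun x => (hf' x).continuousAt
  set D := ∫ x, ‖⟪f'' x, f x⟫_ℂ‖ with hD
  have iD := h2''.integrable_inner_two h2
  set r : ℝ → ℝ := fun x => (⟪f' x, f x⟫_ℂ).re with hr
  have hd : ∀ x, HasDerivAt r (‖f' x‖ ^ 2 + (⟪f'' x, f x⟫_ℂ).re) x := by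
    intro x
    have := Complex.reCLM.hasFDerivAt.comp_hasDerivAt x ((hf' x).inner ℂ (hf x))
    refine this.congr_deriv ?_
    simp [inner_self_eq_norm_sq_to_K, ← Complex.ofReal_pow]
  have iint : ∀ a b : ℝ, IntervalIntegrable (fun x => (⟪f'' x, f x⟫_ℂ).re) volume a b :=
    fun a b => iD.re.intervalIntegrable
  have iint2 : ∀ a b : ℝ, IntervalIntegrable (fun x => ‖f' x‖ ^ 2) volume a b :=
    fun a b => (by fun_prop : Continuous fun x => ‖f' x‖ ^ 2).intervalIntegrable _ _
  have key : ∀ a x, a ≤ x → (∫ t in a..x, ‖f' t‖ ^ 2) - D ≤ r x - r a := by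
    intro a x hx
    rw [← intervalIntegral.integral_eq_sub_of_hasDerivAt (fun t _ => hd t)
      ((iint2 a x).add (iint a x)), intervalIntegral.integral_add (iint2 a x) (iint a x)]
    have : |∫ t in a..x, (⟪f'' t, f t⟫_ℂ).re| ≤ D := by
      rw [← Real.norm_eq_abs]
      refine (intervalIntegral.norm_integral_le_integral_norm hx).trans ?_
      rw [intervalIntegral.integral_of_le hx]
      refine (setIntegral_mono_on iD.re.norm.integrableOn iD.norm.integrableOn measurableSet_Ioc
        fun t _ => by simpa using Complex.abs_re_le_norm _).trans ?_
      exact setIntegral_le_integral iD.norm (ae_of_all _ fun t => norm_nonneg _)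
    linarith [neg_abs_le (∫ t in a..x, (⟪f'' t, f t⟫_ℂ).re)]
  by_contra! hC
  obtain ⟨x0, hx0, h⟩ := hC (2 * D + 1 - r 0 + |D|)
  have hr1 : ∀ x, x0 ≤ x → 1 ≤ r x := by
    intro x hx
    have h1 := key 0 x (hx0.trans hx)
    have h3 : ∫ t in (0 : ℝ)..x0, ‖f' t‖ ^ 2 ≤ ∫ t in (0 : ℝ)..x, ‖f' t‖ ^ 2 :=
      intervalIntegral.integral_mono_interval le_rfl hx0 hx (ae_of_all _ fun t => by
        simp only [Pi.zero_apply]; positivity) (iint2 0 x)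
    have : 0 ≤ D := by positivity
    linarith [abs_nonneg D]
  have hsq : ∀ x, HasDerivAt (fun x => ‖f x‖ ^ 2) (2 * r x) x := by
    intro x
    have := Complex.reCLM.hasFDerivAt.comp_hasDerivAt x ((hf x).inner ℂ (hf x))
    have e : (fun x => ‖f x‖ ^ 2) = Complex.reCLM ∘ fun t => ⟪f t, f t⟫_ℂ := by
      ext t; simp [inner_self_eq_norm_sq_to_K, ← Complex.ofReal_pow]
    rw [e]
    refine this.congr_deriv ?_
    rw [hr, map_add, Complex.reCLM_apply, Complex.reCLM_apply, ← inner_conj_symm, Complex.conj_re]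
    ring
  have hge : ∀ x, x0 + 1 ≤ x → 1 ≤ ‖f x‖ ^ 2 := by
    intro x hx
    have h1 : x - x0 ≤ ‖f x‖ ^ 2 - ‖f x0‖ ^ 2 := by
      have cr : Continuous r := continuous_iff_continuousAt.2 fun x => (hd x).continuousAt
      rw [← intervalIntegral.integral_eq_sub_of_hasDerivAt (fun t _ => hsq t)
        ((by fun_prop : Continuous fun t => 2 * r t).intervalIntegrable x0 x)]
      have : ∫ t in x0..x, (1 : ℝ) ≤ ∫ t in x0..x, 2 * r t :=
        intervalIntegral.integral_mono_on (by linarith) (by simp)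
          ((by fun_prop : Continuous fun t => 2 * r t).intervalIntegrable x0 x)
          fun t ht => by linarith [hr1 t ht.1]
      simpa using this
    linarith [sq_nonneg ‖f x0‖]
  have hfin := (h2.integrable_sq_norm).measure_ge_lt_top (ε := 1) one_pos
  have : (⊤ : ENNReal) ≤ volume {a | (1 : ℝ) ≤ ‖f a‖ ^ 2} := by
    rw [← Real.volume_Ici (a := x0 + 1)]
    exact measure_mono fun x hx => hge x hx
  exact absurd hfin (not_lt.2 this)

theorem memLp_deriv_of_second_deriv {f f' f'' : ℝ → F} (hf : ∀ x, HasDerivAt f (f' x) x)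
    (hf' : ∀ x, HasDerivAt f' (f'' x) x) (h2 : MemLp f 2) (h2'' : MemLp f'' 2) : MemLp f' 2 := by
  have cf' : Continuous f' := continuous_iff_continuousAt.2 fun x => (hf' x).continuousAt
  rw [memLp_two_iff_integrable_sq_norm cf'.aestronglyMeasurable]
  obtain ⟨C, hC⟩ := intervalIntegral_sq_deriv_bounded hf hf' h2 h2''
  have mp : MeasurePreserving (fun x : ℝ => -x) volume volume := Measure.measurePreserving_neg _
  obtain ⟨C', hC'⟩ := intervalIntegral_sq_deriv_bounded (f := fun x => f (-x))
    (f' := fun x => -f' (-x)) (f'' := fun x => f'' (-x))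
    (fun x => HasDerivAt.congr_deriv ((hf (-x)).scomp x (hasDerivAt_neg x)) (by simp))
    (fun x => HasDerivAt.congr_deriv ((hf' (-x)).scomp x (hasDerivAt_neg x)).neg (by simp))
    (h2.comp_measurePreserving mp) (h2''.comp_measurePreserving mp)
  have ci : Continuous fun x => ‖f' x‖ ^ 2 := by fun_prop
  have li : LocallyIntegrable fun x => ‖f' x‖ ^ 2 := ci.locallyIntegrable
  rw [← integrableOn_univ, ← Iic_union_Ioi (a := (0 : ℝ))]
  refine IntegrableOn.union ?_ ?_
  · refine integrableOn_Iic_of_intervalIntegral_norm_bounded C' 0 (a := fun n : ℕ => -(n : ℝ))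
      (l := atTop) (fun n => ci.integrableOn_Ioc) ?_ (Eventually.of_forall fun n => ?_)
    · exact tendsto_neg_atTop_atBot.comp tendsto_natCast_atTop_atTop
    · have := hC' n (Nat.cast_nonneg n)
      simp only [norm_neg] at this
      rw [intervalIntegral.integral_comp_neg (fun t => ‖f' t‖ ^ 2)] at this
      simpa using this
  · exact integrableOn_Ioi_of_intervalIntegral_norm_bounded C 0 (b := fun n : ℕ => (n : ℝ))
      (l := atTop) (fun n => ci.integrableOn_Ioc) tendsto_natCast_atTop_atTop
      (Eventually.of_forall fun n => by simpa using hC n (Nat.cast_nonneg n))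

end regularity

end

section

open MeasureTheory Filter Topology Set
open scoped ComplexOrder InnerProductSpace

variable {F : Type*} [NormedAddCommGroup F] [InnerProductSpace ℂ F]

theorem sq_norm_intervalIntegral_le [CompleteSpace F] {g : ℝ → F} (hg : MemLp g 2) {a b : ℝ} (hab : a ≤ b) :
    ‖∫ x in a..b, g x‖ ^ 2 ≤ (b - a) * ∫ x in a..b, ‖g x‖ ^ 2 := by
  have i2 : IntervalIntegrable (fun x => ‖g x‖ ^ 2) volume a b :=
    hg.integrable_sq_norm.intervalIntegrable
  have i1 : IntervalIntegrable (fun x => ‖g x‖) volume a b :=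
    ((hg.locallyIntegrable (by norm_num)).integrableOn_isCompact
      isCompact_uIcc).intervalIntegrable.norm
  have h1 : ‖∫ x in a..b, g x‖ ≤ ∫ x in a..b, ‖g x‖ :=
    intervalIntegral.norm_integral_le_integral_norm hab
  have h2 : ∀ t : ℝ, 0 ≤ (∫ x in a..b, ‖g x‖ ^ 2) * (t * t) + (-2 * ∫ x in a..b, ‖g x‖) * t
      + (b - a) := by
    intro t
    have : 0 ≤ ∫ x in a..b, (‖g x‖ * t - 1) ^ 2 :=
      intervalIntegral.integral_nonneg hab fun x _ => sq_nonneg _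
    have e : ∀ x, (‖g x‖ * t - 1) ^ 2 = ‖g x‖ ^ 2 * (t * t) + (‖g x‖ * (-2 * t) + 1) :=
      fun x => by ring
    simp only [e] at this
    rw [intervalIntegral.integral_add (i2.mul_const _) ((i1.mul_const _).add (by simp)),
      intervalIntegral.integral_add (i1.mul_const _) (by simp),
      intervalIntegral.integral_mul_const, intervalIntegral.integral_mul_const,
      intervalIntegral.integral_const, smul_eq_mul] at this
    linarith
  have h3 := discrim_le_zero h2
  rw [discrim] at h3
  have h4 : ‖∫ x in a..b, g x‖ ^ 2 ≤ (∫ x in a..b, ‖g x‖) ^ 2 := by gcongr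
  nlinarith

namespace H1

theorem integral_dv [CompleteSpace F] (u : H1 F) (a b : ℝ) :
    ∫ x in a..b, u.dv x = u.fn b - u.fn a := by
  obtain ⟨s, hs, h⟩ := u.exists_deriv
  exact eq_add_integral_of_off_countable hs u.continuous h
    (u.memLp'.locallyIntegrable (by norm_num)) a b

theorem sq_norm_sub_le [CompleteSpace F] (u : H1 F) (x y : ℝ) :
    ‖u.fn y - u.fn x‖ ^ 2 ≤ |y - x| * ∫ t, ‖u.dv t‖ ^ 2 := by
  wlog h : x ≤ y generalizing x y
  · rw [norm_sub_rev, abs_sub_comm]; exact this y x (le_of_not_ge h)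
  rw [← integral_dv, abs_of_nonneg (sub_nonneg.2 h)]
  refine (sq_norm_intervalIntegral_le u.memLp' h).trans ?_
  refine mul_le_mul_of_nonneg_left ?_ (by linarith)
  rw [intervalIntegral.integral_of_le h]
  exact setIntegral_le_integral u.memLp'.integrable_sq_norm (ae_of_all _ fun x => by positivity)

theorem sq_norm_le [CompleteSpace F] (u : H1 F) (x : ℝ) :
    ‖u.fn x‖ ^ 2 ≤ (∫ t, ‖u.fn t‖ ^ 2) + ∫ t, ‖u.dv t‖ ^ 2 := by
  obtain ⟨s, hs, h⟩ := u.exists_deriv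
  have hi := (u.memLp.integrable_inner_two u.memLp').add (u.memLp'.integrable_inner_two u.memLp)
  have key : ∀ a, a ≤ x → ‖u.fn x‖ ^ 2 - ‖u.fn a‖ ^ 2 ≤
      (∫ t, ‖u.fn t‖ ^ 2) + ∫ t, ‖u.dv t‖ ^ 2 := by
    intro a ha
    have e := eq_add_integral_of_off_countable hs (u.continuous.inner (𝕜 := ℂ) u.continuous)
      (fun x hx => (h x hx).inner ℂ (h x hx)) hi.locallyIntegrable a x
    have e2 : ‖u.fn x‖ ^ 2 - ‖u.fn a‖ ^ 2 = (⟪u.fn x, u.fn x⟫_ℂ - ⟪u.fn a, u.fn a⟫_ℂ).re := by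
      simp [inner_self_eq_norm_sq_to_K, ← Complex.ofReal_pow]
    rw [e2, ← e, ← integral_add u.memLp.integrable_sq_norm u.memLp'.integrable_sq_norm]
    refine (Complex.re_le_norm _).trans ?_
    refine (intervalIntegral.norm_integral_le_integral_norm ha).trans ?_
    rw [intervalIntegral.integral_of_le ha]
    refine (setIntegral_le_integral hi.norm (ae_of_all _ fun t => norm_nonneg _)).trans ?_
    refine integral_mono hi.norm (u.memLp.integrable_sq_norm.add u.memLp'.integrable_sq_norm)
      fun t => ?_
    have h1 := norm_inner_le_norm (𝕜 := ℂ) (u.fn t) (u.dv t)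
    have h2 := norm_inner_le_norm (𝕜 := ℂ) (u.dv t) (u.fn t)
    have h3 := norm_add_le ⟪u.fn t, u.dv t⟫_ℂ ⟪u.dv t, u.fn t⟫_ℂ
    simp only [Pi.add_apply]
    nlinarith [sq_nonneg (‖u.fn t‖ - ‖u.dv t‖)]
  have hl : Tendsto (fun a => ‖u.fn x‖ ^ 2 - ‖u.fn a‖ ^ 2) atBot (𝓝 (‖u.fn x‖ ^ 2 - 0)) := by
    refine tendsto_const_nhds.sub ?_
    simpa using (u.tendsto_zero.1.norm).pow 2
  rw [sub_zero] at hl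
  exact le_of_tendsto hl (eventually_atBot.2 ⟨x, key⟩)

end H1

theorem tendsto_integral_inner_of_bounded {f : ℝ → F} {u : ℕ → ℝ → F} {v : ℝ → F}
    (hf : MemLp f 2) (hu : ∀ k, MemLp (u k) 2) {C : ℝ} (hC : ∀ k, ∫ x, ‖u k x‖ ^ 2 ≤ C)
    (hv : MemLp v 2) (h : ∀ x, Tendsto (fun k => u k x) atTop (𝓝 (v x))) :
    Tendsto (fun k => ∫ x, ⟪f x, u k x⟫_ℂ) atTop (𝓝 (∫ x, ⟪f x, v x⟫_ℂ)) := by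
  set w : ℕ → ℝ → F := fun k x => u k x - v x
  have hw : ∀ k, MemLp (w k) 2 := fun k => (hu k).sub hv
  set D := 2 * C + 2 * ∫ x, ‖v x‖ ^ 2 with hD
  have hwD : ∀ k, ∫ x, ‖w k x‖ ^ 2 ≤ D := by
    intro k
    have : ∫ x, ‖w k x‖ ^ 2 ≤ ∫ x, (2 * ‖u k x‖ ^ 2 + 2 * ‖v x‖ ^ 2) := by
      refine integral_mono (hw k).integrable_sq_norm
        (((hu k).integrable_sq_norm.const_mul 2).add (hv.integrable_sq_norm.const_mul 2))
        fun x => ?_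
      have := norm_sub_le (u k x) (v x)
      simp only [w]
      nlinarith [sq_nonneg (‖u k x‖ - ‖v x‖), norm_nonneg (u k x - v x), norm_nonneg (u k x),
        norm_nonneg (v x)]
    rw [integral_add ((hu k).integrable_sq_norm.const_mul 2) (hv.integrable_sq_norm.const_mul 2),
      integral_const_mul, integral_const_mul] at this
    linarith [hC k]
  have hD0 : 0 ≤ D := le_trans (integral_nonneg fun x => by positivity) (hwD 0)
  have key : Tendsto (fun k => ∫ x, ‖⟪f x, w k x⟫_ℂ‖) atTop (𝓝 0) := by
    rw [Metric.tendsto_atTop]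
    intro ε hε
    set α : ℝ := ε / (2 * (D + 1)) with hα
    have hα0 : 0 < α := by positivity
    have lim : Tendsto (fun k => ∫ x, max (‖⟪f x, w k x⟫_ℂ‖ - α * ‖w k x‖ ^ 2) 0) atTop
        (𝓝 (∫ x : ℝ, (0 : ℝ))) := by
      refine tendsto_integral_of_dominated_convergence (fun x => ‖f x‖ ^ 2 / (4 * α))
        (fun k => ?_) (hf.integrable_sq_norm.div_const _) (fun k => ae_of_all _ fun x => ?_)
        (ae_of_all _ fun x => ?_)
      · exact (((hf.1.inner (𝕜 := ℂ) (hw k).1).norm.sub (((hw k).1.norm.pow 2).const_mul α)).sup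
          aestronglyMeasurable_const)
      · rw [Real.norm_of_nonneg (le_max_right _ _)]
        refine max_le ?_ (by positivity)
        have h1 := norm_inner_le_norm (𝕜 := ℂ) (f x) (w k x)
        have h2 : ‖f x‖ * ‖w k x‖ ≤ ‖f x‖ ^ 2 / (4 * α) + α * ‖w k x‖ ^ 2 := by
          rw [← sub_nonneg]
          have : ‖f x‖ ^ 2 / (4 * α) + α * ‖w k x‖ ^ 2 - ‖f x‖ * ‖w k x‖
              = (‖f x‖ - 2 * α * ‖w k x‖) ^ 2 / (4 * α) := by field_simp; ring
          rw [this]; positivity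
        linarith
      · have hw0 : Tendsto (fun k => w k x) atTop (𝓝 0) := by
          simpa [w] using (h x).sub_const (v x)
        have c : Continuous fun z : F => max (‖⟪f x, z⟫_ℂ‖ - α * ‖z‖ ^ 2) 0 := by fun_prop
        simpa [Function.comp_def] using (c.tendsto 0).comp hw0
    rw [integral_zero] at lim
    obtain ⟨N, hN⟩ := (Metric.tendsto_atTop.1 lim) (ε / 2) (by positivity)
    refine ⟨N, fun k hk => ?_⟩
    have h1 := hN k hk
    rw [Real.dist_eq, sub_zero] at h1 ⊢
    rw [abs_of_nonneg (integral_nonneg fun x => norm_nonneg _)]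
    have i1 := (hf.integrable_inner_two (hw k))
    have i2 := (hw k).integrable_sq_norm
    have i3 : Integrable fun x => max (‖⟪f x, w k x⟫_ℂ‖ - α * ‖w k x‖ ^ 2) 0 :=
      (i1.norm.sub (i2.const_mul α)).sup (integrable_zero _ _ _)
    have h2 : ∫ x, ‖⟪f x, w k x⟫_ℂ‖ ≤
        ∫ x, (max (‖⟪f x, w k x⟫_ℂ‖ - α * ‖w k x‖ ^ 2) 0 + α * ‖w k x‖ ^ 2) :=
      integral_mono i1.norm (i3.add (i2.const_mul α)) fun x => by
        simp only; linarith [le_max_left (‖⟪f x, w k x⟫_ℂ‖ - α * ‖w k x‖ ^ 2) 0]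
    rw [integral_add i3 (i2.const_mul α), integral_const_mul] at h2
    have h3 : α * ∫ x, ‖w k x‖ ^ 2 ≤ α * D := by gcongr; exact hwD k
    have h4 : α * D < ε / 2 := by
      rw [hα, div_mul_eq_mul_div, div_lt_div_iff₀ (by positivity) (by positivity)]; nlinarith
    linarith [le_abs_self (∫ x, max (‖⟪f x, w k x⟫_ℂ‖ - α * ‖w k x‖ ^ 2) 0)]
  rw [tendsto_iff_norm_sub_tendsto_zero]
  refine squeeze_zero (fun _ => norm_nonneg _) (fun k => ?_) key
  rw [← integral_sub (hf.integrable_inner_two (hu k)) (hf.integrable_inner_two hv)]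
  simp only [← inner_sub_right]
  exact norm_integral_le_integral_norm _

/-- Bounded sequences in `H1` have pointwise convergent subsequences, with continuous
square-integrable limit. -/
theorem H1.exists_subseq_tendsto [FiniteDimensional ℂ F] (u : ℕ → H1 F) {C : ℝ}
    (h1 : ∀ k, ∫ x, ‖(u k).fn x‖ ^ 2 ≤ C) (h2 : ∀ k, ∫ x, ‖(u k).dv x‖ ^ 2 ≤ C) :
    ∃ (φ : ℕ → ℕ) (v : ℝ → F), StrictMono φ ∧ Continuous v ∧ MemLp v 2 ∧
      ∀ x, Tendsto (fun k => (u (φ k)).fn x) atTop (𝓝 (v x)) := by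
  have : CompleteSpace F := FiniteDimensional.complete ℂ F
  have : ProperSpace F := FiniteDimensional.proper ℂ F
  have hC : 0 ≤ C := le_trans (integral_nonneg fun x => by positivity) (h1 0)
  have hb : ∀ k x, ‖(u k).fn x‖ ≤ √(2 * C) := fun k x => by
    refine Real.le_sqrt_of_sq_le (((u k).sq_norm_le x).trans ?_)
    linarith [h1 k, h2 k]
  have hH : ∀ k x y, ‖(u k).fn y - (u k).fn x‖ ≤ √(|y - x| * C) := fun k x y => by
    refine Real.le_sqrt_of_sq_le (((u k).sq_norm_sub_le x y).trans ?_)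
    gcongr; exact h2 k
  obtain ⟨a, -, φ, hφ, ha⟩ := (isCompact_univ_pi (X := fun _ : ℚ => F)
    (s := fun _ => Metric.closedBall 0 (√(2 * C))) fun _ => isCompact_closedBall _ _).tendsto_subseq
    (x := fun k (q : ℚ) => (u k).fn (q : ℝ)) (fun k q _ => by simpa using hb k q)
  rw [tendsto_pi_nhds] at ha
  have hlim : ∀ x, ∃ v, Tendsto (fun k => (u (φ k)).fn x) atTop (𝓝 v) := by
    intro x
    refine cauchySeq_tendsto_of_complete (Metric.cauchySeq_iff'.2 fun ε hε => ?_)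
    have hc : Tendsto (fun y : ℝ => √(|y - x| * C)) (𝓝 x) (𝓝 0) := by
      have : Continuous fun y : ℝ => √(|y - x| * C) := by fun_prop
      simpa using this.tendsto x
    obtain ⟨δ, hδ, hδ'⟩ := Metric.tendsto_nhds_nhds.1 hc (ε / 4) (by positivity)
    obtain ⟨q, hq⟩ := exists_rat_btwn (show x < x + δ by linarith)
    have hq1 : √(|(q : ℝ) - x| * C) < ε / 4 := by
      have := hδ' (x := (q : ℝ)) (by rw [Real.dist_eq, abs_of_pos] <;> linarith [hq.1, hq.2])
      simpa [abs_of_nonneg (Real.sqrt_nonneg _)] using this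
    obtain ⟨N, hN⟩ := Metric.cauchySeq_iff'.1 (ha q).cauchySeq (ε / 4) (by positivity)
    refine ⟨N, fun n hn => ?_⟩
    have e1 := hN n hn
    have e2 := hH (φ n) x q
    have e3 := hH (φ N) x q
    simp only [Function.comp_apply] at e1
    rw [dist_eq_norm] at e1 ⊢
    have : (u (φ n)).fn x - (u (φ N)).fn x = ((u (φ n)).fn q - (u (φ N)).fn q)
      - ((u (φ n)).fn q - (u (φ n)).fn x) + ((u (φ N)).fn q - (u (φ N)).fn x) := by abel
    rw [this]
    refine (norm_add_le _ _).trans_lt ?_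
    have := norm_sub_le ((u (φ n)).fn q - (u (φ N)).fn q) ((u (φ n)).fn q - (u (φ n)).fn x)
    linarith
  choose v hv using hlim
  refine ⟨φ, v, hφ, ?_, ?_, hv⟩
  · rw [continuous_iff_continuousAt]
    intro x
    have hl : ∀ y, ‖v y - v x‖ ≤ √(|y - x| * C) := fun y =>
      le_of_tendsto ((hv y).sub (hv x)).norm (Eventually.of_forall fun k => hH _ _ _)
    rw [ContinuousAt, tendsto_iff_norm_sub_tendsto_zero]
    refine squeeze_zero (fun _ => norm_nonneg _) hl ?_
    have : Continuous fun y : ℝ => √(|y - x| * C) := by fun_prop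
    simpa using this.tendsto x
  · refine ⟨aestronglyMeasurable_of_tendsto_ae atTop
      (fun k => (u (φ k)).continuous.aestronglyMeasurable) (ae_of_all _ hv), ?_⟩
    refine (Lp.eLpNorm_lim_le_liminf_eLpNorm
      (fun k => (u (φ k)).continuous.aestronglyMeasurable) v (ae_of_all _ hv)).trans_lt ?_
    have hle : ∀ k, eLpNorm (u (φ k)).fn 2 volume ≤ ENNReal.ofReal (√C) := by
      intro k
      rw [(u (φ k)).memLp.eLpNorm_eq_integral_rpow_norm (by norm_num) (by norm_num)]
      refine ENNReal.ofReal_le_ofReal ?_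
      rw [Real.sqrt_eq_rpow]
      have : ((2 : ENNReal).toReal)⁻¹ = 1 / 2 := by norm_num
      rw [this]
      refine Real.rpow_le_rpow (integral_nonneg fun x => by positivity) ?_ (by norm_num)
      simpa using h1 (φ k)
    refine lt_of_le_of_lt (Filter.liminf_le_of_frequently_le'
      (Eventually.of_forall hle).frequently) ENNReal.ofReal_lt_top

end

section

open MeasureTheory Filter Topology Set
open scoped ComplexOrder InnerProductSpace

variable {F : Type*} [NormedAddCommGroup F] [InnerProductSpace ℂ F]

/-- The tent function of half-width `h` centered at `x`. -/
noncomputable def tent (x h y : ℝ) : ℝ := max (h - |y - x|) 0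

/-- The derivative of the tent function. -/
noncomputable def tentDeriv (x h y : ℝ) : ℝ :=
  (Ioc (x - h) x).indicator (fun _ => 1) y - (Ioc x (x + h)).indicator (fun _ => 1) y

theorem continuous_tent (x h : ℝ) : Continuous (tent x h) := by unfold tent; fun_prop

theorem hasCompactSupport_tent (x h : ℝ) : HasCompactSupport (tent x h) := by
  refine HasCompactSupport.intro (isCompact_Icc (a := x - h) (b := x + h)) fun y hy => ?_
  rw [tent, max_eq_right]
  by_contra! hc
  exact hy ⟨by linarith [neg_abs_le (y - x)], by linarith [le_abs_self (y - x)]⟩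

theorem hasDerivAt_tent {x h : ℝ} (hh : 0 < h) {y : ℝ} (hy : y ∉ ({x - h, x, x + h} : Set ℝ)) :
    HasDerivAt (tent x h) (tentDeriv x h y) y := by
  simp only [mem_insert_iff, mem_singleton_iff, not_or] at hy
  obtain ⟨h1, h2, h3⟩ := hy
  rcases lt_or_gt_of_ne h1 with h1 | h1
  · have e : tentDeriv x h y = 0 := by
      rw [tentDeriv, indicator_of_notMem (by simp; intro; linarith),
        indicator_of_notMem (by simp; intro; linarith), sub_zero]
    rw [e]
    refine (hasDerivAt_const y 0).congr_of_eventuallyEq ?_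
    filter_upwards [Iio_mem_nhds h1] with z hz
    rw [mem_Iio] at hz
    exact max_eq_right (by linarith [neg_abs_le (z - x)])
  rcases lt_or_gt_of_ne h2 with h2 | h2
  · have e : tentDeriv x h y = 1 := by
      rw [tentDeriv, indicator_of_mem (by constructor <;> linarith),
        indicator_of_notMem (by simp; intro; linarith), sub_zero]
    rw [e]
    refine (((hasDerivAt_id y).sub_const x).const_add h).congr_of_eventuallyEq ?_
    filter_upwards [Ioo_mem_nhds h1 h2] with z hz
    rw [tent, abs_of_neg (by linarith [hz.2]), max_eq_left (by linarith [hz.1])]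
    simp only [id]; ring
  rcases lt_or_gt_of_ne h3 with h3 | h3
  · have e : tentDeriv x h y = -1 := by
      rw [tentDeriv, indicator_of_notMem (by simp; intro; linarith),
        indicator_of_mem (by constructor <;> linarith), zero_sub]
    rw [e]
    refine (((hasDerivAt_id y).sub_const x).const_sub h).congr_of_eventuallyEq ?_
    filter_upwards [Ioo_mem_nhds h2 h3] with z hz
    rw [tent, abs_of_pos (by linarith [hz.1]), max_eq_left (by linarith [hz.2])]
    simp
  · have e : tentDeriv x h y = 0 := by
      rw [tentDeriv, indicator_of_notMem (by simp; intro; linarith),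
        indicator_of_notMem (by simp; intro; linarith), sub_zero]
    rw [e]
    refine (hasDerivAt_const y 0).congr_of_eventuallyEq ?_
    filter_upwards [Ioi_mem_nhds h3] with z hz
    rw [mem_Ioi] at hz
    exact max_eq_right (by linarith [le_abs_self (z - x)])

theorem memLp_tentDeriv (x h : ℝ) (p : ENNReal) : MemLp (tentDeriv x h) p :=
  (memLp_indicator_const p measurableSet_Ioc 1 (Or.inr (by simp))).sub
    (memLp_indicator_const p measurableSet_Ioc 1 (Or.inr (by simp)))

theorem integral_tentDeriv [CompleteSpace F] {f g : ℝ → F} {s : Set ℝ} (hs : s.Countable)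
    (hf : Continuous f) (hd : ∀ x ∉ s, HasDerivAt f (g x) x) (hg : LocallyIntegrable g)
    {x h : ℝ} (hh : 0 < h) (e : F) :
    ∫ y, ⟪((tentDeriv x h y : ℝ) : ℂ) • e, g y⟫_ℂ
      = ⟪e, (2 : ℂ) • f x - f (x - h) - f (x + h)⟫_ℂ := by
  have k1 := eq_add_integral_of_off_countable hs hf hd hg (x - h) x
  have k2 := eq_add_integral_of_off_countable hs hf hd hg x (x + h)
  have e1 : ∀ y, ⟪((tentDeriv x h y : ℝ) : ℂ) • e, g y⟫_ℂ =
      (Ioc (x - h) x).indicator (fun y => ⟪e, g y⟫_ℂ) y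
        - (Ioc x (x + h)).indicator (fun y => ⟪e, g y⟫_ℂ) y := by
    intro y
    rw [inner_smul_left, Complex.conj_ofReal, tentDeriv]
    by_cases hy1 : y ∈ Ioc (x - h) x <;> by_cases hy2 : y ∈ Ioc x (x + h) <;> simp [hy1, hy2]
  have ii : ∀ a b : ℝ, IntegrableOn g (Ioc a b) := fun a b =>
    (hg.integrableOn_isCompact isCompact_Icc).mono_set Ioc_subset_Icc_self
  have i1 : ∀ a b : ℝ, IntegrableOn (fun y => ⟪e, g y⟫_ℂ) (Ioc a b) := fun a b =>
    (ii a b).const_inner e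
  simp only [e1]
  rw [integral_sub ((i1 _ _).integrable_indicator measurableSet_Ioc)
    ((i1 _ _).integrable_indicator measurableSet_Ioc), integral_indicator measurableSet_Ioc,
    integral_indicator measurableSet_Ioc, integral_inner (ii _ _), integral_inner (ii _ _),
    ← intervalIntegral.integral_of_le (by linarith), ← intervalIntegral.integral_of_le (by linarith),
    k1, k2, ← inner_sub_right]
  congr 1
  rw [two_smul]; abel

/-- The vector-valued tent as an element of `H1`. -/
noncomputable def H1.tent (x h : ℝ) (hh : 0 < h) (e : F) : H1 F :=
  H1.mk (fun y => ((_root_.tent x h y : ℝ) : ℂ) • e) (fun y => ((tentDeriv x h y : ℝ) : ℂ) • e)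
    ((Complex.continuous_ofReal.comp (continuous_tent x h)).smul continuous_const)
    ⟨{x - h, x, x + h}, by simp, fun _ hy =>
      ((hasDerivAt_tent hh hy).ofReal_comp).smul_const e⟩
    (Continuous.memLp_of_hasCompactSupport
      ((Complex.continuous_ofReal.comp (continuous_tent x h)).smul continuous_const)
      (HasCompactSupport.smul_right
        ((hasCompactSupport_tent x h).comp_left (g := Complex.ofReal) rfl)))
    (by
      have h1 : MemLp (fun y => tentDeriv x h y) 2 := memLp_tentDeriv x h 2
      refine MemLp.of_le_mul (c := ‖e‖) h1 ?_ (ae_of_all _ fun y => ?_)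
      · exact (Complex.continuous_ofReal.comp_aestronglyMeasurable h1.1).smul
          aestronglyMeasurable_const
      · rw [norm_smul, Complex.norm_real, mul_comm])

theorem exists_second_deriv_of_tent [FiniteDimensional ℂ F] {u z : ℝ → F} (hu : Continuous u)
    (hz : Continuous z)
    (H : ∀ x h, 0 < h → ∀ e : F, ∫ y, ⟪((tent x h y : ℝ) : ℂ) • e, z y⟫_ℂ
      = -⟪e, (2 : ℂ) • u x - u (x - h) - u (x + h)⟫_ℂ) :
    ∃ u' : ℝ → F, (∀ x, HasDerivAt u (u' x) x) ∧ ∀ x, HasDerivAt u' (z x) x := by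
  have : CompleteSpace F := FiniteDimensional.complete ℂ F
  set w' : ℝ → F := fun x => ∫ t in (0 : ℝ)..x, z t with hw'
  have hw'd : ∀ x, HasDerivAt w' (z x) x := fun x => intervalIntegral.integral_hasDerivAt_right
    (hz.intervalIntegrable _ _) (hz.stronglyMeasurableAtFilter _ _) hz.continuousAt
  have cw' : Continuous w' := continuous_iff_continuousAt.2 fun x => (hw'd x).continuousAt
  set w : ℝ → F := fun x => ∫ t in (0 : ℝ)..x, w' t with hw
  have hwd : ∀ x, HasDerivAt w (w' x) x := fun x => intervalIntegral.integral_hasDerivAt_right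
    (cw'.intervalIntegrable _ _) (cw'.stronglyMeasurableAtFilter _ _) cw'.continuousAt
  have cw : Continuous w := continuous_iff_continuousAt.2 fun x => (hwd x).continuousAt
  have K : ∀ x h, 0 < h → ∀ e : F, ∫ y, ⟪((tent x h y : ℝ) : ℂ) • e, z y⟫_ℂ
      = -⟪e, (2 : ℂ) • w x - w (x - h) - w (x + h)⟫_ℂ := by
    intro x h hh e
    rw [← integral_tentDeriv countable_empty cw (fun x _ => hwd x) cw'.locallyIntegrable hh e]
    have cT : Continuous fun y => ((tent x h y : ℝ) : ℂ) • e :=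
      (Complex.continuous_ofReal.comp (continuous_tent x h)).smul continuous_const
    have sT : HasCompactSupport fun y => ((tent x h y : ℝ) : ℂ) • e :=
      HasCompactSupport.smul_right
        ((hasCompactSupport_tent x h).comp_left (g := Complex.ofReal) rfl)
    have si : ∀ v : ℝ → F, Continuous v →
        Integrable fun y => ⟪((tent x h y : ℝ) : ℂ) • e, v y⟫_ℂ := fun v hv =>
      (cT.inner hv).integrable_of_hasCompactSupport (sT.mono' (fun y hy => by
        refine subset_tsupport _ ?_
        simp only [Function.mem_support] at hy ⊢
        intro h0; rw [h0, inner_zero_left] at hy; exact hy rfl))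
    have i3 : Integrable fun y => ⟪((tentDeriv x h y : ℝ) : ℂ) • e, w' y⟫_ℂ := by
      have : ∀ y, ⟪((tentDeriv x h y : ℝ) : ℂ) • e, w' y⟫_ℂ =
          (Ioc (x - h) x).indicator (fun y => ⟪e, w' y⟫_ℂ) y
            - (Ioc x (x + h)).indicator (fun y => ⟪e, w' y⟫_ℂ) y := by
        intro y
        rw [inner_smul_left, Complex.conj_ofReal, tentDeriv]
        by_cases hy1 : y ∈ Ioc (x - h) x <;> by_cases hy2 : y ∈ Ioc x (x + h) <;>
          simp [hy1, hy2]
      simp only [this]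
      have c : Continuous fun y => ⟪e, w' y⟫_ℂ := by fun_prop
      exact (c.integrableOn_Ioc.integrable_indicator measurableSet_Ioc).sub
        (c.integrableOn_Ioc.integrable_indicator measurableSet_Ioc)
    have := (integral_deriv_eq_zero (s := {x - h, x, x + h}) (by simp) (cT.inner (𝕜 := ℂ) cw')
      (fun y hy => (((hasDerivAt_tent hh hy).ofReal_comp).smul_const e).inner ℂ (hw'd y))
      ((si z hz).add i3) (si w' cw')).2.2
    rw [integral_add (si z hz) i3] at this
    exact eq_neg_of_add_eq_zero_left this
  have mid : ∀ x h, 0 < h → (2 : ℂ) • (u x - w x) - (u (x - h) - w (x - h))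
      - (u (x + h) - w (x + h)) = 0 := by
    intro x h hh
    refine ext_inner_left ℂ fun e => ?_
    have := (H x h hh e).symm.trans (K x h hh e)
    rw [neg_inj] at this
    rw [inner_zero_right, ← sub_eq_zero.2 this, ← inner_sub_right]
    congr 1
    rw [smul_sub]; abel
  have mid2 : ∀ a b : ℝ, (u - w) (midpoint ℝ a b) = midpoint ℝ ((u - w) a) ((u - w) b) := by
    intro a b
    wlog hab : a < b generalizing a b
    · rcases eq_or_lt_of_le (not_lt.1 hab) with rfl | h
      · simp
      · rw [midpoint_comm, this b a h, midpoint_comm]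
    have := mid ((a + b) / 2) ((b - a) / 2) (by linarith)
    rw [show (a + b) / 2 - (b - a) / 2 = a by ring, show (a + b) / 2 + (b - a) / 2 = b by ring]
      at this
    have e1 : midpoint ℝ a b = (a + b) / 2 := by
      rw [midpoint_eq_smul_add, smul_eq_mul, invOf_eq_inv]; ring
    rw [e1, midpoint_eq_smul_add, invOf_eq_inv]
    simp only [Pi.sub_apply]
    rw [two_smul, sub_sub, sub_eq_zero] at this
    rw [← this, ← two_smul ℝ, smul_smul]
    norm_num
  set A := AffineMap.ofMapMidpoint (u - w) mid2 (hu.sub cw) with hA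
  have hA' : ∀ x, u x = w x + (x • A.linear 1 + A 0) := by
    intro x
    have h1 : A x = u x - w x := rfl
    have h2 : A x = A.linear x + A 0 := congrFun A.decomp x
    have h3 : A.linear x = x • A.linear 1 := by rw [← map_smul]; simp
    rw [← h3, ← h2, h1]; abel
  refine ⟨fun x => w' x + A.linear 1, fun x => ?_, fun x => (hw'd x).add_const _⟩
  have e : u = fun x => w x + (x • A.linear 1 + A 0) := funext hA'
  rw [e]
  refine (hwd x).add (HasDerivAt.add_const _ ?_)
  simpa using (hasDerivAt_id x).smul_const (A.linear 1)

end

section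

open MeasureTheory Filter Topology Set
open scoped ComplexOrder InnerProductSpace

section abstractForms
variable {X : Type*} [AddCommGroup X] [Module ℂ X]

/-- Cauchy–Schwarz for a Hermitian form which is nonnegative on a subspace. -/
theorem sq_norm_sesq_le (p : X →ₗ⋆[ℂ] X →ₗ[ℂ] ℂ) (S : Submodule ℂ X)
    (hs : ∀ u v, starRingEnd ℂ (p u v) = p v u) (hp : ∀ u ∈ S, 0 ≤ (p u u).re) {u v : X}
    (hu : u ∈ S) (hv : v ∈ S) : ‖p u v‖ ^ 2 ≤ (p u u).re * (p v v).re := by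
  set c := p u v with hc
  have h : ∀ t : ℝ, 0 ≤ (‖c‖ ^ 2 * (p v v).re) * (t * t) + (-2 * ‖c‖ ^ 2) * t + (p u u).re := by
    intro t
    have h1 := hp (u + (-(t : ℂ) * starRingEnd ℂ c) • v) (S.add_mem hu (S.smul_mem _ hv))
    have h2 : p v u = starRingEnd ℂ c := (hs u v).symm
    simp only [map_add, LinearMap.add_apply, map_smul, LinearMap.map_smulₛₗ, LinearMap.smul_apply,
      smul_eq_mul, ← hc, h2, map_mul, map_neg, Complex.conj_conj, Complex.conj_ofReal] at h1
    have h3 : c * starRingEnd ℂ c = ((‖c‖ ^ 2 : ℝ) : ℂ) := by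
      rw [Complex.mul_conj, Complex.normSq_eq_norm_sq]
    have e : p u u + -(t : ℂ) * starRingEnd ℂ c * c + (-(t : ℂ) * c * starRingEnd ℂ c +
        -(t : ℂ) * starRingEnd ℂ c * (-(t : ℂ) * c * p v v)) = p u u - 2 * t * (c * starRingEnd ℂ c)
          + t * t * (c * starRingEnd ℂ c) * p v v := by ring
    have e' := congrArg Complex.re e
    rw [h3] at e'
    have h1' : 0 ≤ (p u u + -(t : ℂ) * starRingEnd ℂ c * c + (-(t : ℂ) * c * starRingEnd ℂ c +
        -(t : ℂ) * starRingEnd ℂ c * (-(t : ℂ) * c * p v v))).re := by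
      convert h1 using 2; ring
    rw [e'] at h1'
    have e2 : (p u u - 2 * t * ((‖c‖ ^ 2 : ℝ) : ℂ) + t * t * ((‖c‖ ^ 2 : ℝ) : ℂ) * p v v).re
      = (p u u).re - 2 * t * ‖c‖ ^ 2 + t * t * ‖c‖ ^ 2 * (p v v).re := by
      rw [show (2 : ℂ) * t * ((‖c‖ ^ 2 : ℝ) : ℂ) = ((2 * t * ‖c‖ ^ 2 : ℝ) : ℂ) by push_cast; ring,
        show (t : ℂ) * t * ((‖c‖ ^ 2 : ℝ) : ℂ) = ((t * t * ‖c‖ ^ 2 : ℝ) : ℂ) by push_cast; ring,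
        Complex.add_re, Complex.sub_re, Complex.ofReal_re, Complex.re_ofReal_mul]
    rw [e2] at h1'
    linarith
  have h3 := discrim_le_zero h
  rw [discrim] at h3
  rcases eq_or_ne c 0 with h0 | h0
  · rw [h0]; simpa using mul_nonneg (hp u hu) (hp v hv)
  · have : 0 < ‖c‖ ^ 2 := by positivity
    have h4 : ‖c‖ ^ 2 * (‖c‖ ^ 2 - (p u u).re * (p v v).re) ≤ 0 := by nlinarith
    have := nonpos_of_mul_nonpos_right h4 this
    linarith

end abstractForms

variable {F : Type*} [NormedAddCommGroup F] [InnerProductSpace ℂ F]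

namespace H1

/-- Orthonormal families of eigenfunctions, with eigenvalues `-E j`. -/
structure IsEigenFamily (V : Potential F) {N : ℕ} (E : Fin N → ℝ) (ψ : Fin N → H1 F) : Prop where
  eig : ∀ j, IsEigen V (E j) (ψ j)
  ortho : ∀ i j, mass (ψ i) (ψ j) = if i = j then 1 else 0

/-- The component orthogonal to a family. -/
noncomputable def perp {N : ℕ} (ψ : Fin N → H1 F) (u : H1 F) : H1 F :=
  u - ∑ j, mass (ψ j) u • ψ j

variable {V : Potential F} {N : ℕ} {E : Fin N → ℝ} {ψ : Fin N → H1 F}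

theorem mass_sum_smul (hψ : IsEigenFamily V E ψ) (c : Fin N → ℂ) (i : Fin N) :
    mass (ψ i) (∑ j, c j • ψ j) = c i := by
  simp [map_sum, hψ.ortho]

theorem mass_perp (hψ : IsEigenFamily V E ψ) (u : H1 F) (i : Fin N) :
    mass (ψ i) (perp ψ u) = 0 := by
  rw [perp, map_sub, mass_sum_smul hψ, sub_self]

theorem mass_eq_zero_symm {u v : H1 F} (h : mass u v = 0) : mass v u = 0 := by
  rw [← mass_symm, h, map_zero]

theorem conj_mul_re (z : ℂ) : (starRingEnd ℂ z * z).re = ‖z‖ ^ 2 := by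
  rw [mul_comm, Complex.mul_conj, Complex.ofReal_re, Complex.normSq_eq_norm_sq]

theorem map_perp_eq (l : H1 F →ₗ[ℂ] ℂ) {u : H1 F} (h : ∀ i, l (ψ i) = 0) :
    l (perp ψ u) = l u := by
  rw [perp, map_sub, map_sum]
  simp [h]

theorem mass_self_eq_perp (hψ : IsEigenFamily V E ψ) (u : H1 F) :
    (mass u u).re = (mass (perp ψ u) (perp ψ u)).re + ∑ j, ‖mass (ψ j) u‖ ^ 2 := by
  have h0 : ∀ i, mass (perp ψ u) (ψ i) = 0 := fun i => mass_eq_zero_symm (mass_perp hψ u i)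
  have h1 : mass (perp ψ u) (perp ψ u) = mass (perp ψ u) u := by
    exact map_perp_eq _ h0
  rw [h1, perp, map_sub, map_sum, LinearMap.sub_apply, LinearMap.sum_apply]
  simp [LinearMap.map_smulₛₗ, ← Complex.normSq_eq_norm_sq, Complex.normSq_apply]

theorem form_perp_left (hψ : IsEigenFamily V E ψ) (u : H1 F) (i : Fin N) :
    form V (ψ i) (perp ψ u) = 0 := by
  rw [(hψ.eig i).form_eq, mass_perp hψ, mul_zero]

theorem form_self_eq_perp (hψ : IsEigenFamily V E ψ) (u : H1 F) :
    (form V u u).re = (form V (perp ψ u) (perp ψ u)).re - ∑ j, E j * ‖mass (ψ j) u‖ ^ 2 := by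
  have h0 : ∀ i, form V (perp ψ u) (ψ i) = 0 := fun i => by
    rw [← form_symm, form_perp_left hψ, map_zero]
  have h1 : form V (perp ψ u) (perp ψ u) = form V (perp ψ u) u := by
    exact map_perp_eq _ h0
  rw [h1, perp, map_sub, map_sum, LinearMap.sub_apply, LinearMap.sum_apply]
  simp only [LinearMap.map_smulₛₗ, LinearMap.smul_apply, smul_eq_mul, (hψ.eig _).form_eq,
    Complex.sub_re, Complex.re_sum]
  have : ∀ j, (starRingEnd ℂ (mass (ψ j) u) * (-(E j : ℂ) * mass (ψ j) u)).re
      = - (E j * ‖mass (ψ j) u‖ ^ 2) := by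
    intro j
    rw [← conj_mul_re, ← Complex.re_ofReal_mul, ← Complex.neg_re]
    congr 1; ring
  simp only [this, Finset.sum_neg_distrib]; ring

theorem bessel (hψ : IsEigenFamily V E ψ) (u : H1 F) :
    ∑ j, ‖mass (ψ j) u‖ ^ 2 ≤ (mass u u).re := by
  rw [mass_self_eq_perp hψ]; linarith [mass_self_nonneg (perp ψ u)]

theorem form_sum_smul (hψ : IsEigenFamily V E ψ) (c : Fin N → ℂ) :
    (form V (∑ j, c j • ψ j) (∑ j, c j • ψ j)).re = - ∑ j, E j * ‖c j‖ ^ 2 := by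
  have h := form_self_eq_perp hψ (∑ j, c j • ψ j)
  have h0 : perp ψ (∑ j, c j • ψ j) = 0 := by
    rw [perp]; simp only [mass_sum_smul hψ, sub_self]
  rw [h, h0]; simp [mass_sum_smul hψ]

theorem mass_sum_smul_self (hψ : IsEigenFamily V E ψ) (c : Fin N → ℂ) :
    (mass (∑ j, c j • ψ j) (∑ j, c j • ψ j)).re = ∑ j, ‖c j‖ ^ 2 := by
  have h := mass_self_eq_perp hψ (∑ j, c j • ψ j)
  have h0 : perp ψ (∑ j, c j • ψ j) = 0 := by
    rw [perp]; simp only [mass_sum_smul hψ, sub_self]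
  rw [h, h0]; simp [mass_sum_smul hψ]

theorem form_self_ge (V : Potential F) {K : ℝ} (hK : ∀ x, ‖V.op x‖ ≤ K) (u : H1 F) :
    (∫ x, ‖u.dv x‖ ^ 2) - K * (mass u u).re ≤ (form V u u).re := by
  rw [form_self_re, mass_self, Complex.ofReal_re, ← integral_const_mul,
    ← integral_sub u.memLp'.integrable_sq_norm (u.memLp.integrable_sq_norm.const_mul _)]
  refine integral_mono (u.memLp'.integrable_sq_norm.sub (u.memLp.integrable_sq_norm.const_mul _))
    (integrable_form_self V u) fun x => ?_
  have h1 := (Complex.abs_re_le_norm _).trans (norm_inner_le_norm (𝕜 := ℂ) (u.fn x) (V.op x (u.fn x)))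
  have h2 := ((V.op x).le_opNorm (u.fn x)).trans
    (mul_le_mul_of_nonneg_right (hK x) (norm_nonneg (u.fn x)))
  have h3 := mul_le_mul_of_nonneg_left h2 (norm_nonneg (u.fn x))
  simp only
  nlinarith [neg_abs_le (⟪u.fn x, V.op x (u.fn x)⟫_ℂ).re]

end H1

end

section

open MeasureTheory Filter Topology Set
open scoped ComplexOrder InnerProductSpace

variable {F : Type*} [NormedAddCommGroup F] [InnerProductSpace ℂ F]

/-- The potential vanishes at infinity. -/
def Potential.Decays (V : Potential F) : Prop :=
  ∀ η : ℝ, 0 < η → ∃ L : ℝ, 0 < L ∧ ∀ x, L ≤ |x| → ‖V.op x‖ ≤ η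

namespace H1
variable {V : Potential F} {N : ℕ} {E : Fin N → ℝ} {ψ : Fin N → H1 F}

theorem mass_self_im (u : H1 F) : mass u u = (((mass u u).re : ℝ) : ℂ) := by
  rw [mass_self, Complex.ofReal_re]

theorem fn_eq_zero_of_mass {u : H1 F} (h : (mass u u).re ≤ 0) (x : ℝ) : u.fn x = 0 := by
  by_contra hx
  exact absurd (mass_self_pos hx) (not_lt.2 h)

theorem form_nonneg_of_mass {u : H1 F} (h : (mass u u).re ≤ 0) : 0 ≤ (form V u u).re := by
  rw [form_self_re]
  refine integral_nonneg fun x => ?_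
  simp [fn_eq_zero_of_mass h x]

theorem exists_normalize {u : H1 F} (h : 0 < (mass u u).re) : ∃ c : ℂ, c ≠ 0 ∧
    mass (c • u) (c • u) = 1 ∧ (form V (c • u) (c • u)).re = (form V u u).re / (mass u u).re := by
  set m := (mass u u).re with hm
  have e : ∀ z : ℂ, (starRingEnd ℂ) (((√m)⁻¹ : ℝ) : ℂ) * ((((√m)⁻¹ : ℝ) : ℂ) * z)
      = ((m⁻¹ : ℝ) : ℂ) * z := by
    intro z
    rw [Complex.conj_ofReal, ← mul_assoc, ← Complex.ofReal_mul, ← mul_inv, Real.mul_self_sqrt h.le]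
  refine ⟨(((√m)⁻¹ : ℝ) : ℂ), by simp [(Real.sqrt_pos.2 h).ne'], ?_, ?_⟩
  · rw [map_smul, LinearMap.map_smulₛₗ, LinearMap.smul_apply, smul_eq_mul, smul_eq_mul, mul_left_comm, e,
      mass_self_im, ← hm, ← Complex.ofReal_mul, inv_mul_cancel₀ h.ne', Complex.ofReal_one]
  · rw [map_smul, LinearMap.map_smulₛₗ, LinearMap.smul_apply, smul_eq_mul, smul_eq_mul, mul_left_comm, e,
      Complex.re_ofReal_mul]
    field_simp

theorem IsEigen.smul {e : ℝ} {u : H1 F} (h : IsEigen V e u) (c : ℂ) : IsEigen V e (c • u) := by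
  refine ⟨fun x => (h.1 x).const_smul c, fun x => ((h.2 x).const_smul c).congr_deriv ?_⟩
  simp only [fn_smul, map_smul, smul_add, smul_smul, mul_comm]

theorem form_self_ge_split {K η L : ℝ} (hK : ∀ x, ‖V.op x‖ ≤ K) (hη : 0 ≤ η)
    (hL : ∀ x, L ≤ |x| → ∀ v, -η * ‖v‖ ^ 2 ≤ (⟪v, V.op x v⟫_ℂ).re) (u : H1 F) :
    (∫ x, ‖u.dv x‖ ^ 2) - K * (∫ x in Icc (-L) L, ‖u.fn x‖ ^ 2) - η * (mass u u).re
      ≤ (form V u u).re := by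
  have hK0 : 0 ≤ K := (norm_nonneg _).trans (hK 0)
  have i1 := u.memLp'.integrable_sq_norm
  have i2 := u.memLp.integrable_sq_norm
  have i3 := i2.indicator (measurableSet_Icc (a := -L) (b := L))
  rw [form_self_re, mass_self, Complex.ofReal_re, ← integral_indicator measurableSet_Icc,
    ← integral_const_mul, ← integral_const_mul, ← integral_sub i1 (i3.const_mul _),
    ← integral_sub (f := fun x => ‖u.dv x‖ ^ 2 - K * (Icc (-L) L).indicator
      (fun x => ‖u.fn x‖ ^ 2) x) (i1.sub (i3.const_mul _)) (i2.const_mul _)]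
  refine integral_mono ((i1.sub (i3.const_mul _)).sub (i2.const_mul _))
    (integrable_form_self V u) fun x => ?_
  simp only
  by_cases hx : x ∈ Icc (-L) L
  · rw [indicator_of_mem hx]
    have h1 := (Complex.abs_re_le_norm _).trans
      (norm_inner_le_norm (𝕜 := ℂ) (u.fn x) (V.op x (u.fn x)))
    have h2 := ((V.op x).le_opNorm (u.fn x)).trans
      (mul_le_mul_of_nonneg_right (hK x) (norm_nonneg (u.fn x)))
    have h3 := mul_le_mul_of_nonneg_left h2 (norm_nonneg (u.fn x))
    nlinarith [neg_abs_le (⟪u.fn x, V.op x (u.fn x)⟫_ℂ).re, sq_nonneg ‖u.fn x‖,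
      mul_nonneg hη (sq_nonneg ‖u.fn x‖)]
  · rw [indicator_of_notMem hx]
    have : L ≤ |x| := by
      by_contra! hc
      exact hx ⟨(abs_lt.1 hc).1.le, (abs_lt.1 hc).2.le⟩
    linarith [hL x this (u.fn x)]

theorem neg_mul_sq_le_re_inner {A : F →L[ℂ] F} {η : ℝ} (h : ‖A‖ ≤ η) (v : F) :
    -η * ‖v‖ ^ 2 ≤ (⟪v, A v⟫_ℂ).re := by
  have h1 := (Complex.abs_re_le_norm _).trans (norm_inner_le_norm (𝕜 := ℂ) v (A v))
  have h2 := (A.le_opNorm v).trans (mul_le_mul_of_nonneg_right h (norm_nonneg v))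
  have h3 := mul_le_mul_of_nonneg_left h2 (norm_nonneg v)
  nlinarith [neg_abs_le (⟪v, A v⟫_ℂ).re]

/-- Weak limits of approximate critical points are eigenfunctions. -/
theorem exists_second_deriv_of_weak_limit [FiniteDimensional ℂ F] {lam : ℝ} {u : ℕ → H1 F}
    {v : ℝ → F} {C : ℝ} (hC : ∀ k, ∫ x, ‖(u k).fn x‖ ^ 2 ≤ C) (hvc : Continuous v)
    (hv : MemLp v 2) (hlim : ∀ x, Tendsto (fun k => (u k).fn x) atTop (𝓝 (v x)))
    (hcrit : ∀ w : H1 F, Tendsto (fun k => form V w (u k) - (lam : ℂ) * mass w (u k)) atTop (𝓝 0)) :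
    ∃ v' : ℝ → F, (∀ x, HasDerivAt v (v' x) x) ∧
      ∀ x, HasDerivAt v' (V.op x (v x) + ((-lam : ℝ) : ℂ) • v x) x := by
  have : CompleteSpace F := FiniteDimensional.complete ℂ F
  have hz : Continuous fun x => V.op x (v x) + ((-lam : ℝ) : ℂ) • v x :=
    (V.cont.clm_apply hvc).add (hvc.const_smul _)
  refine exists_second_deriv_of_tent hvc hz fun x h hh e => ?_
  set τ := H1.tent x h hh e with hτ
  have t1 : ∀ k, ∫ y, ⟪τ.dv y, (u k).dv y⟫_ℂ
      = ⟪e, (2 : ℂ) • (u k).fn x - (u k).fn (x - h) - (u k).fn (x + h)⟫_ℂ := by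
    intro k
    obtain ⟨s, hs, hd⟩ := (u k).exists_deriv
    exact integral_tentDeriv hs (u k).continuous hd
      ((u k).memLp'.locallyIntegrable (by norm_num)) hh e
  have t2 : ∀ k, ∫ y, ⟪τ.fn y, V.op y ((u k).fn y)⟫_ℂ = ∫ y, ⟪V.op y (τ.fn y), (u k).fn y⟫_ℂ :=
    fun k => by simp only [V.symm]
  have l1 : Tendsto (fun k => ∫ y, ⟪τ.dv y, (u k).dv y⟫_ℂ) atTop
      (𝓝 ⟪e, (2 : ℂ) • v x - v (x - h) - v (x + h)⟫_ℂ) := by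
    simp only [t1]
    exact tendsto_const_nhds.inner ((((hlim x).const_smul _).sub (hlim _)).sub (hlim _))
  have l2 := tendsto_integral_inner_of_bounded (V.memLp τ.memLp) (fun k => (u k).memLp) hC hv hlim
  have l3 := tendsto_integral_inner_of_bounded τ.memLp (fun k => (u k).memLp) hC hv hlim
  have l4 := (l1.add l2).sub (l3.const_mul (lam : ℂ))
  have e4 : ∀ k, form V τ (u k) - (lam : ℂ) * mass τ (u k) =
      (∫ y, ⟪τ.dv y, (u k).dv y⟫_ℂ) + (∫ y, ⟪V.op y (τ.fn y), (u k).fn y⟫_ℂ)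
        - (lam : ℂ) * ∫ y, ⟪τ.fn y, (u k).fn y⟫_ℂ := fun k => by
    rw [form_apply, mass_apply, integral_add (τ.memLp'.integrable_inner_two (u k).memLp')
      (τ.memLp.integrable_inner_two (V.memLp (u k).memLp)), t2]
  have h0 := tendsto_nhds_unique (hcrit τ) (l4.congr fun k => (e4 k).symm)
  have e5 : ∫ y, ⟪((_root_.tent x h y : ℝ) : ℂ) • e, V.op y (v y) + ((-lam : ℝ) : ℂ) • v y⟫_ℂ =
      (∫ y, ⟪V.op y (τ.fn y), v y⟫_ℂ) - (lam : ℂ) * ∫ y, ⟪τ.fn y, v y⟫_ℂ := by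
    rw [← integral_const_mul, ← integral_sub ((V.memLp τ.memLp).integrable_inner_two hv)
      ((τ.memLp.integrable_inner_two hv).const_mul _)]
    congr 1; ext y
    rw [V.symm, inner_add_right, inner_smul_right]
    push_cast
    change _ = ⟪((_root_.tent x h y : ℝ) : ℂ) • e, _⟫_ℂ - _ * ⟪((_root_.tent x h y : ℝ) : ℂ) • e, _⟫_ℂ
    ring
  rw [e5]
  linear_combination -h0

theorem exists_eigen [FiniteDimensional ℂ F] (hV : V.Decays) (hψ : IsEigenFamily V E ψ) {ε : ℝ}
    (hε : 0 < ε) {φ : H1 F} (hφ : ∀ j, mass (ψ j) φ = 0) (hm : 0 < (mass φ φ).re)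
    (hf : (form V φ φ).re ≤ -ε * (mass φ φ).re) :
    ∃ (e : ℝ) (χ : H1 F), ε ≤ e ∧ IsEigen V e χ ∧ mass χ χ = 1 ∧ ∀ j, mass (ψ j) χ = 0 := by
  have : CompleteSpace F := FiniteDimensional.complete ℂ F
  obtain ⟨K, hK⟩ := V.bdd
  have hK0 : 0 ≤ K := (norm_nonneg _).trans (hK 0)
  let S : Submodule ℂ (H1 F) :=
    { carrier := {u | ∀ j, mass (ψ j) u = 0}
      add_mem' := fun {a b} ha hb j => by rw [map_add, ha j, hb j, add_zero]
      zero_mem' := fun j => map_zero _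
      smul_mem' := fun c a ha j => by rw [map_smul, ha j, smul_zero] }
  set Q : Set ℝ := {q | ∃ u ∈ S, mass u u = 1 ∧ q = (form V u u).re} with hQ
  have hQb : BddBelow Q := ⟨-K, by
    rintro q ⟨u, -, hu, rfl⟩
    have := form_self_ge V hK u
    rw [hu] at this
    have h0 : 0 ≤ ∫ x, ‖u.dv x‖ ^ 2 := integral_nonneg fun x => by positivity
    simp at this; linarith⟩
  obtain ⟨c0, hc0, hc1, hc2⟩ := exists_normalize (V := V) hm
  have hφQ : (form V φ φ).re / (mass φ φ).re ∈ Q := ⟨c0 • φ, S.smul_mem _ hφ, hc1, hc2.symm⟩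
  set lam := sInf Q with hlam
  have hlamε : lam ≤ -ε := (csInf_le hQb hφQ).trans ((div_le_iff₀ hm).2 hf)
  set p : H1 F →ₗ⋆[ℂ] H1 F →ₗ[ℂ] ℂ := form V - (lam : ℂ) • mass with hp
  have hpa : ∀ u v, p u v = form V u v - (lam : ℂ) * mass u v := fun u v => rfl
  have hps : ∀ u v, starRingEnd ℂ (p u v) = p v u := fun u v => by
    rw [hpa, hpa, map_sub, map_mul, form_symm, mass_symm, Complex.conj_ofReal]
  have hpre : ∀ u, (p u u).re = (form V u u).re - lam * (mass u u).re := fun u => by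
    rw [hpa, Complex.sub_re, Complex.re_ofReal_mul]
  have hpp : ∀ u ∈ S, 0 ≤ (p u u).re := by
    intro u hu
    rw [hpre]
    rcases le_or_gt (mass u u).re 0 with h | h
    · have h2 := form_nonneg_of_mass (V := V) h
      have h3 := mass_self_nonneg u
      rw [le_antisymm h h3]; linarith
    · obtain ⟨c, -, h1, h2⟩ := exists_normalize (V := V) h
      have := csInf_le hQb ⟨c • u, S.smul_mem _ hu, h1, h2.symm⟩
      rw [← hlam, le_div_iff₀ h] at this
      linarith
  have hseq : ∀ k : ℕ, ∃ u ∈ S, mass u u = 1 ∧ (form V u u).re < lam + 1 / ((k : ℝ) + 1) := by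
    intro k
    obtain ⟨q, ⟨u, hu, h1, rfl⟩, h⟩ := exists_lt_of_csInf_lt ⟨_, hφQ⟩
      (show sInf Q < lam + 1 / ((k : ℝ) + 1) by rw [← hlam]; linarith [Nat.one_div_pos_of_nat (α := ℝ) (n := k)])
    exact ⟨u, hu, h1, h⟩
  choose u huS hu1 hu2 using hseq
  have hk1 : ∀ k : ℕ, 1 / ((k : ℝ) + 1) ≤ 1 := fun k => by
    rw [div_le_one (by positivity)]; linarith [(Nat.cast_nonneg k : (0:ℝ) ≤ k)]
  have hfn : ∀ k, ∫ x, ‖(u k).fn x‖ ^ 2 = 1 := fun k => by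
    have := hu1 k; rw [mass_self] at this; exact_mod_cast this
  have hdv : ∀ k, ∫ x, ‖(u k).dv x‖ ^ 2 ≤ 1 + K := fun k => by
    have := form_self_ge V hK (u k)
    rw [hu1, Complex.one_re] at this
    linarith [hu2 k, hk1 k]
  obtain ⟨s, v, hs, hvc, hv, hlim⟩ := exists_subseq_tendsto u (C := 1 + K)
    (fun k => by rw [hfn]; linarith) hdv
  have hlim0 : Tendsto (fun k : ℕ => 1 / (((s k : ℕ) : ℝ) + 1)) atTop (𝓝 0) :=
    tendsto_one_div_add_atTop_nhds_zero_nat.comp hs.tendsto_atTop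
  have hcrit : ∀ w : H1 F,
      Tendsto (fun k => form V w (u (s k)) - (lam : ℂ) * mass w (u (s k))) atTop (𝓝 0) := by
    intro w
    have e1 : ∀ k, p (u k) (perp ψ w) = p (u k) w := fun k => map_perp_eq _ fun i => by
      rw [hpa, mass_eq_zero_symm (huS k i), ← form_symm, (hψ.eig i).form_eq, huS k i]
      simp
    have b1 : ∀ k, ‖form V w (u (s k)) - (lam : ℂ) * mass w (u (s k))‖ ^ 2
        ≤ 1 / (((s k : ℕ) : ℝ) + 1) * (p (perp ψ w) (perp ψ w)).re := by
      intro k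
      rw [← hpa, ← hps, RCLike.norm_conj, ← e1]
      have hw : perp ψ w ∈ S := fun j => mass_perp hψ w j
      refine (sq_norm_sesq_le p S hps hpp (huS _) hw).trans
        (mul_le_mul_of_nonneg_right ?_ (hpp _ hw))
      rw [hpre, hu1, Complex.one_re]; linarith [hu2 (s k)]
    rw [tendsto_zero_iff_norm_tendsto_zero]
    have l1 := squeeze_zero (fun k => sq_nonneg _) b1 (by simpa using hlim0.mul_const _)
    have l2 := l1.sqrt
    simpa using l2
  obtain ⟨v', hv', hv''⟩ := exists_second_deriv_of_weak_limit (C := 1)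
    (fun k => (hfn (s k)).le) hvc hv hlim hcrit
  have hv2 : MemLp (fun x => V.op x (v x) + ((-lam : ℝ) : ℂ) • v x) 2 :=
    (V.memLp hv).add (hv.const_smul _)
  set χ : H1 F := H1.mk v v' hvc ⟨∅, countable_empty, fun x _ => hv' x⟩ hv
    (memLp_deriv_of_second_deriv hv' hv'' hv hv2) with hχ
  have hχe : IsEigen V (-lam) χ := ⟨hv', hv''⟩
  have hne : ∃ x, v x ≠ 0 := by
    by_contra! h0
    obtain ⟨L, hL0, hL⟩ := hV (ε / 2) (by positivity)
    have b : ∀ k, ε / 2 - 1 / (((s k : ℕ) : ℝ) + 1)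
        ≤ K * ∫ x in Icc (-L) L, ‖(u (s k)).fn x‖ ^ 2 := by
      intro k
      have := form_self_ge_split (η := ε / 2) hK (by positivity)
        (fun x hx w => neg_mul_sq_le_re_inner (hL x hx) w) (u (s k))
      rw [hu1, Complex.one_re] at this
      have h0 : 0 ≤ ∫ x, ‖(u (s k)).dv x‖ ^ 2 := integral_nonneg fun x => by positivity
      linarith [hu2 (s k)]
    have l1 : Tendsto (fun k => ∫ x in Icc (-L) L, ‖(u (s k)).fn x‖ ^ 2) atTop
        (𝓝 (∫ x in Icc (-L) L, (0 : ℝ))) := by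
      refine tendsto_integral_of_dominated_convergence (fun _ => 1 + (1 + K))
        (fun k => ((u (s k)).continuous.norm.pow 2).aestronglyMeasurable) (by simp)
        (fun k => ae_of_all _ fun x => ?_) (ae_of_all _ fun x => ?_)
      · rw [Real.norm_of_nonneg (by positivity)]
        exact (sq_norm_le _ x).trans (add_le_add (hfn _).le (hdv _))
      · have := ((hlim x).norm).pow 2
        simpa [h0] using this
    have l2 := le_of_tendsto_of_tendsto' (hlim0.const_sub (ε / 2)) (l1.const_mul K) b
    simp at l2; linarith
  obtain ⟨x0, hx0⟩ := hne
  obtain ⟨c, hc0, hc1, -⟩ := exists_normalize (V := V) (mass_self_pos (u := χ) hx0)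
  refine ⟨-lam, c • χ, by linarith, hχe.smul c, hc1, fun j => ?_⟩
  rw [map_smul]
  have l := tendsto_integral_inner_of_bounded (ψ j).memLp (fun k => (u (s k)).memLp)
    (fun k => (hfn (s k)).le) hv hlim
  have : mass (ψ j) χ = 0 := by
    refine tendsto_nhds_unique l ?_
    have : ∀ k, ∫ x, ⟪(ψ j).fn x, (u (s k)).fn x⟫_ℂ = 0 := fun k => huS (s k) j
    simp only [this, tendsto_const_nhds]
  rw [this, smul_zero]

/-- Families of eigenfunctions below a suitable threshold have bounded cardinality. -/
theorem exists_card_bound [FiniteDimensional ℂ F] (V : Potential F) {ε L : ℝ} (hε : 0 ≤ ε)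
    (hL : ∀ x, L ≤ |x| → ∀ v, -ε * ‖v‖ ^ 2 ≤ (⟪v, V.op x v⟫_ℂ).re) :
    ∃ M : ℕ, ∀ (N : ℕ) (E : Fin N → ℝ) (ψ : Fin N → H1 F), IsEigenFamily V E ψ →
      (∀ j, ε < E j) → N ≤ M := by
  have : CompleteSpace F := FiniteDimensional.complete ℂ F
  obtain ⟨K, hK⟩ := V.bdd
  have hK0 : 0 ≤ K := (norm_nonneg _).trans (hK 0)
  set h : ℝ := 1 / (K * (2 * |L|) + 1) with hh
  have hh0 : 0 < h := by positivity
  obtain ⟨t, -, ht, hcov⟩ := (isCompact_Icc (a := -L) (b := L)).finite_cover_balls hh0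
  have : Fintype t := ht.fintype
  refine ⟨Module.finrank ℂ (t → F), fun N E ψ hψ hE => ?_⟩
  let T : (Fin N → ℂ) →ₗ[ℂ] (t → F) :=
    { toFun := fun c y => (∑ j, c j • ψ j).fn y
      map_add' := fun c d => by
        ext y; simp only [Pi.add_apply, add_smul, Finset.sum_add_distrib, fn_add]
      map_smul' := fun a c => by
        ext y; simp only [Pi.smul_apply, smul_eq_mul, mul_smul, ← Finset.smul_sum, fn_smul,
          RingHom.id_apply] }
  have hT : Function.Injective T := by
    rw [injective_iff_map_eq_zero]
    intro c hc
    set u := ∑ j, c j • ψ j with hu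
    have hnode : ∀ y ∈ t, u.fn y = 0 := fun y hy => congrFun hc ⟨y, hy⟩
    set D := ∫ x, ‖u.dv x‖ ^ 2 with hD
    have hD0 : 0 ≤ D := integral_nonneg fun x => by positivity
    have hb : ∀ x ∈ Icc (-L) L, ‖u.fn x‖ ^ 2 ≤ h * D := by
      intro x hx
      obtain ⟨y, hy, hxy⟩ := mem_iUnion₂.1 (hcov hx)
      have := sq_norm_sub_le u y x
      rw [hnode y hy, sub_zero] at this
      exact this.trans (mul_le_mul_of_nonneg_right (le_of_lt hxy) hD0)
    have hI : ∫ x in Icc (-L) L, ‖u.fn x‖ ^ 2 ≤ 2 * |L| * (h * D) := by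
      have h1 := setIntegral_mono_on (u.memLp.integrable_sq_norm.integrableOn)
        (integrableOn_const (C := h * D) (by simp)) measurableSet_Icc hb
      refine h1.trans ?_
      rw [setIntegral_const, smul_eq_mul, Real.volume_real_Icc]
      refine mul_le_mul_of_nonneg_right ?_ (by positivity)
      rw [max_le_iff]
      exact ⟨by linarith [le_abs_self L], by positivity⟩
    have h1 := form_self_ge_split hK hε hL u
    have h2 := form_sum_smul hψ c
    have h3 := mass_sum_smul_self hψ c
    rw [← hu] at h2 h3
    rw [h2, h3] at h1
    have h4 : K * (2 * |L| * (h * D)) ≤ D := by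
      have : K * (2 * |L|) * h ≤ 1 := by
        rw [hh, mul_one_div, div_le_one (by positivity)]; linarith
      nlinarith
    have h5 := (mul_le_mul_of_nonneg_left hI hK0).trans h4
    have h6 : ∑ j, (E j - ε) * ‖c j‖ ^ 2 ≤ 0 := by
      simp only [sub_mul, Finset.sum_sub_distrib, ← Finset.mul_sum]; linarith
    have h7 := (Finset.sum_eq_zero_iff_of_nonneg (fun j _ =>
      mul_nonneg (sub_nonneg.2 (hE j).le) (sq_nonneg ‖c j‖))).1
      (le_antisymm h6 (Finset.sum_nonneg fun j _ =>
        mul_nonneg (sub_nonneg.2 (hE j).le) (sq_nonneg ‖c j‖)))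
    ext j
    have := h7 j (Finset.mem_univ j)
    have h8 : E j - ε ≠ 0 := (sub_pos.2 (hE j)).ne'
    simpa [h8] using this
  simpa using LinearMap.finrank_le_finrank_of_injective hT

/-- Existence of a maximal orthonormal family of eigenfunctions below the threshold `-ε`. -/
theorem exists_maximal_family [FiniteDimensional ℂ F] (hV : V.Decays) {ε L : ℝ} (hε : 0 ≤ ε)
    (hL : ∀ x, L ≤ |x| → ∀ v, -ε * ‖v‖ ^ 2 ≤ (⟪v, V.op x v⟫_ℂ).re) :
    ∃ (N : ℕ) (E : Fin N → ℝ) (ψ : Fin N → H1 F), IsEigenFamily V E ψ ∧ (∀ j, ε < E j) ∧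
      ∀ φ : H1 F, -(∑ j, E j * ‖mass (ψ j) φ‖ ^ 2) - ε * (mass φ φ).re ≤ (form V φ φ).re := by
  obtain ⟨M, hM⟩ := exists_card_bound V hε hL
  let P : ℕ → Prop := fun N => ∃ (E : Fin N → ℝ) (ψ : Fin N → H1 F), IsEigenFamily V E ψ ∧
    ∀ j, ε < E j
  have hP0 : P 0 := ⟨Fin.elim0, Fin.elim0, ⟨fun j => j.elim0, fun j => j.elim0⟩, fun j => j.elim0⟩
  have hPM : ∀ N, P N → N ≤ M := fun N ⟨E, ψ, h1, h2⟩ => hM N E ψ h1 h2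
  classical
  have hN : P (Nat.findGreatest P M) := Nat.findGreatest_spec (Nat.zero_le M) hP0
  obtain ⟨E, ψ, hψ, hE⟩ := hN
  refine ⟨_, E, ψ, hψ, hE, fun φ => ?_⟩
  by_contra! hc
  have h1 := form_self_eq_perp hψ φ
  have h2 := mass_self_eq_perp hψ φ
  set w := perp ψ φ with hw
  have h3 : (form V w w).re < - ε * (mass w w).re := by
    have : 0 ≤ ∑ j, ‖mass (ψ j) φ‖ ^ 2 := Finset.sum_nonneg fun j _ => by positivity
    rw [h2] at hc
    linarith [mul_nonneg hε this]
  have hm : 0 < (mass w w).re := by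
    by_contra! h
    have h4 := form_nonneg_of_mass (V := V) h
    rw [le_antisymm h (mass_self_nonneg w)] at h3
    linarith
  set ε' := -((form V w w).re / (mass w w).re) with hε'
  have hlt : ε < ε' := by
    rw [hε', lt_neg, div_lt_iff₀ hm]; exact h3
  obtain ⟨e, χ, he, hχ, hχ1, hχ0⟩ := exists_eigen hV hψ (hε.trans_lt hlt) (mass_perp hψ φ) hm
    (by rw [hε', neg_neg, div_mul_cancel₀ _ hm.ne'])
  have hnew : P (Nat.findGreatest P M + 1) := by
    refine ⟨Fin.cons e E, Fin.cons χ ψ, ⟨fun j => ?_, fun i j => ?_⟩, fun j => ?_⟩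
    · refine Fin.cases ?_ (fun j => ?_) j
      · simpa using hχ
      · simpa using hψ.eig j
    · refine Fin.cases ?_ (fun i => ?_) i <;> refine Fin.cases ?_ (fun j => ?_) j
      · simpa using hχ1
      · simpa [Fin.succ_ne_zero, eq_comm] using mass_eq_zero_symm (hχ0 j)
      · simpa [Fin.succ_ne_zero] using hχ0 i
      · simpa [Fin.succ_inj] using hψ.ortho i j
    · refine Fin.cases ?_ (fun j => ?_) j
      · simpa using hlt.trans_le he
      · simpa using hE j
  have := Nat.le_findGreatest (hPM _ hnew) hnew
  omega

end H1

end

section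

open MeasureTheory Filter Topology Set
open scoped ComplexOrder InnerProductSpace

variable {F : Type*} [NormedAddCommGroup F] [InnerProductSpace ℂ F]

/-- The rank one operator `z ↦ ⟪v, z⟫ u`. -/
noncomputable def rk (u v : F) : F →L[ℂ] F := InnerProductSpace.rankOne ℂ u v

@[simp] theorem rk_apply (u v z : F) : rk u v z = ⟪v, z⟫_ℂ • u := rfl

theorem rk_symm (u v x y : F) : ⟪rk u v x, y⟫_ℂ = ⟪x, rk v u y⟫_ℂ := by
  simp [rk]

theorem isBoundedBilinearMap_rk : IsBoundedBilinearMap ℝ fun p : F × F => rk p.1 p.2 where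
  add_left := fun x y z => by simp [rk]
  smul_left := fun c x y => by ext z; exact smul_comm _ _ _
  add_right := fun x y z => by simp [rk]
  smul_right := fun c x y => by
    ext z
    rw [rk_apply, ← Complex.coe_smul c y, inner_smul_left, _root_.smul_apply,
      rk_apply, Complex.conj_ofReal, ← smul_smul, Complex.coe_smul]
  bound := ⟨1, one_pos, fun x y => by simp [rk]⟩

theorem continuous_rk {X : Type*} [TopologicalSpace X] {f g : X → F} (hf : Continuous f)
    (hg : Continuous g) : Continuous fun x => rk (f x) (g x) :=
  isBoundedBilinearMap_rk.continuous.comp (hf.prodMk hg)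

theorem HasDerivAt.rk {f g : ℝ → F} {f' g' : F} {x : ℝ} (hf : HasDerivAt f f' x)
    (hg : HasDerivAt g g' x) :
    HasDerivAt (fun x => _root_.rk (f x) (g x)) (_root_.rk (f x) g' + _root_.rk f' (g x)) x := by
  exact (isBoundedBilinearMap_rk.hasFDerivAt (f x, g x)).comp_hasDerivAt x (hf.prodMk hg)

theorem mul_rk (A : F →L[ℂ] F) (u v : F) : A * rk u v = rk (A u) v := by ext z; simp

theorem rk_mul_rk (u v x y : F) : rk u v * rk x y = ⟪v, x⟫_ℂ • rk u y := by
  ext z; simp [smul_smul, mul_comm]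

section trace
variable [FiniteDimensional ℂ F]

/-- The trace of an operator. -/
noncomputable def tr : (F →L[ℂ] F) →L[ℂ] ℂ :=
  LinearMap.toContinuousLinearMap
    ((LinearMap.trace ℂ F).comp (ContinuousLinearMap.coeLM ℂ))

theorem tr_apply (A : F →L[ℂ] F) : tr A = LinearMap.trace ℂ F A := rfl

theorem tr_mul_comm (A B : F →L[ℂ] F) : tr (A * B) = tr (B * A) := LinearMap.trace_mul_comm ℂ _ _

@[simp] theorem tr_rk (u v : F) : tr (rk u v) = ⟪v, u⟫_ℂ := InnerProductSpace.trace_rankOne u v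

theorem tr_mul_rk (A : F →L[ℂ] F) (u v : F) : tr (A * rk u v) = ⟪v, A u⟫_ℂ := by
  rw [mul_rk, tr_rk]

theorem tr_sq_add_sub (A X : F →L[ℂ] F) :
    tr ((A + X) * (A + X)) - tr (A * A) = 2 * tr (A * X) + tr (X * X) := by
  rw [mul_add, add_mul, add_mul, map_add, map_add, map_add, tr_mul_comm X A]; ring

theorem tr_cube_add_sub (A X : F →L[ℂ] F) :
    tr ((A + X) * (A + X) * (A + X)) - tr (A * A * A)
      = 3 * tr (A * A * X) + 3 * tr (A * (X * X)) + tr (X * X * X) := by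
  have e1 : tr (A * X * A) = tr (A * A * X) := by rw [tr_mul_comm, mul_assoc]
  have e2 : tr (X * A * A) = tr (A * A * X) := by rw [mul_assoc, tr_mul_comm]
  have e3 : tr (X * A * X) = tr (A * (X * X)) := by rw [mul_assoc, tr_mul_comm, mul_assoc]
  have e4 : tr (X * X * A) = tr (A * (X * X)) := by rw [tr_mul_comm]
  simp only [mul_add, add_mul, map_add, e1, e2, e3, e4, mul_assoc A X X]; ring

/-- Derivatives of the quantities attached to a solution of the Schrödinger equation. -/
structure StripPoint (A : F →L[ℂ] F) (u v : F) (p σ : ℝ) : Prop where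
  symm : ∀ x y, ⟪A x, y⟫_ℂ = ⟪x, A y⟫_ℂ
  uu : ⟪u, u⟫_ℂ = (p : ℂ)
  uv : ⟪u, v⟫_ℂ = (σ : ℂ)
  vu : ⟪v, u⟫_ℂ = (σ : ℂ)

/-- The vector `η` with `2 (ψψ*/g)' = ηψ* + ψη*`. -/
noncomputable def etaVec (γ p : ℝ) (u v : F) : F := ((2 * γ : ℝ) : ℂ) • v + ((γ ^ 2 * p : ℝ) : ℂ) • u

/-- The derivative of `etaVec`. -/
noncomputable def etaVec' (γ p σ E : ℝ) (A : F →L[ℂ] F) (u v : F) : F :=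
  ((2 * γ : ℝ) : ℂ) • (A u) + ((3 * γ ^ 2 * p : ℝ) : ℂ) • v
    + ((2 * γ * E + 2 * γ ^ 3 * p ^ 2 + 2 * γ ^ 2 * σ : ℝ) : ℂ) • u

theorem tr_sq_strip {A : F →L[ℂ] F} {u v : F} {p σ γ : ℝ} (h : StripPoint A u v p σ) :
    tr ((A + (rk (etaVec γ p u v) u + rk u (etaVec γ p u v)))
      * (A + (rk (etaVec γ p u v) u + rk u (etaVec γ p u v)))) - tr (A * A)
    = 4 * γ * (⟪u, A v⟫_ℂ + ⟪v, A u⟫_ℂ) + 4 * γ ^ 2 * p * ⟪u, A u⟫_ℂ + 8 * γ ^ 2 * σ ^ 2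
      + 8 * γ ^ 2 * p * ⟪v, v⟫_ℂ + 16 * γ ^ 3 * p ^ 2 * σ + 4 * γ ^ 4 * p ^ 4 := by
  rw [tr_sq_add_sub]
  simp only [mul_add, add_mul, map_add, tr_mul_rk, rk_mul_rk, map_smul, tr_rk, smul_eq_mul]
  simp only [etaVec, inner_add_left, inner_add_right, inner_smul_left, inner_smul_right, map_add,
    map_smul, Complex.conj_ofReal, h.uu, h.uv, h.vu]
  push_cast
  ring

/-- The derivative of `2 (ψψ*/g)'`. -/
noncomputable def stripDeriv (γ p σ E : ℝ) (A : F →L[ℂ] F) (u v : F) : F →L[ℂ] F :=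
  (rk (etaVec γ p u v) v + rk (etaVec' γ p σ E A u v) u)
    + (rk u (etaVec' γ p σ E A u v) + rk v (etaVec γ p u v))

theorem tr_strip_five {A A' : F →L[ℂ] F} {u v : F} {p σ γ E : ℝ} (h : StripPoint A u v p σ) :
    tr ((A' + stripDeriv γ p σ E A u v) * (A' + stripDeriv γ p σ E A u v)) - tr (A' * A')
      + 2 * (tr ((A + (rk (etaVec γ p u v) u + rk u (etaVec γ p u v)))
      * (A + (rk (etaVec γ p u v) u + rk u (etaVec γ p u v)))
      * (A + (rk (etaVec γ p u v) u + rk u (etaVec γ p u v)))) - tr (A * A * A)) =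
    8 * γ * ⟪v, A' v⟫_ℂ + 4 * γ * ⟪u, A' (A u)⟫_ℂ + 8 * γ * E * ⟪u, A' u⟫_ℂ
      + 4 * γ * ⟪u, A (A' u)⟫_ℂ + 12 * γ * ⟪u, A (A v)⟫_ℂ + 12 * γ * ⟪v, A (A u)⟫_ℂ
      + 8 * γ ^ 2 * p * (⟪v, A' u⟫_ℂ + ⟪u, A' v⟫_ℂ) + 32 * γ ^ 2 * p * E * ⟪u, A u⟫_ℂ
      + 20 * γ ^ 2 * p * ⟪u, A (A u)⟫_ℂ + 24 * γ ^ 2 * p * ⟪v, A v⟫_ℂ + 16 * γ ^ 2 * p ^ 2 * E ^ 2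
      + 32 * γ ^ 2 * E * σ ^ 2 + 8 * γ ^ 2 * σ * ⟪u, A' u⟫_ℂ
      + 40 * γ ^ 2 * σ * (⟪v, A u⟫_ℂ + ⟪u, A v⟫_ℂ) + 24 * γ ^ 2 * ⟪v, v⟫_ℂ * ⟪u, A u⟫_ℂ
      + 16 * γ ^ 2 * ⟪v, v⟫_ℂ ^ 2 + 8 * γ ^ 2 * ⟪u, A u⟫_ℂ ^ 2 + 160 * γ ^ 3 * p * σ * ⟪v, v⟫_ℂ
      + 112 * γ ^ 3 * p * σ * ⟪u, A u⟫_ℂ + 96 * γ ^ 3 * p ^ 2 * E * σ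
      + 8 * γ ^ 3 * p ^ 2 * ⟪u, A' u⟫_ℂ + 40 * γ ^ 3 * p ^ 2 * (⟪v, A u⟫_ℂ + ⟪u, A v⟫_ℂ)
      + 64 * γ ^ 3 * σ ^ 3 + 288 * γ ^ 4 * p ^ 2 * σ ^ 2 + 80 * γ ^ 4 * p ^ 3 * ⟪v, v⟫_ℂ
      + 56 * γ ^ 4 * p ^ 3 * ⟪u, A u⟫_ℂ + 32 * γ ^ 4 * p ^ 4 * E + 192 * γ ^ 5 * p ^ 4 * σ
      + 32 * γ ^ 6 * p ^ 6 := by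
  rw [tr_sq_add_sub, tr_cube_add_sub]
  simp only [stripDeriv, mul_add, add_mul, map_add, tr_mul_rk, rk_mul_rk, map_smul, tr_rk, smul_eq_mul,
    smul_mul_assoc, mul_smul_comm]
  simp only [etaVec, etaVec', inner_add_left, inner_add_right, inner_smul_left, inner_smul_right,
    map_add, h.symm, mul_apply_eq_comp,
    map_smul, Complex.conj_ofReal, h.uu, h.uv, h.vu]
  push_cast
  ring

end trace

theorem hasDerivAt_clm_apply {A : ℝ → F →L[ℂ] F} {A' : F →L[ℂ] F} {u : ℝ → F} {u' : F} {x : ℝ}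
    (hA : HasDerivAt A A' x) (hu : HasDerivAt u u' x) :
    HasDerivAt (fun x => A x (u x)) (A' (u x) + A x u') x := by
  have hb : IsBoundedBilinearMap ℝ fun p : (F →L[ℂ] F) × F => p.1 p.2 :=
    { add_left := fun _ _ _ => rfl
      smul_left := fun _ _ _ => rfl
      add_right := fun A _ _ => map_add A _ _
      smul_right := fun c A z => (A.restrictScalars ℝ).map_smul c z
      bound := ⟨1, one_pos, fun A z => by simpa using A.le_opNorm z⟩ }
  exact ((hb.hasFDerivAt (A x, u x)).comp_hasDerivAt x (hA.prodMk hu)).congr_deriv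
    (add_comm _ _)

section flow
variable {A A' : ℝ → F →L[ℂ] F} {u v : ℝ → F} {γ p σ : ℝ → ℝ} {E x : ℝ}

/-- A solution of the Schrödinger equation with the associated scalar functions. -/
structure StripFlow (A : ℝ → F →L[ℂ] F) (u v : ℝ → F) (γ p σ : ℝ → ℝ) (E : ℝ) : Prop where
  symm : ∀ x y z, ⟪A x y, z⟫_ℂ = ⟪y, A x z⟫_ℂ
  uu : ∀ x, ⟪u x, u x⟫_ℂ = (p x : ℂ)
  uv : ∀ x, ⟪u x, v x⟫_ℂ = (σ x : ℂ)
  vu : ∀ x, ⟪v x, u x⟫_ℂ = (σ x : ℂ)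
  du : ∀ x, HasDerivAt u (v x) x
  dv : ∀ x, HasDerivAt v (A x (u x) + (E : ℂ) • u x) x
  dγ : ∀ x, HasDerivAt γ (γ x ^ 2 * p x) x

namespace StripFlow

theorem point (h : StripFlow A u v γ p σ E) (x : ℝ) :
    StripPoint (A x) (u x) (v x) (p x) (σ x) := ⟨h.symm x, h.uu x, h.uv x, h.vu x⟩

theorem dp (h : StripFlow A u v γ p σ E) (x : ℝ) :
    HasDerivAt (fun x => (p x : ℂ)) (2 * σ x) x := by
  have h1 := (h.du x).inner ℂ (h.du x)
  simp only [h.uu, h.uv, h.vu] at h1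
  exact h1.congr_deriv (by ring)

theorem dσ (h : StripFlow A u v γ p σ E) (x : ℝ) :
    HasDerivAt (fun x => (σ x : ℂ)) (⟪v x, v x⟫_ℂ + ⟪u x, A x (u x)⟫_ℂ + E * p x) x := by
  have h1 := (h.du x).inner ℂ (h.dv x)
  simp only [h.uv, inner_add_right, inner_smul_right, h.uu] at h1
  exact h1.congr_deriv (by ring)

theorem dτ (h : StripFlow A u v γ p σ E) (x : ℝ) :
    HasDerivAt (fun x => ⟪v x, v x⟫_ℂ)
      (⟪v x, A x (u x)⟫_ℂ + ⟪u x, A x (v x)⟫_ℂ + 2 * E * σ x) x := by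
  refine ((h.dv x).inner ℂ (h.dv x)).congr_deriv ?_
  simp only [inner_add_right, inner_smul_right, inner_add_left, inner_smul_left, h.uv, h.vu, h.symm,
    Complex.conj_ofReal]
  ring

theorem dγc (h : StripFlow A u v γ p σ E) (x : ℝ) :
    HasDerivAt (fun x => (γ x : ℂ)) ((γ x : ℂ) ^ 2 * p x) x := by
  refine (h.dγ x).ofReal_comp.congr_deriv (by push_cast; ring)

end StripFlow

/-- Boundary term of the first trace formula. -/
noncomputable def theta1 (γ : ℝ) (u : F) : ℂ := 2 * γ * ⟪u, u⟫_ℂ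

/-- Boundary term of the second trace formula. -/
noncomputable def theta3 (E γ : ℝ) (u v : F) : ℂ :=
  4 * γ * ⟪v, v⟫_ℂ - 4 * E * γ * ⟪u, u⟫_ℂ + 4 * γ ^ 2 * ⟪u, u⟫_ℂ * ⟪u, v⟫_ℂ
    + 4 / 3 * γ ^ 3 * ⟪u, u⟫_ℂ ^ 3

/-- Boundary term of the third trace formula. -/
noncomputable def theta5 (E γ : ℝ) (A : F →L[ℂ] F) (u v : F) : ℂ :=
  4 * γ * ⟪A u, A u⟫_ℂ + 8 * γ * ⟪v, A v⟫_ℂ + 8 * E * γ * ⟪u, A u⟫_ℂ - 16 * E * γ * ⟪v, v⟫_ℂ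
    + 8 * γ ^ 2 * ⟪u, v⟫_ℂ * ⟪u, A u⟫_ℂ + 16 * γ ^ 2 * ⟪u, v⟫_ℂ * ⟪v, v⟫_ℂ
    + 16 * E ^ 2 * γ * ⟪u, u⟫_ℂ + 8 * γ ^ 2 * ⟪u, u⟫_ℂ * (⟪u, A v⟫_ℂ + ⟪v, A u⟫_ℂ)
    + 32 * γ ^ 3 * ⟪u, u⟫_ℂ * ⟪u, v⟫_ℂ ^ 2 + 8 * γ ^ 3 * ⟪u, u⟫_ℂ ^ 2 * ⟪u, A u⟫_ℂ
    + 16 * γ ^ 3 * ⟪u, u⟫_ℂ ^ 2 * ⟪v, v⟫_ℂ + 32 * γ ^ 4 * ⟪u, u⟫_ℂ ^ 3 * ⟪u, v⟫_ℂ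
    + 32 / 5 * γ ^ 5 * ⟪u, u⟫_ℂ ^ 5

namespace StripFlow

/-- The stripped potential. -/
noncomputable def newOp (A : ℝ → F →L[ℂ] F) (u v : ℝ → F) (γ p : ℝ → ℝ) (x : ℝ) : F →L[ℂ] F :=
  A x + (rk (etaVec (γ x) (p x) (u x) (v x)) (u x) + rk (u x) (etaVec (γ x) (p x) (u x) (v x)))

theorem symm_deriv (h : StripFlow A u v γ p σ E) (x : ℝ) (hA' : HasDerivAt A (A' x) x) (y z : F) :
    ⟪A' x y, z⟫_ℂ = ⟪y, A' x z⟫_ℂ := by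
  have h1 := (hasDerivAt_clm_apply hA' (hasDerivAt_const x y)).inner ℂ (hasDerivAt_const x z)
  have h2 := (hasDerivAt_const x y).inner ℂ (hasDerivAt_clm_apply hA' (hasDerivAt_const x z))
  simp only [h.symm] at h1
  simpa using h1.unique h2

variable [FiniteDimensional ℂ F]

theorem hasDerivAt_theta1 (h : StripFlow A u v γ p σ E) (x : ℝ) :
    HasDerivAt (fun x => theta1 (γ x) (u x)) (tr (newOp A u v γ p x) - tr (A x)) x := by
  simp only [theta1, h.uu]
  refine (((h.dγc x).const_mul 2).mul (h.dp x)).congr_deriv ?_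
  simp only [newOp, map_add, tr_rk, etaVec, inner_add_left, inner_add_right, inner_smul_left,
    inner_smul_right, h.uu, h.uv, h.vu, Complex.conj_ofReal]
  push_cast; ring

theorem hasDerivAt_theta3 (h : StripFlow A u v γ p σ E) (x : ℝ) :
    HasDerivAt (fun x => theta3 E (γ x) (u x) (v x))
      (tr (newOp A u v γ p x * newOp A u v γ p x) - tr (A x * A x)) x := by
  simp only [theta3, h.uu, h.uv]
  have d1 := ((h.dγc x).const_mul 4).mul (h.dτ x)
  have d2 := ((h.dγc x).const_mul (4 * (E : ℂ))).mul (h.dp x)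
  have d3 := ((((h.dγc x).fun_pow 2).const_mul 4).mul (h.dp x)).mul (h.dσ x)
  have d4 := (((h.dγc x).fun_pow 3).const_mul (4 / 3)).mul ((h.dp x).fun_pow 3)
  refine (((d1.sub d2).add d3).add d4).congr_deriv ?_
  rw [newOp, tr_sq_strip (h.point x)]
  simp only [Pi.mul_apply, Nat.cast_ofNat]
  ring

theorem hasDerivAt_theta5 (h : StripFlow A u v γ p σ E) (x : ℝ)
    (hA' : HasDerivAt A (A' x) x) :
    HasDerivAt (fun x => theta5 E (γ x) (A x) (u x) (v x))
      (tr ((A' x + stripDeriv (γ x) (p x) (σ x) E (A x) (u x) (v x))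
        * (A' x + stripDeriv (γ x) (p x) (σ x) E (A x) (u x) (v x))) - tr (A' x * A' x)
        + 2 * (tr (newOp A u v γ p x * newOp A u v γ p x * newOp A u v γ p x)
          - tr (A x * A x * A x))) x := by
  simp only [theta5, h.uu, h.uv]
  have dAu := hasDerivAt_clm_apply hA' (h.du x)
  have dAv := hasDerivAt_clm_apply hA' (h.dv x)
  have dv2 := dAu.inner ℂ dAu
  have dy := (h.dv x).inner ℂ dAv
  have dvv := (h.du x).inner ℂ dAu
  have dw := ((h.du x).inner ℂ dAv).add ((h.dv x).inner ℂ dAu)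
  have g1 := h.dγc x
  have g2 := g1.fun_pow 2
  have g3 := g1.fun_pow 3
  have g4 := g1.fun_pow 4
  have g5 := g1.fun_pow 5
  have D := ((((((((((((((g1.const_mul 4).mul dv2).add ((g1.const_mul 8).mul dy)).add
    ((g1.const_mul (8 * (E : ℂ))).mul dvv)).sub ((g1.const_mul (16 * (E : ℂ))).mul (h.dτ x))).add
    (((g2.const_mul 8).mul (h.dσ x)).mul dvv)).add (((g2.const_mul 16).mul (h.dσ x)).mul (h.dτ x))).add
    ((g1.const_mul (16 * (E : ℂ) ^ 2)).mul (h.dp x))).add (((g2.const_mul 8).mul (h.dp x)).mul dw)).add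
    (((g3.const_mul 32).mul (h.dp x)).mul ((h.dσ x).fun_pow 2))).add
    (((g3.const_mul 8).mul ((h.dp x).fun_pow 2)).mul dvv)).add
    (((g3.const_mul 16).mul ((h.dp x).fun_pow 2)).mul (h.dτ x))).add
    (((g4.const_mul 32).mul ((h.dp x).fun_pow 3)).mul (h.dσ x))).add
    ((g5.const_mul (32 / 5)).mul ((h.dp x).fun_pow 5)))
  refine D.congr_deriv ?_
  have hs := h.symm_deriv x hA'
  rw [newOp, tr_strip_five (A' := A' x) (h.point x)]
  simp only [Pi.mul_apply, Pi.add_apply, Nat.cast_ofNat, inner_add_left, inner_add_right,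
    inner_smul_left, inner_smul_right, map_add, map_smul, h.symm, hs, Complex.conj_ofReal]
  push_cast
  ring

end StripFlow
end flow

end

section

open MeasureTheory Filter Topology Set
open scoped ComplexOrder InnerProductSpace

section tails
variable {G : Type*} [NormedAddCommGroup G] [NormedSpace ℝ G]

theorem exists_tail [CompleteSpace G] {f : ℝ → G} (hc : Continuous f) (hi : Integrable f) :
    ∃ h : ℝ → G, (∀ x, HasDerivAt h (-f x) x) ∧ Tendsto h atTop (𝓝 0) ∧
      Tendsto h atBot (𝓝 (∫ x, f x)) := by
  have hd : ∀ x, HasDerivAt (fun x => ∫ t in (0)..x, f t) (f x) x := fun x =>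
    (hc.integral_hasStrictDerivAt 0 x).hasDerivAt
  obtain ⟨m, n, hm, hn, h⟩ := exists_limits_of_integrable_deriv countable_empty
    (continuous_iff_continuousAt.2 fun x => (hd x).continuousAt) (fun x _ => hd x) hi
  exact ⟨fun x => n - ∫ t in (0)..x, f t, fun x => (hd x).const_sub n,
    by simpa using hn.const_sub n, by rw [h]; exact hm.const_sub n⟩

theorem eq_zero_of_hasDerivAt_zero {f : ℝ → G} (hd : ∀ x, HasDerivAt f 0 x) {l : Filter ℝ} [l.NeBot]
    (ht : Tendsto f l (𝓝 0)) (x : ℝ) : f x = 0 := by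
  have h : ∀ y, f y = f x := fun y => is_const_of_deriv_eq_zero
    (fun x => (hd x).differentiableAt) (fun x => (hd x).deriv) y x
  exact tendsto_nhds_unique (tendsto_const_nhds.congr fun y => (h y).symm) ht

theorem nonneg_of_hasDerivAt_nonpos {f f' : ℝ → ℝ} (hd : ∀ x, HasDerivAt f (f' x) x)
    (h0 : ∀ x, f' x ≤ 0) (ht : Tendsto f atTop (𝓝 0)) (x : ℝ) : 0 ≤ f x :=
  (antitone_of_hasDerivAt_nonpos hd h0).le_of_tendsto ht x

theorem integrable_of_nonneg_hasDerivAt {f f' : ℝ → ℝ} (hc : Continuous f')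
    (hd : ∀ x, HasDerivAt f (f' x) x) (h0 : ∀ x, 0 ≤ f' x) {m n : ℝ} (hm : Tendsto f atBot (𝓝 m))
    (hn : Tendsto f atTop (𝓝 n)) : Integrable f' := by
  have hmono : Monotone f := monotone_of_hasDerivAt_nonneg hd h0
  refine integrable_of_intervalIntegral_norm_bounded (a := fun k : ℕ => -(k : ℝ))
    (b := fun k : ℕ => (k : ℝ)) (l := atTop) (n - m)
    (fun i => (hc.integrableOn_Icc).mono_set Ioc_subset_Icc_self)
    (tendsto_neg_atTop_atBot.comp tendsto_natCast_atTop_atTop) tendsto_natCast_atTop_atTop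
    (Eventually.of_forall fun k => ?_)
  have : ∫ x in (-(k : ℝ))..k, f' x = f k - f (-k) :=
    intervalIntegral.integral_eq_sub_of_hasDerivAt (fun x _ => hd x) (hc.intervalIntegrable _ _)
  simp only [Real.norm_eq_abs, abs_of_nonneg (h0 _)]
  rw [this]
  have h1 := hmono.ge_of_tendsto hn (k : ℝ)
  have h2 := hmono.le_of_tendsto hm (-k : ℝ)
  linarith

theorem exists_bound_of_tendsto {f : ℝ → G} (hc : Continuous f) (h1 : Tendsto f atBot (𝓝 0))
    (h2 : Tendsto f atTop (𝓝 0)) : ∃ K, ∀ x, ‖f x‖ ≤ K := by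
  let z : ZeroAtInftyContinuousMap ℝ G := ⟨⟨f, hc⟩, by
    rw [cocompact_eq_atBot_atTop]; exact tendsto_sup.2 ⟨h1, h2⟩⟩
  obtain ⟨C, hC⟩ := ZeroAtInftyContinuousMap.bounded z
  refine ⟨C + ‖f 0‖, fun x => ?_⟩
  have := hC x 0
  rw [dist_eq_norm] at this
  linarith [norm_sub_norm_le (f x) (f 0), show ‖f x - f 0‖ ≤ C from this]

end tails

variable {F : Type*} [NormedAddCommGroup F] [InnerProductSpace ℂ F]

namespace H1
variable {V : Potential F} {E : ℝ} {ψ : H1 F}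

theorem IsEigen.eq_zero (h : IsEigen V E ψ) {x₀ : ℝ} (h0 : ψ.fn x₀ = 0) (h1 : ψ.dv x₀ = 0)
    (x : ℝ) : ψ.fn x = 0 := by
  obtain ⟨K, hK⟩ := V.bdd
  let A : ℝ → F →L[ℂ] F := fun t => V.op t + (E : ℂ) • ContinuousLinearMap.id ℂ F
  have hA : ∀ t, ‖A t‖ ≤ K + |E| := fun t => by
    refine (norm_add_le _ _).trans (add_le_add (hK t) ?_)
    rw [norm_smul, Complex.norm_real, Real.norm_eq_abs]
    exact mul_le_of_le_one_right (abs_nonneg _) ContinuousLinearMap.norm_id_le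
  let v : ℝ → F × F → F × F := fun t z => (z.2, A t z.1)
  have hv : ∀ t, LipschitzOnWith (max 1 (K + |E|).toNNReal) (v t) univ := fun t => by
    refine LipschitzWith.lipschitzOnWith (LipschitzWith.of_dist_le_mul fun y z => ?_)
    rw [dist_eq_norm, dist_eq_norm, Prod.norm_def, Prod.norm_def]
    have e : v t y - v t z = ((y - z).2, A t (y - z).1) := by simp [v]
    rw [e]
    have hn : (0 : ℝ) ≤ max ‖(y - z).1‖ ‖(y - z).2‖ := le_max_of_le_left (norm_nonneg _)
    refine max_le ?_ ?_
    · refine (le_max_right ‖(y - z).1‖ _).trans ?_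
      refine le_mul_of_one_le_left hn ?_
      exact_mod_cast le_max_left _ _
    · refine ((A t).le_opNorm _).trans ?_
      gcongr
      · push_cast
        exact (hA t).trans ((Real.le_coe_toNNReal _).trans (le_max_right _ _))
      · exact le_max_left _ _
  have := ODE_solution_unique_univ (v := v) (s := fun _ => univ) (f := fun t => (ψ.fn t, ψ.dv t))
    (g := fun _ => (0, 0)) (t₀ := x₀) hv
    (fun t => ⟨((h.1 t).prodMk (h.2 t)).congr_deriv (by simp [v, A]), trivial⟩)
    (fun t => ⟨(hasDerivAt_const t _).congr_deriv (by simp [v]; rfl), trivial⟩) (by simp [h0, h1])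
  exact congrArg Prod.fst (congrFun this x)

/-- The scalar functions attached to a normalised eigenfunction. -/
structure StripData (V : Potential F) (E : ℝ) (ψ : H1 F) (γ p σ g : ℝ → ℝ) : Prop
    extends StripFlow V.op ψ.fn ψ.dv γ p σ E where
  eig : IsEigen V E ψ
  g_pos : ∀ x, 0 < g x
  γg : ∀ x, γ x * g x = 1
  dg : ∀ x, HasDerivAt g (-p x) x
  g_top : Tendsto g atTop (𝓝 0)
  g_bot : Tendsto g atBot (𝓝 1)
  γ_bot : Tendsto γ atBot (𝓝 1)

theorem exists_stripData (h : IsEigen V E ψ) (hm : mass ψ ψ = 1) :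
    ∃ γ p σ g : ℝ → ℝ, StripData V E ψ γ p σ g := by
  obtain ⟨g, dg, gt, gb⟩ := exists_tail (f := fun x => ‖ψ.fn x‖ ^ 2)
    (by have := ψ.continuous; fun_prop) ψ.memLp.integrable_sq_norm
  have hm' : ∫ x, ‖ψ.fn x‖ ^ 2 = 1 := by rw [mass_self] at hm; exact_mod_cast hm
  rw [hm'] at gb
  have g0 : ∀ x, 0 ≤ g x :=
    nonneg_of_hasDerivAt_nonpos dg (fun x => neg_nonpos.2 (sq_nonneg _)) gt
  have ganti : Antitone g := antitone_of_hasDerivAt_nonpos dg fun x => neg_nonpos.2 (sq_nonneg _)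
  have gpos : ∀ x, 0 < g x := by
    intro x
    refine (g0 x).lt_of_ne' fun hx => ?_
    have hz : ∀ y, x ≤ y → g y = 0 := fun y hy => le_antisymm (hx ▸ ganti hy) (g0 y)
    have hψ : ∀ y, x < y → ψ.fn y = 0 := by
      intro y hy
      have e : g =ᶠ[𝓝 y] fun _ => 0 := by
        filter_upwards [Ioi_mem_nhds hy] with z hz' using hz z hz'.le
      have := ((dg y).congr_of_eventuallyEq e.symm).unique (hasDerivAt_const y (0 : ℝ))
      simpa using this
    have hψ' : ψ.dv (x + 1) = 0 := by
      have e : ψ.fn =ᶠ[𝓝 (x + 1)] fun _ => 0 := by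
        filter_upwards [Ioi_mem_nhds (lt_add_one x)] with z hz' using hψ z hz'
      exact ((h.1 _).congr_of_eventuallyEq e.symm).unique (hasDerivAt_const _ (0 : F))
    have h0 := h.eq_zero (hψ _ (lt_add_one x)) hψ'
    simp [h0] at hm'
  have hW : ∀ x, ⟪ψ.fn x, ψ.dv x⟫_ℂ - ⟪ψ.dv x, ψ.fn x⟫_ℂ = 0 := by
    have hd : ∀ x, HasDerivAt (fun x => ⟪ψ.fn x, ψ.dv x⟫_ℂ - ⟪ψ.dv x, ψ.fn x⟫_ℂ) 0 x := fun x => by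
      refine (((h.1 x).inner ℂ (h.2 x)).sub ((h.2 x).inner ℂ (h.1 x))).congr_deriv ?_
      simp only [inner_add_left, inner_add_right, inner_smul_left, inner_smul_right, V.symm,
        Complex.conj_ofReal]
      ring
    have ht := (inner_limits ψ h.deriv).2.1.sub (inner_limits h.deriv ψ).2.1
    rw [sub_zero] at ht
    exact fun x => eq_zero_of_hasDerivAt_zero hd ht x
  have uv : ∀ x, ⟪ψ.fn x, ψ.dv x⟫_ℂ = (((⟪ψ.fn x, ψ.dv x⟫_ℂ).re : ℝ) : ℂ) := fun x => by
    refine (Complex.conj_eq_iff_re.1 ?_).symm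
    rw [inner_conj_symm]; exact (sub_eq_zero.1 (hW x)).symm
  refine ⟨fun x => (g x)⁻¹, fun x => ‖ψ.fn x‖ ^ 2, fun x => (⟪ψ.fn x, ψ.dv x⟫_ℂ).re, g,
    { symm := V.symm
      uu := fun x => by rw [inner_self_eq_norm_sq_to_K]; push_cast; rfl
      uv := uv
      vu := fun x => by rw [← uv]; exact (sub_eq_zero.1 (hW x)).symm
      du := h.1
      dv := h.2
      dγ := fun x => ((dg x).inv (gpos x).ne').congr_deriv (by
        have := (gpos x).ne'
        field_simp)
      eig := h
      g_pos := gpos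
      γg := fun x => inv_mul_cancel₀ (gpos x).ne'
      dg := dg
      g_top := gt
      g_bot := gb
      γ_bot := by simpa using gb.inv₀ one_ne_zero }⟩

end H1

end

section

open MeasureTheory Filter Topology Set
open scoped ComplexOrder InnerProductSpace

variable {F : Type*} [NormedAddCommGroup F] [InnerProductSpace ℂ F]

/-- The potential vanishes on `[R, ∞)` and tends to zero at `-∞`. -/
structure Potential.Tame (V : Potential F) (R : ℝ) : Prop where
  zero : ∀ x, R ≤ x → V.op x = 0
  lim : Tendsto V.op atBot (𝓝 0)

/-- The function `f` has a primitive that vanishes at `-∞` and equals `d` at `R`. -/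
def Linked (R : ℝ) (f : ℝ → ℂ) (d : ℂ) : Prop :=
  ∃ θ : ℝ → ℂ, (∀ x, HasDerivAt θ (f x) x) ∧ Tendsto θ atBot (𝓝 0) ∧ θ R = d

theorem Linked.add {R : ℝ} {f f' : ℝ → ℂ} {d d' : ℂ} (h : Linked R f d) (h' : Linked R f' d') :
    Linked R (fun x => f x + f' x) (d + d') := by
  obtain ⟨θ, h1, h2, h3⟩ := h
  obtain ⟨θ', k1, k2, k3⟩ := h'
  exact ⟨fun x => θ x + θ' x, fun x => (h1 x).add (k1 x), by simpa using h2.add k2,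
    congrArg₂ (· + ·) h3 k3⟩

theorem Linked.congr {R : ℝ} {f f' : ℝ → ℂ} {d d' : ℂ} (h : Linked R f d) (hf : ∀ x, f x = f' x)
    (hd : d = d') : Linked R f' d' := by
  rwa [← hd, ← funext hf]

theorem linked_zero (R : ℝ) : Linked R (fun _ => 0) 0 :=
  ⟨fun _ => 0, fun x => hasDerivAt_const x 0, tendsto_const_nhds, rfl⟩

theorem eq_zero_of_hasDerivAt_zero_Ici {G : Type*} [NormedAddCommGroup G] [NormedSpace ℝ G]
    {f : ℝ → G} {R : ℝ} (hd : ∀ x, R ≤ x → HasDerivAt f 0 x) (ht : Tendsto f atTop (𝓝 0)) :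
    ∀ x, R ≤ x → f x = 0 := by
  have h : ∀ y, R ≤ y → f y = f R := fun y hy =>
    constant_of_has_deriv_right_zero (fun x hx => (hd x hx.1).continuousAt.continuousWithinAt)
      (fun x hx => (hd x hx.1).hasDerivWithinAt) y ⟨hy, le_rfl⟩
  have h0 : f R = 0 := tendsto_nhds_unique (tendsto_const_nhds.congr'
    ((eventually_ge_atTop R).mono fun y hy => (h y hy).symm)) ht
  exact fun x hx => (h x hx).trans h0

theorem tendsto_zero_of_continuous {X Y Z : Type*} [TopologicalSpace X] [TopologicalSpace Y] [Zero Y]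
    {f : X → Y} (hc : Continuous f) {x₀ : X} (h0 : f x₀ = 0) {g : Z → X} {l : Filter Z}
    (hg : Tendsto g l (𝓝 x₀)) : Tendsto (fun z => f (g z)) l (𝓝 0) :=
  h0 ▸ (hc.tendsto x₀).comp hg

namespace H1
variable {V : Potential F} {E R κ : ℝ} {ψ : H1 F} {γ p σ g : ℝ → ℝ}

namespace StripData

theorem dv_eq (h : StripData V E ψ γ p σ g) (hV : V.Tame R) (hκ : 0 < κ) (hE : E = κ ^ 2) :
    ∀ x, R ≤ x → ψ.dv x = -(κ : ℂ) • ψ.fn x := by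
  intro x hx
  have hd : ∀ x, R ≤ x →
      HasDerivAt (fun x => Real.exp (-κ * x) • (ψ.dv x + (κ : ℂ) • ψ.fn x)) 0 x := by
    intro x hx
    have h1 := ((hasDerivAt_id x).const_mul (-κ)).exp
    refine (h1.smul ((h.dv x).add ((h.du x).const_smul (κ : ℂ)))).congr_deriv ?_
    simp only [hV.zero x hx, hE, _root_.zero_apply, zero_add, mul_one, id,
      Pi.add_apply, Pi.smul_apply, ← Complex.coe_smul]
    push_cast
    module
  have ht : Tendsto (fun x => Real.exp (-κ * x) • (ψ.dv x + (κ : ℂ) • ψ.fn x)) atTop (𝓝 0) := by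
    have h1 : Tendsto (fun x => Real.exp (-κ * x)) atTop (𝓝 0) :=
      Real.tendsto_exp_atBot.comp (tendsto_id.const_mul_atTop_of_neg (neg_lt_zero.2 hκ))
    have h2 := h.eig.deriv.tendsto_zero.2.add (ψ.tendsto_zero.2.const_smul (κ : ℂ))
    rw [smul_zero, add_zero] at h2
    have h3 := h1.smul h2
    rw [smul_zero] at h3
    exact h3
  have := eq_zero_of_hasDerivAt_zero_Ici hd ht x hx
  rw [smul_eq_zero] at this
  rw [neg_smul]
  exact eq_neg_of_add_eq_zero_left (this.resolve_left (Real.exp_ne_zero _))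

theorem σ_eq (h : StripData V E ψ γ p σ g) (hV : V.Tame R) (hκ : 0 < κ) (hE : E = κ ^ 2) :
    ∀ x, R ≤ x → σ x = -κ * p x := by
  intro x hx
  have h1 := h.uv x
  rw [h.dv_eq hV hκ hE x hx, inner_smul_right, h.uu] at h1
  exact_mod_cast h1.symm

theorem p_lim (h : StripData V E ψ γ p σ g) : Tendsto p atBot (𝓝 0) ∧ Tendsto p atTop (𝓝 0) := by
  have e : p = fun x => (⟪ψ.fn x, ψ.fn x⟫_ℂ).re := by
    funext x; rw [h.uu, Complex.ofReal_re]
  rw [e]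
  have := inner_limits ψ ψ
  have h1 := (Complex.continuous_re.tendsto 0).comp this.1
  have h2 := (Complex.continuous_re.tendsto 0).comp this.2.1
  simp only [Complex.zero_re] at h1 h2
  exact ⟨h1, h2⟩

theorem dp_real (h : StripData V E ψ γ p σ g) (x : ℝ) : HasDerivAt p (2 * σ x) x := by
  have := Complex.reCLM.hasFDerivAt.comp_hasDerivAt x (h.dp x)
  refine this.congr_deriv ?_
  rw [← Complex.ofReal_ofNat, ← Complex.ofReal_mul]
  exact Complex.ofReal_re _

theorem γp_eq (h : StripData V E ψ γ p σ g) (hV : V.Tame R) (hκ : 0 < κ) (hE : E = κ ^ 2) :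
    ∀ x, R ≤ x → γ x * p x = 2 * κ := by
  intro x hx
  have hd : ∀ x, R ≤ x → HasDerivAt (fun x => 2 * κ * g x - p x) 0 x := fun x hx =>
    (((h.dg x).const_mul (2 * κ)).sub (h.dp_real x)).congr_deriv (by
      rw [h.σ_eq hV hκ hE x hx]; ring)
  have ht : Tendsto (fun x => 2 * κ * g x - p x) atTop (𝓝 0) := by
    simpa using (h.g_top.const_mul (2 * κ)).sub h.p_lim.2
  have h0 := eq_zero_of_hasDerivAt_zero_Ici hd ht x hx
  have h1 := h.γg x
  calc γ x * p x = 2 * κ * (γ x * g x) := by linear_combination -(γ x) * h0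
    _ = _ := by rw [h1, mul_one]

theorem eta_eq (h : StripData V E ψ γ p σ g) (hV : V.Tame R) (hκ : 0 < κ) (hE : E = κ ^ 2) :
    ∀ x, R ≤ x → etaVec (γ x) (p x) (ψ.fn x) (ψ.dv x) = 0 := by
  intro x hx
  have h1 := h.γp_eq hV hκ hE x hx
  have h2 : γ x ^ 2 * p x = 2 * κ * γ x := by linear_combination γ x * h1
  rw [etaVec, h.dv_eq hV hκ hE x hx, h2]
  push_cast; module

theorem cont (h : StripData V E ψ γ p σ g) :
    Continuous γ ∧ Continuous p ∧ Continuous σ ∧ Continuous g ∧ Continuous ψ.dv := by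
  refine ⟨continuous_iff_continuousAt.2 fun x => (h.dγ x).continuousAt,
    continuous_iff_continuousAt.2 fun x => (h.dp_real x).continuousAt, ?_,
    continuous_iff_continuousAt.2 fun x => (h.dg x).continuousAt,
    continuous_iff_continuousAt.2 fun x => (h.dv x).continuousAt⟩
  have := Complex.continuous_re.comp (continuous_iff_continuousAt.2 fun x => (h.dσ x).continuousAt)
  exact this

theorem lim (h : StripData V E ψ γ p σ g) (hV : V.Tame R) :
    Tendsto (fun x => (γ x, p x, σ x, V.op x, ψ.fn x, ψ.dv x)) atBot
      (𝓝 (1, 0, 0, 0, 0, 0)) := by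
  have hσ : Tendsto σ atBot (𝓝 0) := by
    have h1 := (Complex.continuous_re.tendsto 0).comp (inner_limits ψ h.eig.deriv).1
    refine h1.congr fun x => ?_
    change (⟪ψ.fn x, ψ.dv x⟫_ℂ).re = _
    rw [h.uv, Complex.ofReal_re]
  exact h.γ_bot.prodMk_nhds (h.p_lim.1.prodMk_nhds (hσ.prodMk_nhds (hV.lim.prodMk_nhds
    (ψ.tendsto_zero.1.prodMk_nhds h.eig.deriv.tendsto_zero.1))))

theorem continuous_etaVec {X : Type*} [TopologicalSpace X] {a b : X → ℝ} {u v : X → F}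
    (ha : Continuous a) (hb : Continuous b) (hu : Continuous u) (hv : Continuous v) :
    Continuous fun x => etaVec (a x) (b x) (u x) (v x) := by
  unfold etaVec; fun_prop

theorem continuous_newOp {X : Type*} [TopologicalSpace X] {a b : X → ℝ} {u v : X → F}
    {A : X → F →L[ℂ] F} (hA : Continuous A)
    (ha : Continuous a) (hb : Continuous b) (hu : Continuous u) (hv : Continuous v) :
    Continuous fun x => A x + (rk (etaVec (a x) (b x) (u x) (v x)) (u x)
      + rk (u x) (etaVec (a x) (b x) (u x) (v x))) :=
  hA.add ((continuous_rk (continuous_etaVec ha hb hu hv) hu).add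
    (continuous_rk hu (continuous_etaVec ha hb hu hv)))

theorem newOp_zero (h : StripData V E ψ γ p σ g) (hV : V.Tame R) (hκ : 0 < κ) (hE : E = κ ^ 2) :
    ∀ x, R ≤ x → StripFlow.newOp V.op ψ.fn ψ.dv γ p x = 0 := by
  intro x hx
  rw [StripFlow.newOp, h.eta_eq hV hκ hE x hx, hV.zero x hx]
  ext z; simp

theorem newOp_lim (h : StripData V E ψ γ p σ g) (hV : V.Tame R) :
    Tendsto (StripFlow.newOp V.op ψ.fn ψ.dv γ p) atBot (𝓝 0) := by
  have hc : Continuous fun q : ℝ × ℝ × ℝ × (F →L[ℂ] F) × F × F =>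
      q.2.2.2.1 + (rk (etaVec q.1 q.2.1 q.2.2.2.2.1 q.2.2.2.2.2) q.2.2.2.2.1
        + rk q.2.2.2.2.1 (etaVec q.1 q.2.1 q.2.2.2.2.1 q.2.2.2.2.2)) :=
    continuous_newOp (by fun_prop) (by fun_prop) (by fun_prop) (by fun_prop) (by fun_prop)
  have h0 := tendsto_zero_of_continuous hc (by simp [rk]) (h.lim hV)
  exact h0

/-- The potential with one eigenvalue removed. -/
noncomputable def pot (h : StripData V E ψ γ p σ g) (hV : V.Tame R) (hκ : 0 < κ) (hE : E = κ ^ 2) :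
    Potential F where
  op := StripFlow.newOp V.op ψ.fn ψ.dv γ p
  cont := continuous_newOp V.cont h.cont.1 h.cont.2.1 ψ.continuous h.cont.2.2.2.2
  symm := fun x u v => by
    simp only [StripFlow.newOp, _root_.add_apply, inner_add_left, inner_add_right, V.symm, rk_symm]
    ring
  bdd := exists_bound_of_tendsto
    (continuous_newOp V.cont h.cont.1 h.cont.2.1 ψ.continuous h.cont.2.2.2.2) (h.newOp_lim hV)
    (tendsto_const_nhds.congr' ((eventually_ge_atTop R).mono fun x hx =>
      (h.newOp_zero hV hκ hE x hx).symm))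

theorem pot_tame (h : StripData V E ψ γ p σ g) (hV : V.Tame R) (hκ : 0 < κ) (hE : E = κ ^ 2) :
    (h.pot hV hκ hE).Tame R := ⟨h.newOp_zero hV hκ hE, h.newOp_lim hV⟩

variable [FiniteDimensional ℂ F]

theorem linked_tr (h : StripData V E ψ γ p σ g) (hV : V.Tame R) (hκ : 0 < κ) (hE : E = κ ^ 2) :
    Linked R (fun x => tr ((h.pot hV hκ hE).op x) - tr (V.op x)) (4 * κ : ℝ) := by
  refine ⟨_, h.hasDerivAt_theta1, ?_, ?_⟩
  · have hc : Continuous fun q : ℝ × ℝ × ℝ × (F →L[ℂ] F) × F × F => theta1 q.1 q.2.2.2.2.1 := by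
      unfold theta1; fun_prop
    have h0 := tendsto_zero_of_continuous hc (by simp [theta1]) (h.lim hV)
    exact h0
  · have h1 : (γ R : ℂ) * p R = 2 * κ := by exact_mod_cast h.γp_eq hV hκ hE R le_rfl
    rw [theta1, h.uu]
    push_cast
    linear_combination 2 * h1

theorem linked_tr_sq (h : StripData V E ψ γ p σ g) (hV : V.Tame R) (hκ : 0 < κ) (hE : E = κ ^ 2) :
    Linked R (fun x => tr ((h.pot hV hκ hE).op x * (h.pot hV hκ hE).op x)
      - tr (V.op x * V.op x)) (-(16 / 3) * κ ^ 3 : ℝ) := by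
  refine ⟨_, h.hasDerivAt_theta3, ?_, ?_⟩
  · have hc : Continuous fun q : ℝ × ℝ × ℝ × (F →L[ℂ] F) × F × F =>
        theta3 E q.1 q.2.2.2.2.1 q.2.2.2.2.2 := by
      unfold theta3; fun_prop
    have h0 := tendsto_zero_of_continuous hc (by simp [theta3]) (h.lim hV)
    exact h0
  · have h1 : (γ R : ℂ) * p R = 2 * κ := by exact_mod_cast h.γp_eq hV hκ hE R le_rfl
    have h2 : (γ R : ℂ) ^ 2 * p R ^ 2 = 4 * κ ^ 2 := by rw [← mul_pow, h1]; ring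
    have h3 : (γ R : ℂ) ^ 3 * p R ^ 3 = 8 * κ ^ 3 := by rw [← mul_pow, h1]; ring
    rw [theta3, h.dv_eq hV hκ hE R le_rfl]
    simp only [inner_smul_left, inner_smul_right, h.uu, map_neg, Complex.conj_ofReal, hE]
    push_cast
    linear_combination 4 / 3 * h3 - 4 * κ * h2

theorem linked_five (h : StripData V E ψ γ p σ g) (hV : V.Tame R) (hκ : 0 < κ) (hE : E = κ ^ 2)
    {V' : ℝ → F →L[ℂ] F} (hd : ∀ x, HasDerivAt V.op (V' x) x) (hc' : Continuous V')
    (hl : Tendsto V' atBot (𝓝 0)) :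
    ∃ U' : ℝ → F →L[ℂ] F, (∀ x, HasDerivAt (h.pot hV hκ hE).op (U' x) x) ∧ Continuous U' ∧
      Tendsto U' atBot (𝓝 0) ∧
      Linked R (fun x => tr (U' x * U' x) - tr (V' x * V' x) + 2 * (tr ((h.pot hV hκ hE).op x
        * (h.pot hV hκ hE).op x * (h.pot hV hκ hE).op x) - tr (V.op x * V.op x * V.op x)))
        (64 / 5 * κ ^ 5 : ℝ) := by
  have hcd : Continuous fun q : ℝ × ℝ × ℝ × (F →L[ℂ] F) × F × F =>
      stripDeriv q.1 q.2.1 q.2.2.1 E q.2.2.2.1 q.2.2.2.2.1 q.2.2.2.2.2 := by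
    have h1 : Continuous fun q : ℝ × ℝ × ℝ × (F →L[ℂ] F) × F × F =>
        etaVec q.1 q.2.1 q.2.2.2.2.1 q.2.2.2.2.2 :=
      continuous_etaVec (by fun_prop) (by fun_prop) (by fun_prop) (by fun_prop)
    have h2 : Continuous fun q : ℝ × ℝ × ℝ × (F →L[ℂ] F) × F × F =>
        etaVec' q.1 q.2.1 q.2.2.1 E q.2.2.2.1 q.2.2.2.2.1 q.2.2.2.2.2 := by
      have h0 : Continuous fun q : ℝ × ℝ × ℝ × (F →L[ℂ] F) × F × F => q.2.2.2.1 q.2.2.2.2.1 :=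
        Continuous.clm_apply (by fun_prop) (by fun_prop)
      unfold etaVec'; fun_prop
    have c1 : Continuous fun q : ℝ × ℝ × ℝ × (F →L[ℂ] F) × F × F => q.2.2.2.2.1 := by fun_prop
    have c2 : Continuous fun q : ℝ × ℝ × ℝ × (F →L[ℂ] F) × F × F => q.2.2.2.2.2 := by fun_prop
    exact ((continuous_rk h1 c2).add (continuous_rk h2 c1)).add
      ((continuous_rk c1 h2).add (continuous_rk c2 h1))
  obtain ⟨c1, c2, c3, c4, c5⟩ := h.cont
  have hcs : Continuous fun x => stripDeriv (γ x) (p x) (σ x) E (V.op x) (ψ.fn x) (ψ.dv x) :=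
    Continuous.comp (f := fun x => (γ x, p x, σ x, V.op x, ψ.fn x, ψ.dv x)) hcd
      (c1.prodMk (c2.prodMk (c3.prodMk (V.cont.prodMk (ψ.continuous.prodMk c5)))))
  refine ⟨fun x => V' x + stripDeriv (γ x) (p x) (σ x) E (V.op x) (ψ.fn x) (ψ.dv x), fun x => ?_,
    hc'.add hcs,
    ?_, ⟨_, fun x => h.hasDerivAt_theta5 x (hd x), ?_, ?_⟩⟩
  · have he : HasDerivAt (fun x => etaVec (γ x) (p x) (ψ.fn x) (ψ.dv x))
        (etaVec' (γ x) (p x) (σ x) E (V.op x) (ψ.fn x) (ψ.dv x)) x := by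
      have g1 := h.dγc x
      have e1 := (g1.const_mul 2).smul (h.dv x)
      have e2 := ((g1.fun_pow 2).mul (h.dp x)).smul (h.du x)
      have e3 := e1.add e2
      have : (fun x => etaVec (γ x) (p x) (ψ.fn x) (ψ.dv x)) =
        ((fun x => (2 * (γ x : ℂ))) • ψ.dv) + ((fun x => (γ x : ℂ) ^ 2) * fun x => (p x : ℂ)) • ψ.fn := by
        funext x; simp [etaVec]
      rw [this]
      refine e3.congr_deriv ?_
      simp only [etaVec', Pi.mul_apply, Nat.cast_ofNat]
      push_cast
      module
    exact ((hd x).add ((he.rk (h.du x)).add ((h.du x).rk he))).congr_deriv rfl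
  · rw [← add_zero (0 : F →L[ℂ] F)]
    have h0 := tendsto_zero_of_continuous hcd (by simp [stripDeriv, rk]) (h.lim hV)
    exact hl.add h0
  · have hc : Continuous fun q : ℝ × ℝ × ℝ × (F →L[ℂ] F) × F × F =>
        theta5 E q.1 q.2.2.2.1 q.2.2.2.2.1 q.2.2.2.2.2 := by
      have h0 : Continuous fun q : ℝ × ℝ × ℝ × (F →L[ℂ] F) × F × F => q.2.2.2.1 q.2.2.2.2.1 :=
        Continuous.clm_apply (by fun_prop) (by fun_prop)
      have h0' : Continuous fun q : ℝ × ℝ × ℝ × (F →L[ℂ] F) × F × F => q.2.2.2.1 q.2.2.2.2.2 :=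
        Continuous.clm_apply (by fun_prop) (by fun_prop)
      unfold theta5; fun_prop
    have h0 := tendsto_zero_of_continuous hc (by simp [theta5]) (h.lim hV)
    exact h0
  · have h1 : (γ R : ℂ) * p R = 2 * κ := by exact_mod_cast h.γp_eq hV hκ hE R le_rfl
    have h2 : (γ R : ℂ) ^ 2 * p R ^ 2 = 4 * κ ^ 2 := by rw [← mul_pow, h1]; ring
    have h3 : (γ R : ℂ) ^ 3 * p R ^ 3 = 8 * κ ^ 3 := by rw [← mul_pow, h1]; ring
    have h4 : (γ R : ℂ) ^ 4 * p R ^ 4 = 16 * κ ^ 4 := by rw [← mul_pow, h1]; ring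
    have h5 : (γ R : ℂ) ^ 5 * p R ^ 5 = 32 * κ ^ 5 := by rw [← mul_pow, h1]; ring
    rw [theta5, h.dv_eq hV hκ hE R le_rfl, hV.zero R le_rfl]
    simp only [inner_smul_left, inner_smul_right, h.uu, map_neg, Complex.conj_ofReal, hE,
      _root_.zero_apply, inner_zero_right]
    push_cast
    linear_combination 32 / 5 * h5 - 32 * κ * h4 + 48 * κ ^ 2 * h3 - 16 * κ ^ 3 * h2

end StripData
end H1

end

section

open MeasureTheory Filter Topology Set
open scoped ComplexOrder InnerProductSpace

variable {F : Type*} [NormedAddCommGroup F] [InnerProductSpace ℂ F]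

namespace H1
variable {V : Potential F} {E E' R κ : ℝ} {ψ φ : H1 F} {γ p σ g : ℝ → ℝ} {k : ℝ → ℂ}

/-- `k x = ∫ₓ^∞ ⟪ψ, φ⟫` for orthogonal `ψ`, `φ`. -/
structure IsTail (ψ φ : H1 F) (k : ℝ → ℂ) : Prop where
  dk : ∀ x, HasDerivAt k (-⟪ψ.fn x, φ.fn x⟫_ℂ) x
  top : Tendsto k atTop (𝓝 0)
  bot : Tendsto k atBot (𝓝 0)

theorem exists_isTail (h : mass ψ φ = 0) : ∃ k, IsTail ψ φ k := by
  obtain ⟨k, h1, h2, h3⟩ := exists_tail (ψ.continuous.inner φ.continuous)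
    (ψ.memLp.integrable_inner_two φ.memLp)
  exact ⟨k, h1, h2, by rwa [← mass_apply, h] at h3⟩

namespace StripData

/-- The transformed eigenfunction. -/
noncomputable def newFn (γ : ℝ → ℝ) (ψ φ : H1 F) (k : ℝ → ℂ) (x : ℝ) : F :=
  φ.fn x - ((γ x : ℂ) * k x) • ψ.fn x

/-- The derivative of the transformed eigenfunction. -/
noncomputable def newDv (γ p : ℝ → ℝ) (ψ φ : H1 F) (k : ℝ → ℂ) (x : ℝ) : F :=
  φ.dv x - (((γ x : ℂ) ^ 2 * p x * k x - γ x * ⟪ψ.fn x, φ.fn x⟫_ℂ) • ψ.fn x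
    + ((γ x : ℂ) * k x) • ψ.dv x)

theorem hasDerivAt_newFn (h : StripData V E ψ γ p σ g) (hφ : IsEigen V E' φ) (hk : IsTail ψ φ k)
    (x : ℝ) : HasDerivAt (newFn γ ψ φ k) (newDv γ p ψ φ k x) x := by
  have h1 : HasDerivAt (fun x => (γ x : ℂ) * k x)
      ((γ x : ℂ) ^ 2 * p x * k x - γ x * ⟪ψ.fn x, φ.fn x⟫_ℂ) x :=
    ((h.dγc x).mul (hk.dk x)).congr_deriv (by ring)
  exact ((hφ.1 x).sub (h1.smul (h.du x))).congr_deriv (by rw [newDv, add_comm (_ • _)])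

theorem wronskian_eq (h : StripData V E ψ γ p σ g) (hφ : IsEigen V E' φ) (hk : IsTail ψ φ k)
    (x : ℝ) : ⟪ψ.fn x, φ.dv x⟫_ℂ = ⟪ψ.dv x, φ.fn x⟫_ℂ - (E' - E) * k x := by
  have hd : ∀ x, HasDerivAt (fun x => ⟪ψ.fn x, φ.dv x⟫_ℂ - ⟪ψ.dv x, φ.fn x⟫_ℂ + (E' - E) * k x)
      0 x := fun x => by
    refine ((((h.du x).inner ℂ (hφ.2 x)).sub ((h.dv x).inner ℂ (hφ.1 x))).add
      ((hk.dk x).const_mul ((E' : ℂ) - E))).congr_deriv ?_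
    simp only [inner_add_left, inner_add_right, inner_smul_left, inner_smul_right, V.symm,
      Complex.conj_ofReal]
    ring
  have ht := ((inner_limits ψ hφ.deriv).2.1.sub (inner_limits h.eig.deriv φ).2.1).add
    (hk.top.const_mul ((E' : ℂ) - E))
  rw [sub_zero, mul_zero, add_zero] at ht
  linear_combination eq_zero_of_hasDerivAt_zero hd ht x

theorem hasDerivAt_newDv (h : StripData V E ψ γ p σ g) (hφ : IsEigen V E' φ) (hk : IsTail ψ φ k)
    (x : ℝ) : HasDerivAt (newDv γ p ψ φ k)
      (StripFlow.newOp V.op ψ.fn ψ.dv γ p x (newFn γ ψ φ k x) + (E' : ℂ) • newFn γ ψ φ k x) x := by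
  have h1 : HasDerivAt (fun x => (γ x : ℂ) * k x)
      ((γ x : ℂ) ^ 2 * p x * k x - γ x * ⟪ψ.fn x, φ.fn x⟫_ℂ) x :=
    ((h.dγc x).mul (hk.dk x)).congr_deriv (by ring)
  have h2 : HasDerivAt (fun x => (γ x : ℂ) ^ 2 * p x * k x - γ x * ⟪ψ.fn x, φ.fn x⟫_ℂ)
      (2 * γ x ^ 3 * p x ^ 2 * k x + 2 * γ x ^ 2 * σ x * k x - 2 * γ x ^ 2 * p x * ⟪ψ.fn x, φ.fn x⟫_ℂ
        - γ x * (⟪ψ.dv x, φ.fn x⟫_ℂ + ⟪ψ.fn x, φ.dv x⟫_ℂ)) x :=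
    (((((h.dγc x).fun_pow 2).mul (h.dp x)).mul (hk.dk x)).sub
      ((h.dγc x).mul ((h.du x).inner ℂ (hφ.1 x)))).congr_deriv (by
        simp only [Pi.mul_apply, Nat.cast_ofNat]; ring)
  refine ((hφ.2 x).sub ((h2.smul (h.du x)).add (h1.smul (h.dv x)))).congr_deriv ?_
  rw [h.wronskian_eq hφ hk x]
  simp only [StripFlow.newOp, _root_.add_apply, rk_apply, newFn, etaVec, inner_add_left,
    inner_smul_left, map_sub, map_smul, h.uu, h.vu,
    Complex.conj_ofReal]
  push_cast
  module

theorem exists_tail_sq (h : StripData V E ψ γ p σ g) (hk : IsTail ψ φ k) :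
    ∃ q : ℝ → ℝ, (∀ x, HasDerivAt q (-‖φ.fn x‖ ^ 2) x) ∧ Tendsto q atTop (𝓝 0) ∧
      (∃ m, Tendsto q atBot (𝓝 m)) ∧ ∀ x, γ x * ‖k x‖ ^ 2 ≤ q x := by
  obtain ⟨q, dq, qt, qb⟩ := exists_tail (f := fun x => ‖φ.fn x‖ ^ 2)
    (by have := φ.continuous; fun_prop) φ.memLp.integrable_sq_norm
  refine ⟨q, dq, qt, ⟨_, qb⟩, fun x₀ => ?_⟩
  set c : ℂ := γ x₀ * k x₀ with hc
  have dT : ∀ x, HasDerivAt (fun x => q x - 2 * (starRingEnd ℂ c * k x).re + ‖c‖ ^ 2 * g x)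
      (-‖φ.fn x - c • ψ.fn x‖ ^ 2) x := fun x => by
    have h1 := Complex.reCLM.hasFDerivAt.comp_hasDerivAt x ((hk.dk x).const_mul (starRingEnd ℂ c))
    refine (((dq x).sub (h1.const_mul 2)).add ((h.dg x).const_mul (‖c‖ ^ 2))).congr_deriv ?_
    have e1 := norm_sub_sq (𝕜 := ℂ) (φ.fn x) (c • ψ.fn x)
    have e2 : p x = ‖ψ.fn x‖ ^ 2 := by
      rw [← Complex.ofReal_re (p x), ← h.uu x]
      exact inner_self_eq_norm_sq (𝕜 := ℂ) _
    have e3 : RCLike.re ⟪φ.fn x, c • ψ.fn x⟫_ℂ = (starRingEnd ℂ c * ⟪ψ.fn x, φ.fn x⟫_ℂ).re := by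
      rw [inner_re_symm, inner_smul_left]; rfl
    rw [e1, e3, norm_smul, mul_pow, e2]
    simp only [Complex.reCLM_apply, mul_neg, Complex.neg_re]
    ring
  have tT : Tendsto (fun x => q x - 2 * (starRingEnd ℂ c * k x).re + ‖c‖ ^ 2 * g x) atTop (𝓝 0) := by
    have h1 := (Complex.continuous_re.tendsto _).comp (hk.top.const_mul (starRingEnd ℂ c))
    have h2 := (qt.sub (h1.const_mul 2)).add (h.g_top.const_mul (‖c‖ ^ 2))
    simpa using h2
  have h0 := nonneg_of_hasDerivAt_nonpos dT (fun x => neg_nonpos.2 (sq_nonneg _)) tT x₀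
  have e3 : (starRingEnd ℂ c * k x₀).re = γ x₀ * ‖k x₀‖ ^ 2 := by
    rw [hc, map_mul, Complex.conj_ofReal, mul_assoc, ← Complex.normSq_eq_conj_mul_self,
      ← Complex.ofReal_mul, Complex.ofReal_re, Complex.normSq_eq_norm_sq]
  have e4 : ‖c‖ ^ 2 * g x₀ = γ x₀ * ‖k x₀‖ ^ 2 := by
    rw [hc, norm_mul, mul_pow, Complex.norm_real, Real.norm_eq_abs, sq_abs]
    linear_combination (γ x₀ * ‖k x₀‖ ^ 2) * h.γg x₀
  rw [e3, e4] at h0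
  linarith

theorem γ_pos (h : StripData V E ψ γ p σ g) (x : ℝ) : 0 < γ x := by
  have h1 := h.γg x
  have h2 := h.g_pos x
  by_contra! hn
  nlinarith

theorem inner_newFn (h : StripData V E ψ γ p σ g) {φ' : H1 F} {k' : ℝ → ℂ} (hk : IsTail ψ φ k)
    (hk' : IsTail ψ φ' k') :
    (∀ x, HasDerivAt (fun x => (γ x : ℂ) * ⟪k x, k' x⟫_ℂ)
      (⟪newFn γ ψ φ k x, newFn γ ψ φ' k' x⟫_ℂ - ⟪φ.fn x, φ'.fn x⟫_ℂ) x) ∧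
    Tendsto (fun x => (γ x : ℂ) * ⟪k x, k' x⟫_ℂ) atBot (𝓝 0) ∧
    Tendsto (fun x => (γ x : ℂ) * ⟪k x, k' x⟫_ℂ) atTop (𝓝 0) := by
  refine ⟨fun x => ?_, ?_, ?_⟩
  · refine ((h.dγc x).mul ((hk.dk x).inner ℂ (hk'.dk x))).congr_deriv ?_
    simp only [newFn, inner_sub_left, inner_sub_right, inner_smul_left, inner_smul_right, h.uu,
      RCLike.inner_apply, map_mul, map_neg, Complex.conj_ofReal, inner_conj_symm]
    ring
  · have h1 : Tendsto (fun x => (γ x : ℂ)) atBot (𝓝 1) := by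
      exact_mod_cast (Complex.continuous_ofReal.tendsto 1).comp h.γ_bot
    simpa using h1.mul (hk.bot.inner hk'.bot)
  · obtain ⟨q, -, q1, -, q2⟩ := h.exists_tail_sq hk
    obtain ⟨q', -, q1', -, q2'⟩ := h.exists_tail_sq hk'
    refine squeeze_zero_norm (fun x => ?_) (by simpa using q1.add q1')
    rw [norm_mul, Complex.norm_real, Real.norm_of_nonneg (h.γ_pos x).le]
    have h1 : ‖⟪k x, k' x⟫_ℂ‖ ≤ ‖k x‖ * ‖k' x‖ := norm_inner_le_norm _ _
    nlinarith [q2 x, q2' x, mul_le_mul_of_nonneg_left h1 (h.γ_pos x).le,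
      mul_nonneg (h.γ_pos x).le (sq_nonneg (‖k x‖ - ‖k' x‖)), h.γ_pos x, sq_nonneg ‖k x‖,
      mul_nonneg (h.γ_pos x).le (sq_nonneg (‖k x‖)), mul_nonneg (h.γ_pos x).le (sq_nonneg (‖k' x‖))]

theorem memLp_newFn (h : StripData V E ψ γ p σ g) (hφ : IsEigen V E' φ) (hk : IsTail ψ φ k) :
    MemLp (newFn γ ψ φ k) 2 := by
  have hc : Continuous (newFn γ ψ φ k) :=
    continuous_iff_continuousAt.2 fun x => (h.hasDerivAt_newFn hφ hk x).continuousAt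
  rw [memLp_two_iff_integrable_sq_norm hc.aestronglyMeasurable]
  obtain ⟨q, dq, q1, ⟨m, q2⟩, -⟩ := h.exists_tail_sq hk
  obtain ⟨d, l1, l2⟩ := h.inner_newFn hk hk
  have re0 := Complex.continuous_re.tendsto 0
  refine integrable_of_nonneg_hasDerivAt (f := fun x => ((γ x : ℂ) * ⟪k x, k x⟫_ℂ).re - q x)
    (by fun_prop) (fun x => ?_) (fun x => sq_nonneg _) ((re0.comp l1).sub q2) ((re0.comp l2).sub q1)
  have h1 := (Complex.reCLM.hasFDerivAt.comp_hasDerivAt x (d x)).sub (dq x)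
  refine h1.congr_deriv ?_
  rw [inner_self_eq_norm_sq_to_K, inner_self_eq_norm_sq_to_K]
  simp [← Complex.ofReal_pow]

/-- The transformed eigenfunction as an element of `H1`. -/
noncomputable def newEig (h : StripData V E ψ γ p σ g) (hV : V.Tame R) (hκ : 0 < κ)
    (hE : E = κ ^ 2) (hφ : IsEigen V E' φ) (hk : IsTail ψ φ k) : H1 F :=
  H1.mk (newFn γ ψ φ k) (newDv γ p ψ φ k)
    (continuous_iff_continuousAt.2 fun x => (h.hasDerivAt_newFn hφ hk x).continuousAt)
    ⟨∅, countable_empty, fun x _ => h.hasDerivAt_newFn hφ hk x⟩ (h.memLp_newFn hφ hk)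
    (memLp_deriv_of_second_deriv (h.hasDerivAt_newFn hφ hk) (h.hasDerivAt_newDv hφ hk)
      (h.memLp_newFn hφ hk) (((h.pot hV hκ hE).memLp (h.memLp_newFn hφ hk)).add
        ((h.memLp_newFn hφ hk).const_smul (E' : ℂ))))

theorem newEig_isEigen (h : StripData V E ψ γ p σ g) (hV : V.Tame R) (hκ : 0 < κ)
    (hE : E = κ ^ 2) (hφ : IsEigen V E' φ) (hk : IsTail ψ φ k) :
    IsEigen (h.pot hV hκ hE) E' (h.newEig hV hκ hE hφ hk) :=
  ⟨h.hasDerivAt_newFn hφ hk, h.hasDerivAt_newDv hφ hk⟩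

theorem mass_newEig (h : StripData V E ψ γ p σ g) (hV : V.Tame R) (hκ : 0 < κ)
    (hE : E = κ ^ 2) (hφ : IsEigen V E' φ) (hk : IsTail ψ φ k) {E₂ : ℝ} {φ' : H1 F} {k' : ℝ → ℂ}
    (hφ' : IsEigen V E₂ φ') (hk' : IsTail ψ φ' k') :
    mass (h.newEig hV hκ hE hφ hk) (h.newEig hV hκ hE hφ' hk') = mass φ φ' := by
  obtain ⟨d, l1, l2⟩ := h.inner_newFn hk hk'
  have i1 := (h.memLp_newFn hφ hk).integrable_inner_two (h.memLp_newFn hφ' hk')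
  have i2 := φ.memLp.integrable_inner_two φ'.memLp
  have := integral_of_hasDerivAt_of_tendsto d (i1.sub i2) l1 l2
  rw [integral_sub i1 i2, sub_zero, sub_eq_zero] at this
  exact this

end StripData
end H1

end

section

open MeasureTheory Filter Topology Set
open scoped ComplexOrder InnerProductSpace

variable {F : Type*} [NormedAddCommGroup F] [InnerProductSpace ℂ F]

namespace H1
variable {V : Potential F} {E R κ : ℝ} {ψ χ : H1 F} {γ p σ g : ℝ → ℝ} {c : ℝ → ℂ}

/-- `c x = ∫_{-∞}^x γ ⟪ψ, χ⟫`. -/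
structure IsHead (γ : ℝ → ℝ) (ψ χ : H1 F) (c : ℝ → ℂ) : Prop where
  dc : ∀ x, HasDerivAt c (γ x * ⟪ψ.fn x, χ.fn x⟫_ℂ) x
  bot : Tendsto c atBot (𝓝 0)

namespace StripData

theorem γ_mono (h : StripData V E ψ γ p σ g) : Monotone γ := by
  refine monotone_of_hasDerivAt_nonneg h.dγ fun x => ?_
  have e2 : p x = ‖ψ.fn x‖ ^ 2 := by
    rw [← Complex.ofReal_re (p x), ← h.uu x]
    exact inner_self_eq_norm_sq (𝕜 := ℂ) _
  rw [e2]; positivity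

theorem p_eq (h : StripData V E ψ γ p σ g) (x : ℝ) : p x = ‖ψ.fn x‖ ^ 2 := by
  rw [← Complex.ofReal_re (p x), ← h.uu x]
  exact inner_self_eq_norm_sq (𝕜 := ℂ) _

theorem exists_isHead (h : StripData V E ψ γ p σ g) (χ : H1 F) : ∃ c, IsHead γ ψ χ c := by
  have hf : Continuous fun x => (γ x : ℂ) * ⟪ψ.fn x, χ.fn x⟫_ℂ :=
    (Complex.continuous_ofReal.comp h.cont.1).mul (ψ.continuous.inner χ.continuous)
  have hi : IntegrableOn (fun x => (γ x : ℂ) * ⟪ψ.fn x, χ.fn x⟫_ℂ) (Iic 0) := by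
    refine Integrable.mono' ((ψ.memLp.integrable_inner_two χ.memLp).norm.const_mul (γ 0)).integrableOn
      hf.aestronglyMeasurable ?_
    filter_upwards [ae_restrict_mem measurableSet_Iic] with x hx
    rw [norm_mul, Complex.norm_real, Real.norm_of_nonneg (h.γ_pos x).le]
    exact mul_le_mul_of_nonneg_right (h.γ_mono hx) (norm_nonneg _)
  refine ⟨fun x => (∫ y in Iic 0, (γ y : ℂ) * ⟪ψ.fn y, χ.fn y⟫_ℂ)
    + ∫ y in (0 : ℝ)..x, (γ y : ℂ) * ⟪ψ.fn y, χ.fn y⟫_ℂ, fun x => ?_, ?_⟩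
  · exact (intervalIntegral.integral_hasDerivAt_right (hf.intervalIntegrable _ _)
      (hf.stronglyMeasurableAtFilter _ _) hf.continuousAt).const_add _
  · have h1 := (intervalIntegral_tendsto_integral_Iic (0 : ℝ) hi tendsto_id).const_sub
      (∫ y in Iic 0, (γ y : ℂ) * ⟪ψ.fn y, χ.fn y⟫_ℂ)
    rw [sub_self] at h1
    refine h1.congr fun x => ?_
    rw [id, intervalIntegral.integral_symm 0 x, sub_neg_eq_add]

/-- The inverse transform of `χ`. -/
noncomputable def oldFn (ψ χ : H1 F) (c : ℝ → ℂ) (x : ℝ) : F := χ.fn x - c x • ψ.fn x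

/-- The derivative of the inverse transform of `χ`. -/
noncomputable def oldDv (γ : ℝ → ℝ) (ψ χ : H1 F) (c : ℝ → ℂ) (x : ℝ) : F :=
  χ.dv x - (((γ x : ℂ) * ⟪ψ.fn x, χ.fn x⟫_ℂ) • ψ.fn x + c x • ψ.dv x)

theorem continuous_head (hc : IsHead γ ψ χ c) : Continuous c :=
  continuous_iff_continuousAt.2 fun x => (hc.dc x).continuousAt

theorem continuous_oldFn (hc : IsHead γ ψ χ c) : Continuous (oldFn ψ χ c) :=
  χ.continuous.sub ((continuous_head hc).smul ψ.continuous)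

theorem memLp_oldFn (h : StripData V E ψ γ p σ g) (hc : IsHead γ ψ χ c) :
    MemLp (oldFn ψ χ c) 2 := by
  have hcont := continuous_oldFn hc
  rw [memLp_two_iff_integrable_sq_norm hcont.aestronglyMeasurable]
  have hd : ∀ x, HasDerivAt (fun x => ‖c x‖ ^ 2 * g x) (‖χ.fn x‖ ^ 2 - ‖oldFn ψ χ c x‖ ^ 2) x := by
    intro x
    have h1 := (((hc.dc x).norm_sq).mul (h.dg x))
    refine h1.congr_deriv ?_
    have e1 := norm_sub_sq (𝕜 := ℂ) (χ.fn x) (c x • ψ.fn x)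
    have e3 : RCLike.re ⟪χ.fn x, c x • ψ.fn x⟫_ℂ
        = (starRingEnd ℂ (c x) * ⟪ψ.fn x, χ.fn x⟫_ℂ).re := by
      rw [inner_re_symm, inner_smul_left]; rfl
    have e4 : ⟪c x, (γ x : ℂ) * ⟪ψ.fn x, χ.fn x⟫_ℂ⟫_ℝ
        = γ x * (starRingEnd ℂ (c x) * ⟪ψ.fn x, χ.fn x⟫_ℂ).re := by
      rw [Complex.inner, ← Complex.re_ofReal_mul]; congr 1; ring
    rw [oldFn, e1, e3, norm_smul, mul_pow, e4, h.p_eq]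
    linear_combination 2 * (starRingEnd ℂ (c x) * ⟪ψ.fn x, χ.fn x⟫_ℂ).re * h.γg x
  have hb : Tendsto (fun x => ‖c x‖ ^ 2 * g x) atBot (𝓝 0) := by
    simpa using (hc.bot.norm.pow 2).mul h.g_bot
  refine integrable_of_intervalIntegral_norm_bounded (a := fun k : ℕ => -(k : ℝ))
    (b := fun k : ℕ => (k : ℝ)) (l := atTop) ((∫ x, ‖χ.fn x‖ ^ 2) + 1)
    (fun i => ((hcont.norm.pow 2).integrableOn_Icc).mono_set Ioc_subset_Icc_self)
    (tendsto_neg_atTop_atBot.comp tendsto_natCast_atTop_atTop) tendsto_natCast_atTop_atTop ?_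
  filter_upwards [(tendsto_neg_atTop_atBot.comp (tendsto_natCast_atTop_atTop (R := ℝ))).eventually
    (hb.eventually (gt_mem_nhds one_pos))] with k hk
  simp only [norm_pow, norm_norm]
  have hχ : Continuous fun x => ‖χ.fn x‖ ^ 2 := χ.continuous.norm.pow 2
  have hφ : Continuous fun x => ‖oldFn ψ χ c x‖ ^ 2 := hcont.norm.pow 2
  have h1 : ∫ x in (-(k : ℝ))..k, (‖χ.fn x‖ ^ 2 - ‖oldFn ψ χ c x‖ ^ 2) = _ :=
    intervalIntegral.integral_eq_sub_of_hasDerivAt (fun x _ => hd x)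
      ((hχ.sub hφ).intervalIntegrable _ _)
  rw [intervalIntegral.integral_sub (hχ.intervalIntegrable _ _) (hφ.intervalIntegrable _ _)] at h1
  have h2 : ∫ x in (-(k : ℝ))..k, ‖χ.fn x‖ ^ 2 ≤ ∫ x, ‖χ.fn x‖ ^ 2 := by
    rw [intervalIntegral.integral_of_le (by linarith [k.cast_nonneg (α := ℝ)])]
    exact setIntegral_le_integral χ.memLp.integrable_sq_norm (ae_of_all _ fun x => sq_nonneg _)
  have h3 : 0 ≤ ‖c k‖ ^ 2 * g k := mul_nonneg (sq_nonneg _) (h.g_pos _).le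
  simp only [Function.comp_apply] at hk
  linarith

theorem exists_sq_bound {f : ℝ → ℝ} (hf : Continuous f) {l : ℝ} (h1 : Tendsto f atBot (𝓝 l))
    (R : ℝ) : ∃ K, ∀ x, x ≤ R → ‖f x‖ ≤ K := by
  obtain ⟨a, ha⟩ := eventually_atBot.1 (h1.norm.eventually (gt_mem_nhds (lt_add_one ‖l‖)))
  obtain ⟨K, hK⟩ := (isCompact_Icc (a := a) (b := R)).exists_bound_of_continuousOn hf.continuousOn
  refine ⟨max K (‖l‖ + 1), fun x hx => ?_⟩
  rcases le_total a x with h | h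
  · exact (hK x ⟨h, hx⟩).trans (le_max_left _ _)
  · exact (ha x h).le.trans (le_max_right _ _)

theorem memLp_oldDv (h : StripData V E ψ γ p σ g) (hV : V.Tame R) (hκ : 0 < κ) (hE : E = κ ^ 2)
    (hc : IsHead γ ψ χ c) : MemLp (oldDv γ ψ χ c) 2 := by
  obtain ⟨K1, hK1⟩ := exists_sq_bound (h.cont.1.mul h.cont.2.1) (h.γ_bot.mul h.p_lim.1) R
  obtain ⟨K2, hK2⟩ := exists_sq_bound (continuous_head hc).norm hc.bot.norm R
  have hcc := continuous_head hc
  have hm : MemLp (fun x => ((γ x : ℂ) * ⟪ψ.fn x, χ.fn x⟫_ℂ) • ψ.fn x) 2 := by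
    refine (χ.memLp.norm.const_mul (max K1 (2 * κ))).of_le
      (((Complex.continuous_ofReal.comp h.cont.1).mul (ψ.continuous.inner χ.continuous)).smul
        ψ.continuous).aestronglyMeasurable (ae_of_all _ fun x => ?_)
    have h1 : γ x * p x ≤ max K1 (2 * κ) := by
      rcases le_total x R with hx | hx
      · exact (le_abs_self _).trans ((hK1 x hx).trans (le_max_left _ _))
      · exact (h.γp_eq hV hκ hE x hx).le.trans (le_max_right _ _)
    rw [norm_smul, norm_mul, Complex.norm_real, Real.norm_of_nonneg (h.γ_pos x).le]
    refine le_trans ?_ (le_abs_self _)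
    have h2 := norm_inner_le_norm (𝕜 := ℂ) (ψ.fn x) (χ.fn x)
    rw [h.p_eq] at h1
    calc γ x * ‖⟪ψ.fn x, χ.fn x⟫_ℂ‖ * ‖ψ.fn x‖
        ≤ γ x * (‖ψ.fn x‖ * ‖χ.fn x‖) * ‖ψ.fn x‖ := by
          have := (h.γ_pos x).le
          gcongr
      _ = γ x * ‖ψ.fn x‖ ^ 2 * ‖χ.fn x‖ := by ring
      _ ≤ _ := by gcongr
  have hm2 : MemLp (fun x => c x • ψ.dv x) 2 := by
    have hφ := h.memLp_oldFn hc
    refine ((ψ.memLp'.norm.const_mul K2).add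
      ((χ.memLp.norm.add hφ.norm).const_mul κ)).of_le
      (hcc.smul h.cont.2.2.2.2).aestronglyMeasurable (ae_of_all _ fun x => ?_)
    refine le_trans ?_ (le_abs_self _)
    have hK2' : 0 ≤ K2 := (norm_nonneg _).trans (hK2 R le_rfl)
    simp only [Pi.add_apply]
    rcases le_total x R with hx | hx
    · rw [norm_smul]
      have := hK2 x hx
      rw [norm_norm] at this
      have h3 : ‖c x‖ * ‖ψ.dv x‖ ≤ K2 * ‖ψ.dv x‖ := by gcongr
      have : 0 ≤ κ * (‖χ.fn x‖ + ‖oldFn ψ χ c x‖) := by positivity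
      linarith
    · have e : c x • ψ.dv x = (κ : ℂ) • (oldFn ψ χ c x - χ.fn x) := by
        rw [h.dv_eq hV hκ hE x hx, oldFn]; module
      rw [e, norm_smul, Complex.norm_real, Real.norm_of_nonneg hκ.le]
      have h3 := norm_sub_le (oldFn ψ χ c x) (χ.fn x)
      have h4 := mul_le_mul_of_nonneg_left h3 hκ.le
      have : 0 ≤ K2 * ‖ψ.dv x‖ := by positivity
      linarith
  exact χ.memLp'.sub (hm.add hm2)

/-- The inverse transform as an element of `H1`. -/
noncomputable def old (h : StripData V E ψ γ p σ g) (hV : V.Tame R) (hκ : 0 < κ) (hE : E = κ ^ 2)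
    (hc : IsHead γ ψ χ c) : H1 F :=
  H1.mk (oldFn ψ χ c) (oldDv γ ψ χ c) (continuous_oldFn hc)
    (by
      obtain ⟨s, hs, hd⟩ := χ.exists_deriv
      exact ⟨s, hs, fun x hx => ((hd x hx).sub ((hc.dc x).smul (h.du x))).congr_deriv
        (by rw [oldDv, add_comm (_ • _)])⟩)
    (h.memLp_oldFn hc) (h.memLp_oldDv hV hκ hE hc)

theorem head_lim (h : StripData V E ψ γ p σ g) (hV : V.Tame R) (hκ : 0 < κ) (hE : E = κ ^ 2)
    (hc : IsHead γ ψ χ c) : Tendsto (fun x => c x • ψ.fn x) atTop (𝓝 0) ∧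
      Tendsto (fun x => ‖c x‖ ^ 2 * g x) atTop (𝓝 0) := by
  have h1 : Tendsto (fun x => c x • ψ.fn x) atTop (𝓝 0) := by
    have h2 := χ.tendsto_zero.2.sub (h.old hV hκ hE hc).tendsto_zero.2
    rw [sub_zero] at h2
    refine h2.congr fun x => ?_
    change χ.fn x - oldFn ψ χ c x = _
    rw [oldFn, sub_sub_cancel]
  refine ⟨h1, ?_⟩
  have h2 : Tendsto (fun x => (2 * κ)⁻¹ * ‖c x • ψ.fn x‖ ^ 2) atTop (𝓝 0) := by
    simpa using (h1.norm.pow 2).const_mul (2 * κ)⁻¹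
  refine h2.congr' ((eventually_ge_atTop R).mono fun x hx => ?_)
  have h3 := h.γp_eq hV hκ hE x hx
  have h4 := h.γg x
  rw [norm_smul, mul_pow, ← h.p_eq]
  have h5 : p x = 2 * κ * g x := by
    calc p x = γ x * g x * p x := by rw [h4, one_mul]
      _ = γ x * p x * g x := by ring
      _ = _ := by rw [h3]
  rw [h5]
  field_simp

theorem isTail_old (h : StripData V E ψ γ p σ g) (hV : V.Tame R) (hκ : 0 < κ) (hE : E = κ ^ 2)
    (hc : IsHead γ ψ χ c) : IsTail ψ (h.old hV hκ hE hc) (fun x => -(c x * g x)) where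
  dk x := by
    refine ((hc.dc x).mul (h.dg x).ofReal_comp).neg.congr_deriv ?_
    change _ = -⟪ψ.fn x, oldFn ψ χ c x⟫_ℂ
    have h4 : (γ x : ℂ) * g x = 1 := by exact_mod_cast h.γg x
    rw [oldFn, inner_sub_right, inner_smul_right, h.uu]
    push_cast
    linear_combination -⟪ψ.fn x, χ.fn x⟫_ℂ * h4
  top := by
    have h1 := ((h.head_lim hV hκ hE hc).2.mul h.g_top).sqrt
    rw [zero_mul, Real.sqrt_zero] at h1
    refine squeeze_zero_norm (fun x => ?_) h1
    rw [norm_neg, norm_mul, Complex.norm_real, Real.norm_of_nonneg (h.g_pos x).le]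
    exact Real.le_sqrt_of_sq_le (by ring_nf; rfl)
  bot := by
    have h1 : Tendsto (fun x => (g x : ℂ)) atBot (𝓝 1) := by
      exact_mod_cast (Complex.continuous_ofReal.tendsto 1).comp h.g_bot
    simpa using (hc.bot.mul h1).neg

theorem newFn_old (h : StripData V E ψ γ p σ g) (hV : V.Tame R) (hκ : 0 < κ) (hE : E = κ ^ 2)
    (hc : IsHead γ ψ χ c) :
    newFn γ ψ (h.old hV hκ hE hc) (fun x => -(c x * g x)) = χ.fn := by
  funext x
  change oldFn ψ χ c x - _ = _
  have h4 : (γ x : ℂ) * g x = 1 := by exact_mod_cast h.γg x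
  have h5 : (γ x : ℂ) * -(c x * g x) = -c x := by linear_combination -(c x) * h4
  rw [oldFn, h5]; module

theorem mass_newEig_old (h : StripData V E ψ γ p σ g) (hV : V.Tame R) (hκ : 0 < κ)
    (hE : E = κ ^ 2) {φ : H1 F} {E' : ℝ} {k : ℝ → ℂ} (hφ : IsEigen V E' φ) (hk : IsTail ψ φ k)
    (hc : IsHead γ ψ χ c) :
    mass (h.newEig hV hκ hE hφ hk) χ = mass φ (h.old hV hκ hE hc) := by
  obtain ⟨d, l1, l2⟩ := h.inner_newFn hk (h.isTail_old hV hκ hE hc)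
  rw [h.newFn_old hV hκ hE hc] at d
  have i1 := (h.memLp_newFn hφ hk).integrable_inner_two χ.memLp
  have i2 := φ.memLp.integrable_inner_two (h.old hV hκ hE hc).memLp
  have := integral_of_hasDerivAt_of_tendsto d (i1.sub i2) l1 l2
  rw [integral_sub i1 i2, sub_zero, sub_eq_zero] at this
  exact this

theorem mass_old (h : StripData V E ψ γ p σ g) (hV : V.Tame R) (hκ : 0 < κ) (hE : E = κ ^ 2)
    (hc : IsHead γ ψ χ c) : mass ψ (h.old hV hκ hE hc) = 0 := by
  have hk := h.isTail_old hV hκ hE hc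
  have := integral_of_hasDerivAt_of_tendsto hk.dk
    (ψ.memLp.integrable_inner_two (h.old hV hκ hE hc).memLp).neg hk.bot hk.top
  rw [integral_neg, sub_zero, neg_eq_zero] at this
  exact this

theorem form_old (h : StripData V E ψ γ p σ g) (hV : V.Tame R) (hκ : 0 < κ) (hE : E = κ ^ 2)
    (hc : IsHead γ ψ χ c) :
    form V (h.old hV hκ hE hc) (h.old hV hκ hE hc) = form (h.pot hV hκ hE) χ χ := by
  obtain ⟨s, hs, hd⟩ := χ.exists_deriv
  have hχv : ∀ x ∉ s, HasDerivAt (fun x => ⟪χ.fn x, ψ.dv x⟫_ℂ)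
    (⟪χ.fn x, V.op x (ψ.fn x) + (E : ℂ) • ψ.fn x⟫_ℂ + ⟪χ.dv x, ψ.dv x⟫_ℂ) x :=
    fun x hx => (hd x hx).inner ℂ (h.dv x)
  have hvχ : ∀ x ∉ s, HasDerivAt (fun x => ⟪ψ.dv x, χ.fn x⟫_ℂ)
    (⟪ψ.dv x, χ.dv x⟫_ℂ + ⟪V.op x (ψ.fn x) + (E : ℂ) • ψ.fn x, χ.fn x⟫_ℂ) x :=
    fun x hx => (h.dv x).inner ℂ (hd x hx)
  have hχu : ∀ x ∉ s, HasDerivAt (fun x => ⟪χ.fn x, ψ.fn x⟫_ℂ)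
    (⟪χ.fn x, ψ.dv x⟫_ℂ + ⟪χ.dv x, ψ.fn x⟫_ℂ) x := fun x hx => (hd x hx).inner ℂ (h.du x)
  have huχ : ∀ x ∉ s, HasDerivAt (fun x => ⟪ψ.fn x, χ.fn x⟫_ℂ)
    (⟪ψ.fn x, χ.dv x⟫_ℂ + ⟪ψ.dv x, χ.fn x⟫_ℂ) x := fun x hx => (h.du x).inner ℂ (hd x hx)
  have hcj : ∀ x, HasDerivAt (fun x => starRingEnd ℂ (c x)) (γ x * ⟪χ.fn x, ψ.fn x⟫_ℂ) x := by
    intro x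
    refine (Complex.conjCLE.hasFDerivAt.comp_hasDerivAt x (hc.dc x)).congr_deriv ?_
    simp
  have hdB : ∀ x ∉ s, HasDerivAt (fun x => -(c x * ⟪χ.fn x, ψ.dv x⟫_ℂ)
      - starRingEnd ℂ (c x) * ⟪ψ.dv x, χ.fn x⟫_ℂ + c x * starRingEnd ℂ (c x) * (σ x + E * g x)
      - γ x * (⟪χ.fn x, ψ.fn x⟫_ℂ * ⟪ψ.fn x, χ.fn x⟫_ℂ))
      ((⟪oldDv γ ψ χ c x, oldDv γ ψ χ c x⟫_ℂ + ⟪oldFn ψ χ c x, V.op x (oldFn ψ χ c x)⟫_ℂ)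
        - (⟪χ.dv x, χ.dv x⟫_ℂ + ⟪χ.fn x, (h.pot hV hκ hE).op x (χ.fn x)⟫_ℂ)) x := by
    intro x hx
    refine (((((hc.dc x).mul (hχv x hx)).neg.sub ((hcj x).mul (hvχ x hx))).add
      (((hc.dc x).mul (hcj x)).mul ((h.dσ x).add ((h.dg x).ofReal_comp.const_mul (E : ℂ))))).sub
      ((h.dγc x).mul ((hχu x hx).mul (huχ x hx)))).congr_deriv ?_
    have h4 : (γ x : ℂ) * g x = 1 := by exact_mod_cast h.γg x
    simp only [Pi.mul_apply, Pi.add_apply, oldFn, oldDv, pot, StripFlow.newOp, _root_.add_apply, rk_apply, etaVec,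
      inner_sub_left, inner_sub_right, inner_add_left, inner_add_right, inner_smul_left,
      inner_smul_right, map_sub, map_mul, map_smul, h.uu, h.uv, h.vu, V.symm,
      Complex.conj_ofReal, inner_conj_symm]
    push_cast
    linear_combination (E : ℂ) * (c x * ⟪χ.fn x, ψ.fn x⟫_ℂ
      + starRingEnd ℂ (c x) * ⟪ψ.fn x, χ.fn x⟫_ℂ) * h4
  have h0 : Tendsto (fun x => (c x, starRingEnd ℂ (c x), γ x, σ x, g x, ψ.fn x, ψ.dv x, χ.fn x))
      atBot (𝓝 (0, 0, 1, 0, 1, 0, 0, 0)) := by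
    have hcc : Tendsto (fun x => starRingEnd ℂ (c x)) atBot (𝓝 0) := by
      simpa [Function.comp_def] using (Complex.continuous_conj.tendsto 0).comp hc.bot
    have hl := h.lim hV
    refine hc.bot.prodMk_nhds (hcc.prodMk_nhds (h.γ_bot.prodMk_nhds ?_))
    exact Tendsto.prodMk_nhds (((continuous_fst.comp (continuous_snd.comp continuous_snd)).tendsto
      _).comp hl) (h.g_bot.prodMk_nhds (ψ.tendsto_zero.1.prodMk_nhds
        (h.eig.deriv.tendsto_zero.1.prodMk_nhds χ.tendsto_zero.1)))
  have hB := tendsto_zero_of_continuous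
    (f := fun q : ℂ × ℂ × ℝ × ℝ × ℝ × F × F × F => -(q.1 * ⟪q.2.2.2.2.2.2.2, q.2.2.2.2.2.2.1⟫_ℂ)
      - q.2.1 * ⟪q.2.2.2.2.2.2.1, q.2.2.2.2.2.2.2⟫_ℂ
      + q.1 * q.2.1 * (q.2.2.2.1 + E * q.2.2.2.2.1)
      - q.2.2.1 * (⟪q.2.2.2.2.2.2.2, q.2.2.2.2.2.1⟫_ℂ * ⟪q.2.2.2.2.2.1, q.2.2.2.2.2.2.2⟫_ℂ))
    (by fun_prop) (by simp) h0
  have hT : Tendsto (fun x => -(c x * ⟪χ.fn x, ψ.dv x⟫_ℂ)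
      - starRingEnd ℂ (c x) * ⟪ψ.dv x, χ.fn x⟫_ℂ + c x * starRingEnd ℂ (c x) * (σ x + E * g x)
      - γ x * (⟪χ.fn x, ψ.fn x⟫_ℂ * ⟪ψ.fn x, χ.fn x⟫_ℂ)) atTop (𝓝 0) := by
    obtain ⟨l1, l2⟩ := h.head_lim hV hκ hE hc
    have lχ := χ.tendsto_zero.2
    have t1 : Tendsto (fun x => c x * ⟪χ.fn x, ψ.dv x⟫_ℂ) atTop (𝓝 0) := by
      have := (lχ.inner l1 (𝕜 := ℂ)).const_mul (-(κ : ℂ))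
      rw [inner_zero_left, mul_zero] at this
      refine this.congr' ((eventually_ge_atTop R).mono fun x hx => ?_)
      beta_reduce
      rw [h.dv_eq hV hκ hE x hx, inner_smul_right, inner_smul_right]; ring
    have t2 : Tendsto (fun x => starRingEnd ℂ (c x) * ⟪ψ.dv x, χ.fn x⟫_ℂ) atTop (𝓝 0) := by
      have := (l1.inner lχ (𝕜 := ℂ)).const_mul (-(κ : ℂ))
      rw [inner_zero_left, mul_zero] at this
      refine this.congr' ((eventually_ge_atTop R).mono fun x hx => ?_)
      beta_reduce
      rw [h.dv_eq hV hκ hE x hx, inner_smul_left, inner_smul_left, map_neg, Complex.conj_ofReal]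
      ring
    have t3 : Tendsto (fun x => c x * starRingEnd ℂ (c x) * (σ x + E * g x)) atTop (𝓝 0) := by
      have := l2.ofReal.const_mul (-(κ : ℂ) ^ 2)
      rw [Complex.ofReal_zero, mul_zero] at this
      refine this.congr' ((eventually_ge_atTop R).mono fun x hx => ?_)
      have h3 : (γ x : ℂ) * p x = 2 * κ := by exact_mod_cast h.γp_eq hV hκ hE x hx
      have h4 : (γ x : ℂ) * g x = 1 := by exact_mod_cast h.γg x
      have h5 : (p x : ℂ) = 2 * κ * g x := by linear_combination g x * h3 - p x * h4
      beta_reduce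
      rw [h.σ_eq hV hκ hE x hx, Complex.mul_conj, Complex.normSq_eq_norm_sq, hE]
      push_cast
      rw [h5]; ring
    have t4 : Tendsto (fun x => γ x * (⟪χ.fn x, ψ.fn x⟫_ℂ * ⟪ψ.fn x, χ.fn x⟫_ℂ)) atTop (𝓝 0) := by
      have := (lχ.norm.pow 2).const_mul (2 * κ)
      rw [norm_zero, zero_pow two_ne_zero, mul_zero] at this
      refine squeeze_zero_norm' ((eventually_ge_atTop R).mono fun x hx => ?_) this
      rw [norm_mul, norm_mul, Complex.norm_real, Real.norm_of_nonneg (h.γ_pos x).le,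
        ← h.γp_eq hV hκ hE x hx, h.p_eq, norm_inner_symm]
      have := norm_inner_le_norm (𝕜 := ℂ) (ψ.fn x) (χ.fn x)
      have h6 := (h.γ_pos x).le
      calc γ x * (‖⟪ψ.fn x, χ.fn x⟫_ℂ‖ * ‖⟪ψ.fn x, χ.fn x⟫_ℂ‖)
          ≤ γ x * ((‖ψ.fn x‖ * ‖χ.fn x‖) * (‖ψ.fn x‖ * ‖χ.fn x‖)) := by gcongr
        _ = _ := by ring
    have t5 := ((t1.neg.sub t2).add t3).sub t4
    rwa [neg_zero, sub_zero, add_zero, sub_zero] at t5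
  have hcont : Continuous (fun x => -(c x * ⟪χ.fn x, ψ.dv x⟫_ℂ)
      - starRingEnd ℂ (c x) * ⟪ψ.dv x, χ.fn x⟫_ℂ + c x * starRingEnd ℂ (c x) * (σ x + E * g x)
      - γ x * (⟪χ.fn x, ψ.fn x⟫_ℂ * ⟪ψ.fn x, χ.fn x⟫_ℂ)) := by
    have := continuous_head hc
    have := χ.continuous
    have := ψ.continuous
    obtain ⟨c1, c2, c3, c4, c5⟩ := h.cont
    have := Complex.continuous_conj.comp (continuous_head hc)
    simp only [Function.comp_def] at this
    fun_prop
  have i1 := integrable_form V (h.old hV hκ hE hc) (h.old hV hκ hE hc)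
  have i2 := integrable_form (h.pot hV hκ hE) χ χ
  obtain ⟨m, n, hm, hn, hmn⟩ := exists_limits_of_integrable_deriv hs hcont hdB (i1.sub i2)
  rw [tendsto_nhds_unique hm hB, tendsto_nhds_unique hn hT, sub_zero] at hmn
  have := integral_sub i1 i2
  rw [form_apply, form_apply, ← sub_eq_zero, ← this]
  exact hmn

/-- One step of the commutation method. -/
theorem positivity_transport (h : StripData V E ψ γ p σ g) (hV : V.Tame R) (hκ : 0 < κ)
    (hE : E = κ ^ 2) {N : ℕ} {e : Fin N → ℝ} {φ : Fin N → H1 F} (hφ : ∀ j, IsEigen V (e j) (φ j))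
    {k : Fin N → ℝ → ℂ} (hk : ∀ j, IsTail ψ (φ j) (k j))
    (hpos : ∀ u, -(E * ‖mass ψ u‖ ^ 2 + ∑ j, e j * ‖mass (φ j) u‖ ^ 2) ≤ (form V u u).re) (χ : H1 F) :
    -(∑ j, e j * ‖mass (h.newEig hV hκ hE (hφ j) (hk j)) χ‖ ^ 2)
      ≤ (form (h.pot hV hκ hE) χ χ).re := by
  obtain ⟨c, hc⟩ := h.exists_isHead χ
  have h1 := hpos (h.old hV hκ hE hc)
  rw [h.form_old hV hκ hE hc, h.mass_old hV hκ hE hc] at h1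
  simp only [h.mass_newEig_old hV hκ hE _ _ hc]
  simpa using h1

end StripData
end H1

end

section

open MeasureTheory Filter Topology Set
open scoped ComplexOrder InnerProductSpace

variable {F : Type*} [NormedAddCommGroup F] [InnerProductSpace ℂ F]

namespace H1
variable {V : Potential F} {E κ : ℝ} {R : ℝ}

theorem StripData.newEig_family {ψ : H1 F} {γ p σ g : ℝ → ℝ} (h : StripData V E ψ γ p σ g) (hV : V.Tame R) (hκ : 0 < κ)
    (hE : E = κ ^ 2) {N : ℕ} {e : Fin N → ℝ} {φ : Fin N → H1 F} (hφ : IsEigenFamily V e φ)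
    {k : Fin N → ℝ → ℂ} (hk : ∀ j, IsTail ψ (φ j) (k j)) :
    IsEigenFamily (h.pot hV hκ hE) e (fun j => h.newEig hV hκ hE (hφ.eig j) (hk j)) where
  eig j := h.newEig_isEigen hV hκ hE (hφ.eig j) (hk j)
  ortho i j := by rw [h.mass_newEig, hφ.ortho]

/-- Iterated commutation removes all negative eigenvalues. -/
theorem exists_stripped [FiniteDimensional ℂ F] {N : ℕ} : ∀ {V : Potential F} (_ : V.Tame R)
    {E κ : Fin N → ℝ} {ψ : Fin N → H1 F} (_ : IsEigenFamily V E ψ) (_ : ∀ j, 0 < κ j)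
    (_ : ∀ j, E j = κ j ^ 2) (_ : ∀ u, -(∑ j, E j * ‖mass (ψ j) u‖ ^ 2) ≤ (form V u u).re),
    ∃ U : Potential F, U.Tame R ∧ (∀ u, 0 ≤ (form U u u).re) ∧
      Linked R (fun x => tr (U.op x) - tr (V.op x)) (4 * ∑ j, κ j : ℝ) ∧
      Linked R (fun x => tr (U.op x * U.op x) - tr (V.op x * V.op x))
        (-(16 / 3) * ∑ j, κ j ^ 3 : ℝ) ∧
      ∀ V' : ℝ → F →L[ℂ] F, (∀ x, HasDerivAt V.op (V' x) x) → Continuous V' →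
        Tendsto V' atBot (𝓝 0) →
        ∃ U' : ℝ → F →L[ℂ] F, (∀ x, HasDerivAt U.op (U' x) x) ∧ Continuous U' ∧
        Tendsto U' atBot (𝓝 0) ∧
        Linked R (fun x => tr (U' x * U' x) - tr (V' x * V' x) + 2 * (tr (U.op x * U.op x * U.op x)
          - tr (V.op x * V.op x * V.op x))) (64 / 5 * ∑ j, κ j ^ 5 : ℝ) := by
  induction N with
  | zero =>
    intro V hV E κ ψ _ _ _ hpos
    refine ⟨V, hV, by simpa using hpos, ?_, ?_, fun V' h1 h2 h3 => ⟨V', h1, h2, h3, ?_⟩⟩ <;>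
    exact (linked_zero R).congr (by simp) (by simp)
  | succ N ih =>
    intro V hV E κ ψ hψ hκ hE hpos
    obtain ⟨γ, p, σ, g, h⟩ := exists_stripData (hψ.eig 0) (by rw [hψ.ortho]; simp)
    have hφ : IsEigenFamily V (fun j : Fin N => E j.succ) (fun j => ψ j.succ) :=
      ⟨fun j => hψ.eig _, fun i j => by rw [hψ.ortho]; simp⟩
    choose k hk using fun j : Fin N => exists_isTail (ψ := ψ 0) (φ := ψ j.succ)
      (by rw [hψ.ortho]; simp [(Fin.succ_ne_zero j).symm])
    obtain ⟨U, hU, hpU, l1, l2, l3⟩ := ih (h.pot_tame hV (hκ 0) (hE 0))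
      (h.newEig_family hV (hκ 0) (hE 0) hφ hk) (fun j => hκ j.succ) (fun j => hE j.succ)
      (h.positivity_transport hV (hκ 0) (hE 0) hφ.eig hk
        (fun u => by simpa only [Fin.sum_univ_succ] using hpos u))
    refine ⟨U, hU, hpU, ?_, ?_, fun V' h1 h2 h3 => ?_⟩
    · refine (l1.add (h.linked_tr hV (hκ 0) (hE 0))).congr (fun x => by ring) ?_
      rw [Fin.sum_univ_succ]; push_cast; ring
    · refine (l2.add (h.linked_tr_sq hV (hκ 0) (hE 0))).congr (fun x => by ring) ?_
      rw [Fin.sum_univ_succ]; push_cast; ring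
    · obtain ⟨W', w1, w2, w3, w4⟩ := h.linked_five hV (hκ 0) (hE 0) h1 h2 h3
      obtain ⟨U', u1, u2, u3, u4⟩ := l3 W' w1 w2 w3
      refine ⟨U', u1, u2, u3, (u4.add w4).congr (fun x => by ring) ?_⟩
      rw [Fin.sum_univ_succ]; push_cast; ring

end H1

end

section

open MeasureTheory Filter Topology Set
open scoped ComplexOrder InnerProductSpace BoundedContinuousFunction

section LinearODE

variable {G : Type*} [NormedAddCommGroup G] [NormedSpace ℝ G] [CompleteSpace G]

omit [CompleteSpace G] in
theorem norm_integral_weighted_le {K : ℝ} {g : ℝ → G} {C : ℝ}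
    (hC : 0 ≤ C) (hg : ∀ t, 0 ≤ t → ‖g t‖ ≤ K * (Real.exp (2 * K * t) * C)) {x : ℝ} (hx : 0 ≤ x) :
    Real.exp (-(2 * K * x)) * ‖∫ t in (0 : ℝ)..x, g t‖ ≤ C / 2 := by
  have hd : ∀ t : ℝ, HasDerivAt (fun t => Real.exp (2 * K * t) * C / 2)
      (K * (Real.exp (2 * K * t) * C)) t := fun t => by
    have := (((hasDerivAt_id t).const_mul (2 * K)).exp.mul_const C).div_const 2
    refine this.congr_deriv ?_
    simp; ring
  have h1 : ‖∫ t in (0 : ℝ)..x, g t‖ ≤ ∫ t in (0 : ℝ)..x, K * (Real.exp (2 * K * t) * C) :=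
    intervalIntegral.norm_integral_le_of_norm_le hx
      (Eventually.of_forall fun t ht => hg t ht.1.le)
      (Continuous.intervalIntegrable (by fun_prop) _ _)
  rw [intervalIntegral.integral_eq_sub_of_hasDerivAt (fun t _ => hd t)
    (Continuous.intervalIntegrable (by fun_prop) _ _)] at h1
  have h2 : Real.exp (-(2 * K * x)) * Real.exp (2 * K * x) = 1 := by
    rw [← Real.exp_add]; simp
  have h3 := Real.exp_pos (-(2 * K * x))
  calc _ ≤ Real.exp (-(2 * K * x)) * (Real.exp (2 * K * x) * C / 2 - C / 2) := by
        gcongr; simpa using h1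
    _ = C / 2 - Real.exp (-(2 * K * x)) * (C / 2) := by linear_combination (C / 2) * h2
    _ ≤ C / 2 := by
      have : 0 ≤ Real.exp (-(2 * K * x)) * (C / 2) := by positivity
      linarith

/-- Global forward solvability of a globally Lipschitz equation with equilibrium at the origin. -/
theorem exists_forward_solution {f : ℝ → G → G} (hf : Continuous fun p : ℝ × G => f p.1 p.2)
    {K : ℝ} (hK : 0 < K) (hL : ∀ t x y, ‖f t x - f t y‖ ≤ K * ‖x - y‖) (h0 : ∀ t, f t 0 = 0)
    (y₀ : G) : ∃ y z : ℝ → G, (∀ x, HasDerivAt y (f x (z x)) x) ∧ y 0 = y₀ ∧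
      (∀ x, 0 ≤ x → z x = y x) ∧ Continuous z := by
  have hwc : ∀ w : ℝ →ᵇ G, Continuous fun t => f t (Real.exp (2 * K * t) • w t) := fun w => by
    have : Continuous fun t => (t, Real.exp (2 * K * t) • w t) := by fun_prop
    exact hf.comp this
  have hexp : ∀ (w : G) (t : ℝ), ‖Real.exp (2 * K * t) • w‖ = Real.exp (2 * K * t) * ‖w‖ :=
    fun w t => by rw [norm_smul, Real.norm_of_nonneg (Real.exp_pos _).le]
  let T : (ℝ →ᵇ G) → (ℝ →ᵇ G) := fun w => BoundedContinuousFunction.ofNormedAddCommGroup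
    (fun x => Real.exp (-(2 * K * max x 0)) •
      (y₀ + ∫ t in (0 : ℝ)..(max x 0), f t (Real.exp (2 * K * t) • w t)))
    (by
      have : Continuous fun x => ∫ t in (0 : ℝ)..x, f t (Real.exp (2 * K * t) • w t) :=
        intervalIntegral.continuous_primitive (fun a b => (hwc w).intervalIntegrable _ _) _
      have := this.comp (continuous_id.max (continuous_const (y := (0 : ℝ))))
      simp only [Function.comp_def, id] at this
      fun_prop) (‖y₀‖ + ‖w‖ / 2) (fun x => by
      have hx := le_max_right x 0
      rw [norm_smul, Real.norm_of_nonneg (Real.exp_pos _).le]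
      have h1 := norm_integral_weighted_le (norm_nonneg w)
        (g := fun t => f t (Real.exp (2 * K * t) • w t)) (fun t _ => by
          have := hL t (Real.exp (2 * K * t) • w t) 0
          rw [h0, sub_zero, sub_zero, hexp] at this
          exact this.trans (by gcongr; exact w.norm_coe_le_norm t)) hx
      have h2 : Real.exp (-(2 * K * max x 0)) ≤ 1 := by
        rw [Real.exp_le_one_iff]; have : 0 ≤ 2 * K * max x 0 := by positivity
        linarith
      calc _ ≤ Real.exp (-(2 * K * max x 0)) * (‖y₀‖ + _) := by gcongr; exact norm_add_le _ _
        _ ≤ 1 * ‖y₀‖ + ‖w‖ / 2 := by rw [mul_add]; gcongr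
        _ = _ := by rw [one_mul])
  have hTx : ∀ w x, T w x = Real.exp (-(2 * K * max x 0)) •
      (y₀ + ∫ t in (0 : ℝ)..(max x 0), f t (Real.exp (2 * K * t) • w t)) := fun _ _ => rfl
  have hT : ContractingWith (1 / 2) T := by
    refine ⟨by rw [← NNReal.coe_lt_coe]; norm_num, LipschitzWith.of_dist_le_mul fun w v => ?_⟩
    rw [BoundedContinuousFunction.dist_le (by positivity)]
    intro x
    have hx := le_max_right x 0
    rw [dist_eq_norm, dist_eq_norm, hTx, hTx, ← smul_sub, norm_smul, Real.norm_of_nonneg (Real.exp_pos _).le, add_sub_add_left_eq_sub,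
      ← intervalIntegral.integral_sub ((hwc w).intervalIntegrable _ _)
        ((hwc v).intervalIntegrable _ _)]
    refine (norm_integral_weighted_le (norm_nonneg (w - v)) (fun t _ => ?_) hx).trans
      (le_of_eq (by push_cast; ring))
    refine (hL t _ _).trans ?_
    rw [← smul_sub, hexp]
    gcongr
    exact (w - v).norm_coe_le_norm t
  obtain ⟨w, hw⟩ : ∃ w, T w = w := ⟨_, hT.fixedPoint_isFixedPt⟩
  refine ⟨fun x => y₀ + ∫ t in (0 : ℝ)..x, f t (Real.exp (2 * K * t) • w t),
    fun t => Real.exp (2 * K * t) • w t, fun x => ?_, by simp, fun x hx => ?_, by fun_prop⟩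
  · exact ((hwc w).integral_hasStrictDerivAt 0 x).hasDerivAt.const_add _
  · have h1 : w x = T w x := by rw [hw]
    beta_reduce
    rw [h1, hTx, max_eq_left hx, smul_smul, ← Real.exp_add]
    simp

end LinearODE

end

section

open MeasureTheory Filter Topology Set
open scoped ComplexOrder InnerProductSpace

section trial

/-- The function equal to `0` up to `a`, to `f` on `(a, R]`, and to `g` beyond `R`. -/
noncomputable def glue {G : Type*} [Zero G] (a R : ℝ) (f g : ℝ → G) (x : ℝ) : G :=
  if x ≤ a then 0 else if x ≤ R then f x else g x

section glue
variable {G : Type*} [NormedAddCommGroup G] {a R : ℝ} {f g f' g' : ℝ → G}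

theorem continuous_glue (h : a < R) (hf : Continuous f) (hg : Continuous g) (ha : f a = 0)
    (hR : f R = g R) : Continuous (glue a R f g) := by
  refine Continuous.if_le continuous_const (Continuous.if_le hf hg continuous_id continuous_const ?_)
    continuous_id continuous_const ?_
  · rintro x rfl; exact hR
  · intro x hx
    rw [hx, if_pos h.le, ha]

theorem hasDerivAt_glue [NormedSpace ℝ G] (h : a < R) (hf : ∀ x ≤ R, HasDerivAt f (f' x) x)
    (hg : ∀ x, HasDerivAt g (g' x) x) {x : ℝ} (hx : x ∉ ({a, R} : Set ℝ)) :
    HasDerivAt (glue a R f g) (glue a R f' g' x) x := by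
  simp only [mem_insert_iff, mem_singleton_iff, not_or] at hx
  rcases lt_or_gt_of_ne hx.1 with h1 | h1
  · have e : glue a R f g =ᶠ[𝓝 x] fun _ => 0 := by
      filter_upwards [Iio_mem_nhds h1] with y hy
      simp [glue, (mem_Iio.1 hy).le]
    rw [glue, if_pos h1.le]
    exact (hasDerivAt_const x (0 : G)).congr_of_eventuallyEq e
  rcases lt_or_gt_of_ne hx.2 with h2 | h2
  · have e : glue a R f g =ᶠ[𝓝 x] f := by
      filter_upwards [Ioo_mem_nhds h1 h2] with y hy
      simp [glue, hy.1.not_ge, hy.2.le]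
    rw [glue, if_neg h1.not_ge, if_pos h2.le]
    exact (hf x h2.le).congr_of_eventuallyEq e
  · have e : glue a R f g =ᶠ[𝓝 x] g := by
      filter_upwards [Ioi_mem_nhds h2] with y hy
      simp [glue, (h.trans hy).not_ge, (mem_Ioi.1 hy).not_ge]
    rw [glue, if_neg h1.not_ge, if_neg h2.not_ge]
    exact (hg x).congr_of_eventuallyEq e

theorem memLp_glue (h : a < R) (hf : Continuous f) (hg : MemLp ((Ioi R).indicator g) 2) :
    MemLp (glue a R f g) 2 := by
  have h1 : MemLp ((Ioc a R).indicator f) 2 := by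
    rw [memLp_indicator_iff_restrict measurableSet_Ioc]
    have hb : ∃ C, ∀ x ∈ Icc a R, ‖f x‖ ≤ C := isCompact_Icc.exists_bound_of_continuousOn hf.continuousOn
    obtain ⟨C, hC⟩ := hb
    have hm : AEStronglyMeasurable f (volume.restrict (Ioc a R)) :=
      hf.aestronglyMeasurable
    refine MemLp.of_bound hm C ?_
    filter_upwards [ae_restrict_mem measurableSet_Ioc] with x hx
    exact hC x (Ioc_subset_Icc_self hx)
  refine (h1.add hg).ae_eq (Eventually.of_forall fun x => ?_)
  simp only [Pi.add_apply, indicator, glue, mem_Ioc, mem_Ioi]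
  by_cases h1 : x ≤ a
  · simp [h1, h1.not_gt, h1.trans h.le]
  · by_cases h2 : x ≤ R
    · simp [h1, h2, not_le.1 h1]
    · simp [h1, h2, not_le.1 h2]

end glue

variable {F : Type*} [NormedAddCommGroup F] [InnerProductSpace ℂ F]

theorem memLp_exp_tail {θ : ℝ} (hθ : 0 < θ) (R : ℝ) (c : F) :
    MemLp ((Ioi R).indicator fun x => Real.exp (-θ * (x - R)) • c) 2 := by
  rw [memLp_indicator_iff_restrict measurableSet_Ioi, memLp_two_iff_integrable_sq_norm
    (by
      have : Continuous fun x => Real.exp (-θ * (x - R)) := by fun_prop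
      exact this.aestronglyMeasurable.smul aestronglyMeasurable_const)]
  have h1 := ((integrableOn_exp_mul_Ioi (a := -(2 * θ)) (by linarith) R).const_mul
    (Real.exp (2 * θ * R) * ‖c‖ ^ 2))
  refine h1.congr (Eventually.of_forall fun x => ?_)
  have : Real.exp (-θ * (x - R)) ^ 2 = Real.exp (2 * θ * R) * Real.exp (-(2 * θ) * x) := by
    rw [← Real.exp_add, ← Real.exp_nat_mul]; push_cast; ring_nf
  simp only [norm_smul, mul_pow, Real.norm_eq_abs, Real.abs_exp, this]; ring

/-- A solution at energy zero with a negative slope at `R` does not vanish to the left of `R` when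
the quadratic form is nonnegative. -/
theorem eq_zero_of_form_nonneg [CompleteSpace F] {U : Potential F} {R : ℝ} (hU : U.Tame R)
    (hpos : ∀ u, 0 ≤ (H1.form U u u).re) {f f' : ℝ → F} (hf : Continuous f) (hf' : Continuous f')
    (h1 : ∀ x ≤ R, HasDerivAt f (f' x) x) (h2 : ∀ x ≤ R, HasDerivAt f' (U.op x (f x)) x)
    {θ : ℝ} (hθ : 0 < θ) {c : F} (hc : f R = c) (hc' : f' R = -θ • c) {a : ℝ} (ha : a < R)
    (h0 : f a = 0) : c = 0 := by
  have dE : ∀ x, HasDerivAt (fun x => Real.exp (-θ * (x - R))) (-θ * Real.exp (-θ * (x - R))) x :=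
    fun x => by
      refine (((hasDerivAt_id x).sub_const R).const_mul (-θ)).exp.congr_deriv ?_
      simp; ring
  let φ : H1 F := H1.mk (glue a R f fun x => Real.exp (-θ * (x - R)) • c)
    (glue a R f' fun x => Real.exp (-θ * (x - R)) • (-θ • c))
    (continuous_glue ha hf (by fun_prop) h0 (by simp [hc]))
    ⟨{a, R}, (countable_singleton R).insert a, fun x hx => hasDerivAt_glue ha h1
      (fun x => ((dE x).smul_const c).congr_deriv (by module)) hx⟩
    (memLp_glue ha hf (memLp_exp_tail hθ R c)) (memLp_glue ha hf' (memLp_exp_tail hθ R _))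
  have hfn : ∀ x, φ.fn x = glue a R f (fun x => Real.exp (-θ * (x - R)) • c) x := fun _ => rfl
  have hdv : ∀ x, φ.dv x = glue a R f' (fun x => Real.exp (-θ * (x - R)) • (-θ • c)) x :=
    fun _ => rfl
  let g₁ : ℝ → ℝ := fun x => (⟪f x, f' x⟫_ℂ).re
  let g₂ : ℝ → ℝ := fun x => -(θ / 2) * ‖c‖ ^ 2 * (Real.exp (-θ * (x - R)) ^ 2 + 1)
  have hg₂ : ∀ x, HasDerivAt g₂ (θ ^ 2 * ‖c‖ ^ 2 * Real.exp (-θ * (x - R)) ^ 2) x := fun x => by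
    refine ((((dE x).pow 2).add_const 1).const_mul (-(θ / 2) * ‖c‖ ^ 2)).congr_deriv ?_
    simp; ring
  have hg₁ : ∀ x ≤ R, HasDerivAt g₁ (‖f' x‖ ^ 2 + (⟪f x, U.op x (f x)⟫_ℂ).re) x := fun x hx => by
    refine (Complex.reCLM.hasFDerivAt.comp_hasDerivAt x
      (HasDerivAt.inner ℂ (h1 x hx) (h2 x hx))).congr_deriv ?_
    simp [inner_self_eq_norm_sq_to_K, ← Complex.ofReal_pow]; ring
  have hF : Continuous (glue a R g₁ g₂) := continuous_glue ha (by fun_prop) (by fun_prop)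
    (by simp [g₁, h0]) (by
      simp only [g₁, g₂, hc, hc', ← Complex.coe_smul, inner_smul_right]
      simp [inner_self_eq_norm_sq_to_K, ← Complex.ofReal_pow]; ring)
  have key := exists_limits_of_integrable_deriv (s := {a, R}) ((countable_singleton R).insert a)
    hF (f' := fun x => ‖φ.dv x‖ ^ 2 + (⟪φ.fn x, U.op x (φ.fn x)⟫_ℂ).re) (fun x hx => by
      refine (hasDerivAt_glue ha hg₁ hg₂ hx).congr_deriv ?_
      rw [hfn, hdv]
      simp only [glue]
      split_ifs with i1 i2
      · simp
      · rfl
      · rw [hU.zero x (not_le.1 i2).le]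
        simp only [norm_smul, mul_pow, Real.norm_eq_abs, sq_abs, _root_.zero_apply,
          inner_zero_right, Complex.zero_re]
        ring) (H1.integrable_form_self U φ)
  obtain ⟨m, n, hm, hn, hmn⟩ := key
  have hm0 : m = 0 := by
    refine tendsto_nhds_unique hm (tendsto_const_nhds.congr' ?_)
    filter_upwards [Iic_mem_atBot a] with x hx
    simp [glue, mem_Iic.1 hx]
  have hn0 : n = -(θ / 2) * ‖c‖ ^ 2 := by
    refine tendsto_nhds_unique hn ?_
    have e1 : Tendsto (fun x => Real.exp (-θ * (x - R))) atTop (𝓝 0) :=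
      Real.tendsto_exp_atBot.comp ((tendsto_atTop_add_const_right _ (-R)
        tendsto_id).const_mul_atTop_of_neg (by linarith))
    have e2 : Tendsto g₂ atTop (𝓝 (-(θ / 2) * ‖c‖ ^ 2 * (0 ^ 2 + 1))) :=
      ((e1.pow 2).add_const 1).const_mul _
    rw [show -(θ / 2) * ‖c‖ ^ 2 * ((0 : ℝ) ^ 2 + 1) = -(θ / 2) * ‖c‖ ^ 2 by ring] at e2
    refine e2.congr' ?_
    filter_upwards [Ioi_mem_atTop R] with x hx
    simp [glue, (ha.trans hx).not_ge, (mem_Ioi.1 hx).not_ge]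
  have := hpos φ
  rw [H1.form_self_re, hmn, hm0, hn0] at this
  have h3 : ‖c‖ ^ 2 ≤ 0 := by
    by_contra hcon
    have : 0 < θ / 2 * ‖c‖ ^ 2 := mul_pos (by linarith) (not_le.1 hcon)
    linarith
  have : ‖c‖ = 0 := by nlinarith [norm_nonneg c]
  exact norm_eq_zero.1 this

end trial

end

section

open MeasureTheory Filter Topology Set
open scoped ComplexOrder InnerProductSpace

section riccati

variable {F : Type*} [NormedAddCommGroup F] [InnerProductSpace ℂ F]

theorem exists_matrix_solution [FiniteDimensional ℂ F] (U : Potential F) (R θ : ℝ) :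
    ∃ M M' : ℝ → F →L[ℂ] F, Continuous M ∧ Continuous M' ∧ M R = 1 ∧ M' R = -θ • 1 ∧
      (∀ x ≤ R, HasDerivAt M (M' x) x) ∧ ∀ x ≤ R, HasDerivAt M' (U.op x * M x) x := by
  have : CompleteSpace F := FiniteDimensional.complete ℂ F
  obtain ⟨C, hC⟩ := U.bdd
  have hC0 : 0 ≤ C := (norm_nonneg _).trans (hC 0)
  have hc := U.cont
  obtain ⟨y, z, hy, hy0, hyz, -⟩ := exists_forward_solution (G := (F →L[ℂ] F) × (F →L[ℂ] F))
    (f := fun s p => (-p.2, -(U.op (R - s) * p.1)))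
    (by
      have h1 : Continuous fun p : ℝ × ((F →L[ℂ] F) × (F →L[ℂ] F)) => U.op (R - p.1) :=
        hc.comp (by fun_prop)
      have h2 : Continuous fun p : ℝ × ((F →L[ℂ] F) × (F →L[ℂ] F)) => p.2.1 := by fun_prop
      exact (continuous_snd.comp continuous_snd).neg.prodMk (h1.mul h2).neg)
    (K := C + 1) (by linarith) (fun t x y => by
      have e1 : ‖x.2 - y.2‖ ≤ ‖x - y‖ := norm_snd_le (x - y)
      have e2 : ‖x.1 - y.1‖ ≤ ‖x - y‖ := norm_fst_le (x - y)
      rw [Prod.mk_sub_mk, Prod.norm_mk]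
      refine max_le ?_ ?_
      · rw [neg_sub_neg, norm_sub_rev]
        nlinarith [norm_nonneg (x - y)]
      · rw [neg_sub_neg, norm_sub_rev, ← mul_sub]
        calc _ ≤ ‖U.op (R - t)‖ * ‖x.1 - y.1‖ := norm_mul_le _ _
          _ ≤ C * ‖x - y‖ := by gcongr; exact hC _
          _ ≤ _ := by nlinarith [norm_nonneg (x - y)])
    (fun t => by simp) (1, -θ • 1)
  have hyc : Continuous y := continuous_iff_continuousAt.2 fun x => (hy x).continuousAt
  have hyR : ∀ x ≤ R, HasDerivAt (fun x => y (R - x)) ((y (R - x)).2, U.op x * (y (R - x)).1) x :=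
    fun x hx => by
      have := (hy (R - x)).scomp x ((hasDerivAt_id x).const_sub R)
      refine this.congr_deriv ?_
      rw [hyz _ (sub_nonneg.2 hx)]
      simp
  refine ⟨fun x => (y (R - x)).1, fun x => (y (R - x)).2, by fun_prop, by fun_prop, by simp [hy0],
    by simp [hy0], fun x hx => ?_, fun x hx => ?_⟩
  · exact (hasFDerivAt_fst.comp_hasDerivAt x (hyR x hx) :)
  · exact (hasFDerivAt_snd.comp_hasDerivAt x (hyR x hx) :)

/-- A symmetric solution of the Riccati equation on `(-∞, R]`. -/
theorem exists_riccati [FiniteDimensional ℂ F] {U : Potential F} {R : ℝ} (hU : U.Tame R)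
    (hpos : ∀ u, 0 ≤ (H1.form U u u).re) {θ : ℝ} (hθ : 0 < θ) :
    ∃ f : ℝ → F →L[ℂ] F, f R = -θ • 1 ∧ (∀ x ≤ R, HasDerivAt f (U.op x - f x * f x) x) ∧
      ∀ x ≤ R, ∀ u v, ⟪f x u, v⟫_ℂ = ⟪u, f x v⟫_ℂ := by
  have : CompleteSpace F := FiniteDimensional.complete ℂ F
  obtain ⟨M, M', cM, cM', hM, hM', dM, dM'⟩ := exists_matrix_solution U R θ
  have ap : ∀ {A : ℝ → F →L[ℂ] F} {A' : F →L[ℂ] F} {x : ℝ} (v : F), HasDerivAt A A' x →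
      HasDerivAt (fun x => A x v) (A' v) x := fun v h =>
    ((ContinuousLinearMap.apply ℂ F v).restrictScalars ℝ).hasFDerivAt.comp_hasDerivAt _ h
  have hu : ∀ x ≤ R, IsUnit (M x) := fun x hx => by
    rw [ContinuousLinearMap.isUnit_iff_isUnit_toLinearMap, LinearMap.isUnit_iff_ker_eq_bot,
      LinearMap.ker_eq_bot']
    intro v hv
    rcases hx.lt_or_eq with hx | rfl
    · exact eq_zero_of_form_nonneg hU hpos (f := fun x => M x v) (f' := fun x => M' x v)
        (by fun_prop) (by fun_prop) (fun x hx => ap v (dM x hx)) (fun x hx => ap v (dM' x hx))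
        hθ (by simp [hM]) (by simp [hM']) hx hv
    · simpa [hM] using hv
  refine ⟨fun x => M' x * Ring.inverse (M x), by simp [hM, hM'], fun x hx => ?_, fun x hx u v => ?_⟩
  · obtain ⟨w, hw⟩ := hu x hx
    have h1 : HasDerivAt (fun x => Ring.inverse (M x)) (-(Ring.inverse (M x) * M' x *
        Ring.inverse (M x))) x := by
      have h2 := hasFDerivAt_ringInverse (𝕜 := ℝ) w
      rw [hw] at h2
      refine (h2.comp_hasDerivAt x (dM x hx)).congr_deriv ?_
      rw [← hw, Ring.inverse_unit]
      simp
    refine ((dM' x hx).mul h1).congr_deriv ?_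
    have h3 : M x * Ring.inverse (M x) = 1 := Ring.mul_inverse_cancel _ (hu x hx)
    rw [mul_assoc (U.op x), h3]
    noncomm_ring
  · have h3 : M x * Ring.inverse (M x) = 1 := Ring.mul_inverse_cancel _ (hu x hx)
    have hW : ∀ a b, ⟪M x a, M' x b⟫_ℂ - ⟪M' x a, M x b⟫_ℂ = 0 := fun a b => by
      have d : ∀ y ≤ R, HasDerivAt (fun y => ⟪M y a, M' y b⟫_ℂ - ⟪M' y a, M y b⟫_ℂ) 0 y :=
        fun y hy => by
          refine ((HasDerivAt.inner ℂ (ap a (dM y hy)) (ap b (dM' y hy))).sub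
            (HasDerivAt.inner ℂ (ap a (dM' y hy)) (ap b (dM y hy)))).congr_deriv ?_
          simp [U.symm]
          ring
      have := constant_of_has_deriv_right_zero (a := x) (b := R)
        (f := fun y => ⟪M y a, M' y b⟫_ℂ - ⟪M' y a, M y b⟫_ℂ)
        (fun y hy => (d y hy.2).continuousAt.continuousWithinAt)
        (fun y hy => (d y hy.2.le).hasDerivWithinAt) R (right_mem_Icc.2 hx)
      rw [← this]
      simp only [hM, hM']
      simp [← Complex.coe_smul, inner_smul_left, inner_smul_right]
    have e : ∀ u, M x (Ring.inverse (M x) u) = u := fun u => by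
      have := congrArg (fun A : F →L[ℂ] F => A u) h3
      exact this
    have := hW (Ring.inverse (M x) u) (Ring.inverse (M x) v)
    rw [e, e, sub_eq_zero] at this
    exact this.symm

end riccati

end

section

open MeasureTheory Filter Topology Set
open scoped ComplexOrder InnerProductSpace

section terminal

variable {F : Type*} [NormedAddCommGroup F] [InnerProductSpace ℂ F] [FiniteDimensional ℂ F]

/-- The boundary term in the lower bound for potentials without negative spectrum. -/
noncomputable def terminalForm (c : ℂ) (f g : F →L[ℂ] F) : ℂ :=
  2 * tr (f * g * g) + 6 / 5 * tr (f * f * f * f * f) - 4 * c / 3 * tr (f * f * f) + c ^ 2 * tr f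
    - 2 * c * tr (f * g) + 2 * tr (f * f * f * g)

theorem HasDerivAt.tr {f : ℝ → F →L[ℂ] F} {f' : F →L[ℂ] F} {x : ℝ} (h : HasDerivAt f f' x) :
    HasDerivAt (fun x => _root_.tr (f x)) (_root_.tr f') x :=
  ((_root_.tr (F := F)).restrictScalars ℝ).hasFDerivAt.comp_hasDerivAt x h

theorem tr_terminal (c : ℂ) (f g h : F →L[ℂ] F) :
    tr ((h + g * f + f * g) * (h + g * f + f * g))
      + 2 * tr ((g + f * f) * (g + f * f) * (g + f * f))
      - 2 * c * tr ((g + f * f) * (g + f * f)) + c ^ 2 * tr (g + f * f)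
    = tr ((h - f * f * f + c • f) * (h - f * f * f + c • f)) + 4 * tr (f * f * (g * g))
      + tr (f * f * f * (f * f * f))
      + (2 * tr ((g * g + f * h) * g + f * g * h)
        + 6 / 5 * tr ((((g * f + f * g) * f + f * f * g) * f + f * f * f * g) * f
            + f * f * f * f * g)
        - 4 * c / 3 * tr ((g * f + f * g) * f + f * f * g) + c ^ 2 * tr g
        - 2 * c * tr (g * g + f * h) + 2 * tr (((g * f + f * g) * f + f * f * g) * g
          + f * f * f * h)) := by
  have e1 : tr (h * f) = tr (f * h) := by
    simpa only [← mul_assoc] using tr_mul_comm (h) (f)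
  have e2 : tr (f * g * f) = tr (f * f * g) := by
    simpa only [← mul_assoc] using tr_mul_comm (f * g) (f)
  have e3 : tr (g * f * f) = tr (f * f * g) := by
    simpa only [← mul_assoc] using tr_mul_comm (g) (f * f)
  have e4 : tr (g * f * h) = tr (f * h * g) := by
    simpa only [← mul_assoc] using tr_mul_comm (g) (f * h)
  have e6 : tr (h * f * g) = tr (f * g * h) := by
    simpa only [← mul_assoc] using tr_mul_comm (h) (f * g)
  have e7 : tr (h * g * f) = tr (f * h * g) := by
    simpa only [← mul_assoc] using tr_mul_comm (h * g) (f)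
  have e8 : tr (f * g * g * f) = tr (f * f * g * g) := by
    simpa only [← mul_assoc] using tr_mul_comm (f * g * g) (f)
  have e9 : tr (g * f * f * g) = tr (f * f * g * g) := by
    simpa only [← mul_assoc] using tr_mul_comm (g) (f * f * g)
  have e10 : tr (g * f * g * f) = tr (f * g * f * g) := by
    simpa only [← mul_assoc] using tr_mul_comm (g) (f * g * f)
  have e11 : tr (g * g * f * f) = tr (f * f * g * g) := by
    simpa only [← mul_assoc] using tr_mul_comm (g * g) (f * f)
  have e14 : tr (h * f * f * f) = tr (f * f * f * h) := by
    simpa only [← mul_assoc] using tr_mul_comm (h) (f * f * f)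
  have e15 : tr (f * f * f * g * f) = tr (f * f * f * f * g) := by
    simpa only [← mul_assoc] using tr_mul_comm (f * f * f * g) (f)
  have e16 : tr (f * f * g * f * f) = tr (f * f * f * f * g) := by
    simpa only [← mul_assoc] using tr_mul_comm (f * f * g) (f * f)
  have e17 : tr (f * g * f * f * f) = tr (f * f * f * f * g) := by
    simpa only [← mul_assoc] using tr_mul_comm (f * g) (f * f * f)
  have e18 : tr (g * f * f * f * f) = tr (f * f * f * f * g) := by
    simpa only [← mul_assoc] using tr_mul_comm (g) (f * f * f * f)
  simp only [add_mul, mul_add, sub_mul, mul_sub, smul_mul_assoc, mul_smul_comm, map_add, map_sub,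
    map_smul, smul_eq_mul, smul_smul, ← mul_assoc, smul_add, smul_sub]
  simp only [e1, e2, e3, e4, e6, e7, e8, e9, e10, e11, e14, e15, e16, e17, e18]
  ring

theorem hasDerivAt_terminalForm (c : ℂ) {f g : ℝ → F →L[ℂ] F} {h : F →L[ℂ] F} {x : ℝ}
    (hf : HasDerivAt f (g x) x) (hg : HasDerivAt g h x) :
    HasDerivAt (fun x => terminalForm c (f x) (g x))
      (2 * tr ((g x * g x + f x * h) * g x + f x * g x * h)
        + 6 / 5 * tr ((((g x * f x + f x * g x) * f x + f x * f x * g x) * f x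
            + f x * f x * f x * g x) * f x + f x * f x * f x * f x * g x)
        - 4 * c / 3 * tr ((g x * f x + f x * g x) * f x + f x * f x * g x) + c ^ 2 * tr (g x)
        - 2 * c * tr (g x * g x + f x * h)
        + 2 * tr (((g x * f x + f x * g x) * f x + f x * f x * g x) * g x
          + f x * f x * f x * h)) x :=
  (((((((hf.mul hg).mul hg).tr.const_mul 2).add
    (((((hf.mul hf).mul hf).mul hf).mul hf).tr.const_mul (6 / 5))).sub
    (((hf.mul hf).mul hf).tr.const_mul (4 * c / 3))).add (hf.tr.const_mul (c ^ 2))).sub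
    ((hf.mul hg).tr.const_mul (2 * c))).add ((((hf.mul hf).mul hf).mul hg).tr.const_mul 2)

section trace

variable {A B : F →L[ℂ] F}

theorem tr_eq_sum_inner (A : F →L[ℂ] F) :
    tr A = ∑ i, ⟪stdOrthonormalBasis ℂ F i, A (stdOrthonormalBasis ℂ F i)⟫_ℂ := by
  rw [tr_apply, LinearMap.trace_eq_sum_inner _ (stdOrthonormalBasis ℂ F)]; rfl

theorem tr_mul_self_re (hA : ∀ u v, ⟪A u, v⟫_ℂ = ⟪u, A v⟫_ℂ) :
    (tr (A * A)).re = ∑ i, ‖A (stdOrthonormalBasis ℂ F i)‖ ^ 2 := by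
  rw [tr_eq_sum_inner, Complex.re_sum]
  refine Finset.sum_congr rfl fun i _ => ?_
  rw [mul_apply_eq_comp, ← hA, inner_self_eq_norm_sq_to_K]
  simp [← Complex.ofReal_pow]

theorem tr_mul_self_nonneg (hA : ∀ u v, ⟪A u, v⟫_ℂ = ⟪u, A v⟫_ℂ) : 0 ≤ (tr (A * A)).re := by
  rw [tr_mul_self_re hA]; positivity

theorem tr_sq_mul_sq_nonneg (hA : ∀ u v, ⟪A u, v⟫_ℂ = ⟪u, A v⟫_ℂ)
    (hB : ∀ u v, ⟪B u, v⟫_ℂ = ⟪u, B v⟫_ℂ) : 0 ≤ (tr (A * A * (B * B))).re := by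
  rw [← mul_assoc, tr_mul_comm, tr_eq_sum_inner, Complex.re_sum]
  refine Finset.sum_nonneg fun i _ => ?_
  simp only [mul_apply_eq_comp]
  rw [← hB, ← hA, inner_self_eq_norm_sq_to_K]
  simp only [Complex.coe_algebraMap, ← Complex.ofReal_pow, Complex.ofReal_re]
  positivity

theorem sq_norm_le_tr (hA : ∀ u v, ⟪A u, v⟫_ℂ = ⟪u, A v⟫_ℂ) : ‖A‖ ^ 2 ≤ (tr (A * A)).re := by
  set e := stdOrthonormalBasis ℂ F
  have h : ‖A‖ ≤ Real.sqrt (tr (A * A)).re := by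
    refine ContinuousLinearMap.opNorm_le_bound _ (Real.sqrt_nonneg _) fun x => ?_
    rw [tr_mul_self_re hA]
    have h1 : A x = ∑ i, ⟪e i, x⟫_ℂ • A (e i) := by
      conv_lhs => rw [← e.sum_repr' x]
      simp
    calc ‖A x‖ ≤ ∑ i, ‖A (e i)‖ * ‖⟪e i, x⟫_ℂ‖ := by
          rw [h1]; refine (norm_sum_le _ _).trans (le_of_eq ?_)
          exact Finset.sum_congr rfl fun i _ => by rw [norm_smul, mul_comm]
      _ ≤ Real.sqrt (∑ i, ‖A (e i)‖ ^ 2) * Real.sqrt (∑ i, ‖⟪e i, x⟫_ℂ‖ ^ 2) :=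
          Real.sum_mul_le_sqrt_mul_sqrt _ _ _
      _ = _ := by rw [e.sum_sq_norm_inner_right, Real.sqrt_sq (norm_nonneg _)]
  calc ‖A‖ ^ 2 ≤ Real.sqrt (tr (A * A)).re ^ 2 := by gcongr
    _ = _ := Real.sq_sqrt (tr_mul_self_nonneg hA)

theorem sq_tr_le (hA : ∀ u v, ⟪A u, v⟫_ℂ = ⟪u, A v⟫_ℂ) :
    (tr A).re ^ 2 ≤ Module.finrank ℂ F * (tr (A * A)).re := by
  rw [tr_mul_self_re hA, tr_eq_sum_inner, Complex.re_sum]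
  refine sq_sum_le_card_mul_sum_sq.trans ?_
  rw [Finset.card_univ, Fintype.card_fin]
  refine mul_le_mul_of_nonneg_left (Finset.sum_le_sum fun i _ => ?_) (Nat.cast_nonneg _)
  rw [← sq_abs]
  refine pow_le_pow_left₀ (abs_nonneg _) ?_ 2
  refine (Complex.abs_re_le_norm _).trans ((norm_inner_le_norm _ _).trans ?_)
  simp

end trace

end terminal

end

section

open MeasureTheory Filter Topology Set
open scoped ComplexOrder InnerProductSpace

theorem monotoneOn_Iic_of_hasDerivAt {f f' : ℝ → ℝ} {b : ℝ} (h : ∀ x ≤ b, HasDerivAt f (f' x) x)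
    (h0 : ∀ x ≤ b, 0 ≤ f' x) : MonotoneOn f (Iic b) :=
  monotoneOn_of_hasDerivWithinAt_nonneg (convex_Iic b)
    (fun x hx => (h x hx).continuousAt.continuousWithinAt)
    (fun x hx => (h x (mem_Iic.1 (interior_subset hx))).hasDerivWithinAt)
    (fun x hx => h0 x (mem_Iic.1 (interior_subset hx)))

/-- A scalar Riccati inequality that cannot persist on a half-line unless its quadratic term becomes
small. -/
theorem frequently_small_of_riccati {t s P q : ℝ → ℝ} {R C n : ℝ} (hn : 0 < n)
    (ht : ∀ x ≤ R, HasDerivAt t (q x - s x) x) (hts : ∀ x ≤ R, t x ^ 2 ≤ n * s x)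
    (hP : ∀ x, HasDerivAt P (q x) x) (hC : ∀ a ≤ R, P R - P a ≤ C) {ε : ℝ} (hε : 0 < ε) :
    ∃ᶠ a in atBot, s a < ε := by
  intro hcon
  obtain ⟨a₀, h0⟩ := eventually_atBot.1 (hcon.and (Iic_mem_atBot R))
  have haR : a₀ ≤ R := (h0 a₀ le_rfl).2
  have hs : ∀ a ≤ a₀, ε ≤ s a := fun a ha => not_lt.1 (h0 a ha).1
  set c := C - t R
  let K : ℝ → ℝ := fun a => t a - P a + (P R - t R) - c
  have hK : ∀ x ≤ R, HasDerivAt K (-s x) x := fun x hx => by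
    refine ((((ht x hx).sub (hP x)).add_const (P R - t R)).sub_const c).congr_deriv (by ring)
  have htK : ∀ x ≤ R, K x ≤ t x := fun x hx => by
    have := hC x hx
    simp only [K, c]; linarith
  have m1 : MonotoneOn (fun x => -(K x) - ε * x) (Iic a₀) :=
    monotoneOn_Iic_of_hasDerivAt (f' := fun x => s x - ε) (fun x hx => by
      refine ((hK x (hx.trans haR)).neg.sub ((hasDerivAt_id x).const_mul ε)).congr_deriv (by ring))
      fun x hx => by linarith [hs x hx]
  obtain ⟨a₁, ha₁, hK1⟩ : ∃ a₁ ≤ a₀, 0 < K a₁ := by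
    have hle : a₀ - (|K a₀| + 1) / ε ≤ a₀ := by
      have : 0 ≤ (|K a₀| + 1) / ε := by positivity
      linarith
    refine ⟨a₀ - (|K a₀| + 1) / ε, hle, ?_⟩
    have := m1 (mem_Iic.2 hle) (mem_Iic.2 le_rfl) hle
    simp only at this
    have e : ε * (a₀ - (|K a₀| + 1) / ε) = ε * a₀ - (|K a₀| + 1) := by field_simp
    rw [e] at this
    linarith [neg_abs_le (K a₀)]
  have hKpos : ∀ x ≤ a₁, 0 < K x := fun x hx => by
    have := m1 (a := x) (b := a₁) (mem_Iic.2 (hx.trans ha₁)) (mem_Iic.2 ha₁) hx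
    simp only at this
    nlinarith
  have m2 : MonotoneOn (fun x => (K x)⁻¹ - x / n) (Iic a₁) :=
    monotoneOn_Iic_of_hasDerivAt (f' := fun x => s x / K x ^ 2 - 1 / n) (fun x hx => by
      have hxR := (hx.trans ha₁).trans haR
      refine (((hK x hxR).inv (hKpos x hx).ne').sub ((hasDerivAt_id x).div_const n)).congr_deriv
        (by simp)) fun x hx => by
      have hxR := (hx.trans ha₁).trans haR
      have hk := hKpos x hx
      rw [sub_nonneg, div_le_div_iff₀ hn (by positivity), one_mul]
      calc K x ^ 2 ≤ t x ^ 2 := pow_le_pow_left₀ hk.le (htK x hxR) 2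
        _ ≤ _ := by rw [mul_comm]; exact hts x hxR
  have hx : a₁ - n * (K a₁)⁻¹ ≤ a₁ := by
    have : 0 < n * (K a₁)⁻¹ := by positivity
    linarith
  have h1 := m2 (a := a₁ - n * (K a₁)⁻¹) (b := a₁) (mem_Iic.2 hx) (mem_Iic.2 le_rfl) hx
  have h2 : 0 < (K (a₁ - n * (K a₁)⁻¹))⁻¹ := inv_pos.2 (hKpos _ hx)
  have h3 : (a₁ - n * (K a₁)⁻¹) / n = a₁ / n - (K a₁)⁻¹ := by field_simp
  simp only [h3] at h1
  linarith

section terminal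

variable {F : Type*} [NormedAddCommGroup F] [InnerProductSpace ℂ F]

theorem symm_of_hasDerivAt {A : ℝ → F →L[ℂ] F} {A' : F →L[ℂ] F} {s : Set ℝ} {x : ℝ}
    (hs : s ∈ 𝓝[≤] x) (h : HasDerivAt A A' x)
    (hA : ∀ y ∈ s, ∀ u v, ⟪A y u, v⟫_ℂ = ⟪u, A y v⟫_ℂ) (u v : F) : ⟪A' u, v⟫_ℂ = ⟪u, A' v⟫_ℂ := by
  have ap : ∀ v : F, HasDerivAt (fun x => A x v) (A' v) x := fun v =>
    ((ContinuousLinearMap.apply ℂ F v).restrictScalars ℝ).hasFDerivAt.comp_hasDerivAt _ h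
  have h1 := HasDerivAt.inner ℂ (ap u) (hasDerivAt_const x v)
  have h2 := HasDerivAt.inner ℂ (hasDerivAt_const x u) (ap v)
  simp only [inner_zero_left, inner_zero_right, zero_add, add_zero] at h1 h2
  refine (uniqueDiffOn_Iic x x self_mem_Iic).eq_deriv _ h1.hasDerivWithinAt
    (h2.hasDerivWithinAt.congr_of_eventuallyEq ?_ ?_)
  · filter_upwards [hs] with y hy using hA y hy u v
  · exact hA x (mem_of_mem_nhdsWithin self_mem_Iic hs) u v

variable [FiniteDimensional ℂ F]

theorem continuous_terminalForm (c : ℂ) :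
    Continuous fun p : (F →L[ℂ] F) × (F →L[ℂ] F) => terminalForm c p.1 p.2 := by
  unfold terminalForm; fun_prop

theorem terminalForm_zero (c : ℂ) : terminalForm c (0 : F →L[ℂ] F) 0 = 0 := by
  simp [terminalForm]

theorem tendsto_terminalForm (c : ℂ) : Tendsto (fun θ : ℝ =>
    (terminalForm c (-θ • (1 : F →L[ℂ] F)) (-(θ ^ 2) • 1)).re) (𝓝[>] 0) (𝓝 0) := by
  have h1 : Continuous fun θ : ℝ => (-θ • (1 : F →L[ℂ] F), -(θ ^ 2) • (1 : F →L[ℂ] F)) := by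
    fun_prop
  have h2 := (Complex.continuous_re.comp ((continuous_terminalForm c).comp h1)).tendsto 0
  have e : (Complex.re ∘ (fun p : (F →L[ℂ] F) × (F →L[ℂ] F) => terminalForm c p.1 p.2) ∘
      fun θ : ℝ => (-θ • (1 : F →L[ℂ] F), -(θ ^ 2) • (1 : F →L[ℂ] F))) 0 = 0 := by
    simp [terminalForm_zero]
  rw [e] at h2
  exact h2.mono_left nhdsWithin_le_nhds

set_option maxHeartbeats 600000 in
theorem terminal_inequality {U : Potential F} {R : ℝ} (hU : U.Tame R)
    (hpos : ∀ u, 0 ≤ (H1.form U u u).re) {U' : ℝ → F →L[ℂ] F} (hU' : ∀ x, HasDerivAt U.op (U' x) x)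
    {P : ℝ → ℝ} {C : ℝ} (hP : ∀ x, HasDerivAt P (tr (U.op x)).re x) (hC : ∀ a ≤ R, P R - P a ≤ C)
    {Q : ℝ → ℝ} {c q : ℝ} (hQ : ∀ x, HasDerivAt Q (tr (U' x * U' x)
      + 2 * tr (U.op x * U.op x * U.op x) - 2 * c * tr (U.op x * U.op x)
      + c ^ 2 * tr (U.op x)).re x) (hq : Tendsto Q atBot (𝓝 q)) : q ≤ Q R := by
  have key : ∀ θ : ℝ, 0 < θ →
      q ≤ Q R - (terminalForm c (-θ • (1 : F →L[ℂ] F)) (-(θ ^ 2) • 1)).re := by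
    intro θ hθ
    obtain ⟨f, hfR, hf, fs⟩ := exists_riccati hU hpos hθ
    let g : ℝ → F →L[ℂ] F := fun x => U.op x - f x * f x
    let h : ℝ → F →L[ℂ] F := fun x => U' x - (g x * f x + f x * g x)
    have hg : ∀ x ≤ R, HasDerivAt g (h x) x := fun x hx => (hU' x).sub ((hf x hx).mul (hf x hx))
    have gs : ∀ x ≤ R, ∀ u v, ⟪g x u, v⟫_ℂ = ⟪u, g x v⟫_ℂ := fun x hx u v => by
      simp [g, U.symm, fs x hx]
    have hs : ∀ x ≤ R, ∀ u v, ⟪h x u, v⟫_ℂ = ⟪u, h x v⟫_ℂ := fun x hx u v =>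
      symm_of_hasDerivAt (s := Iic x) self_mem_nhdsWithin (hg x hx)
        (fun y hy => gs y (le_trans hy hx)) u v
    have mono : MonotoneOn (fun x => Q x - (terminalForm c (f x) (g x)).re) (Iic R) := by
      refine monotoneOn_Iic_of_hasDerivAt (fun x hx => (hQ x).sub
        (Complex.reCLM.hasFDerivAt.comp_hasDerivAt x
          (hasDerivAt_terminalForm c (hf x hx) (hg x hx)))) fun x hx => ?_
      have e1 : U' x = h x + g x * f x + f x * g x := by simp only [h]; abel
      have e2 : U.op x = g x + f x * f x := by simp only [g]; abel
      rw [e1, e2, tr_terminal, sub_nonneg]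
      have p1 : 0 ≤ (tr ((h x - f x * f x * f x + (c : ℂ) • f x) *
          (h x - f x * f x * f x + (c : ℂ) • f x))).re := tr_mul_self_nonneg fun u v => by
        simp [fs x hx, hs x hx]
      have p2 := tr_sq_mul_sq_nonneg (fs x hx) (gs x hx)
      have p3 : 0 ≤ (tr (f x * f x * f x * (f x * f x * f x))).re :=
        tr_mul_self_nonneg fun u v => by simp [fs x hx]
      rw [Complex.add_re, Complex.add_re, Complex.add_re _ (4 * _)]
      have p4 : (4 * tr (f x * f x * (g x * g x))).re = 4 * (tr (f x * f x * (g x * g x))).re := by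
        simp
      rw [p4]
      refine le_add_of_nonneg_left ?_
      positivity
    have hgR : g R = -(θ ^ 2) • 1 := by
      simp only [g, hU.zero R le_rfl, hfR]
      simp [smul_smul, sq]
    refine le_of_forall_pos_le_add fun ε hε => ?_
    obtain ⟨δ, hδ, hball⟩ := Metric.continuousAt_iff.1
      ((continuous_terminalForm (F := F) c).continuousAt (x := (0, 0))) (ε / 2) (by positivity)
    set η := min 1 (δ / 2)
    have hη : 0 < η := by positivity
    have hfreq : ∃ᶠ a in atBot, (tr (f a * f a)).re < η ^ 2 :=
      frequently_small_of_riccati (t := fun x => (tr (f x)).re) (q := fun x => (tr (U.op x)).re)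
        (n := Module.finrank ℂ F + 1) (by positivity)
        (fun x hx => by
          refine (Complex.reCLM.hasFDerivAt.comp_hasDerivAt x (hf x hx).tr).congr_deriv ?_
          simp) (fun x hx => (sq_tr_le (fs x hx)).trans (by
            have := tr_mul_self_nonneg (fs x hx)
            linarith)) hP hC (by positivity)
    have ev1 : ∀ᶠ a in atBot, ‖U.op a‖ < δ / 2 := by
      have := hU.lim.norm
      rw [norm_zero] at this
      exact this.eventually_lt_const (by positivity)
    have ev2 : ∀ᶠ a in atBot, q - ε / 2 < Q a := hq.eventually_const_lt (by linarith)
    obtain ⟨a, ha, ha1, ha2, ha3⟩ :=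
      (hfreq.and_eventually (ev1.and (ev2.and (Iic_mem_atBot R)))).exists
    have hfa : ‖f a‖ < η := lt_of_pow_lt_pow_left₀ 2 hη.le ((sq_norm_le_tr (fs a ha3)).trans_lt ha)
    have hga : ‖g a‖ < δ := by
      have : ‖f a * f a‖ ≤ ‖f a‖ * ‖f a‖ := norm_mul_le _ _
      have h1 : ‖g a‖ ≤ ‖U.op a‖ + ‖f a * f a‖ := norm_sub_le _ _
      have h2 : η ≤ 1 := min_le_left _ _
      have h3 : η ≤ δ / 2 := min_le_right _ _
      nlinarith [norm_nonneg (f a)]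
    have hb := @hball (f a, g a) (by
      rw [dist_eq_norm, Prod.mk_sub_mk, sub_zero, sub_zero, Prod.norm_mk, max_lt_iff]
      exact ⟨hfa.trans_le ((min_le_right _ _).trans (by linarith)), hga⟩)
    simp only [terminalForm_zero, dist_zero_right] at hb
    have hb' := (Complex.abs_re_le_norm _).trans hb.le
    have := mono (a := a) (b := R) ha3 (mem_Iic.2 le_rfl) ha3
    simp only [hfR, hgR] at this
    have := (abs_le.1 hb').2
    linarith
  have hlim := (tendsto_terminalForm (F := F) c).const_sub (Q R)
  rw [sub_zero] at hlim
  exact ge_of_tendsto hlim (by filter_upwards [self_mem_nhdsWithin] with θ hθ using key θ hθ)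

end terminal

end

section

open MeasureTheory Filter Topology Set
open scoped ComplexOrder InnerProductSpace FourierTransform

theorem fourier_exp_neg_abs {c : ℝ} (hc : 0 < c) (w : ℝ) :
    Integrable (fun t : ℝ => (Real.exp (-c * |t|) : ℂ)) ∧
    𝓕 (fun t : ℝ => (Real.exp (-c * |t|) : ℂ)) w =
      ((2 * c / (c ^ 2 + (2 * Real.pi * w) ^ 2) : ℝ) : ℂ) := by
  have key : ∀ y : ℝ, Integrable (fun t : ℝ => Complex.exp (↑(y * t) * Complex.I) * (Real.exp (-c * |t|) : ℂ)) ∧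
      ∫ t : ℝ, Complex.exp (↑(y * t) * Complex.I) * (Real.exp (-c * |t|) : ℂ) =
      ((2 * c / (c ^ 2 + y ^ 2) : ℝ) : ℂ) := by
    intro y
    set f : ℝ → ℂ := fun t : ℝ => Complex.exp (↑(y * t) * Complex.I) * (Real.exp (-c * |t|) : ℂ)
    have e1 : EqOn (fun t : ℝ => Complex.exp ((-c + y * Complex.I) * t)) f (Ioi 0) := by
      intro t ht
      simp only [f]
      rw [abs_of_pos (mem_Ioi.1 ht), Complex.ofReal_exp, ← Complex.exp_add]
      push_cast; ring_nf
    have e2 : EqOn (fun t : ℝ => Complex.exp ((c + y * Complex.I) * t)) f (Iic 0) := by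
      intro t ht
      simp only [f]
      rw [abs_of_nonpos (mem_Iic.1 ht), Complex.ofReal_exp, ← Complex.exp_add]
      push_cast; ring_nf
    have r1 : (-(c : ℂ) + y * Complex.I).re < 0 := by simp [hc]
    have r2 : 0 < ((c : ℂ) + y * Complex.I).re := by simp [hc]
    have i1 : IntegrableOn f (Ioi 0) :=
      (integrableOn_exp_mul_complex_Ioi r1 0).congr_fun e1 measurableSet_Ioi
    have i2 : IntegrableOn f (Iic 0) :=
      (integrableOn_exp_mul_complex_Iic r2 0).congr_fun e2 measurableSet_Iic
    have hf : Integrable f := by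
      rw [← integrableOn_univ, ← Iic_union_Ioi (a := (0 : ℝ))]
      exact i2.union i1
    refine ⟨hf, ?_⟩
    rw [← intervalIntegral.integral_Iic_add_Ioi i2 i1,
      ← setIntegral_congr_fun measurableSet_Ioi e1, ← setIntegral_congr_fun measurableSet_Iic e2,
      integral_exp_mul_complex_Ioi r1, integral_exp_mul_complex_Iic r2]
    have h1 : (-(c : ℂ) + y * Complex.I) ≠ 0 := fun h => by rw [h] at r1; simp at r1
    have h2 : ((c : ℂ) + y * Complex.I) ≠ 0 := fun h => by rw [h] at r2; simp at r2
    have h3 : ((c : ℂ) ^ 2 + y ^ 2) ≠ 0 := by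
      have : c ^ 2 + y ^ 2 ≠ 0 := by positivity
      exact_mod_cast this
    push_cast
    simp only [mul_zero, Complex.exp_zero]
    field_simp
    linear_combination (-2 * c * y ^ 2 : ℂ) * Complex.I_sq
  constructor
  · simpa using (key 0).1
  · rw [Real.fourier_real_eq_integral_exp_smul]
    have := (key (-2 * Real.pi * w)).2
    rw [show (-2 * Real.pi * w) ^ 2 = (2 * Real.pi * w) ^ 2 by ring] at this
    rw [← this]
    congr 1; ext t
    rw [smul_eq_mul]; congr 4; ring

/-- The Poisson kernel and the positive definiteness of `exp (-c|t|)`. -/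
theorem exists_poisson_kernel {c : ℝ} (hc : 0 < c) : ∃ q : ℝ → ℝ, Continuous q ∧ (∀ ξ, 0 < q ξ) ∧
    Integrable q ∧ ∫ ξ, q ξ = 1 ∧ ∀ t : ℝ, ∫ ξ, (q ξ : ℂ) * Complex.exp (↑(2 * Real.pi * ξ * t) * Complex.I) =
      (Real.exp (-c * |t|) : ℂ) := by
  set q : ℝ → ℝ := fun ξ => 2 * c / (c ^ 2 + (2 * Real.pi * ξ) ^ 2)
  have hq : Continuous q := by
    refine continuous_const.div (by fun_prop) fun ξ => by positivity
  have hF : 𝓕 (fun t : ℝ => (Real.exp (-c * |t|) : ℂ)) = fun ξ => (q ξ : ℂ) := by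
    ext w; exact (fourier_exp_neg_abs hc w).2
  have hi : Integrable q := by
    have h := (integrable_inv_one_add_sq.comp_mul_left' (R := 2 * Real.pi / c) (by positivity)).const_mul (2 / c)
    refine h.congr (ae_of_all _ fun ξ => ?_)
    simp only [q]
    field_simp
  have hfi := (fourier_exp_neg_abs hc 0).1
  have hinv : ∀ t : ℝ, ∫ ξ, (q ξ : ℂ) * Complex.exp (↑(2 * Real.pi * ξ * t) * Complex.I) =
      (Real.exp (-c * |t|) : ℂ) := by
    intro t
    have h := Continuous.fourierInv_fourier_eq (f := fun t : ℝ => (Real.exp (-c * |t|) : ℂ)) (by fun_prop) hfi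
      (by rw [hF]; exact hi.ofReal)
    rw [hF] at h
    have h2 := congrFun h t
    rw [← h2, Real.fourierInv_eq']
    congr 1; ext ξ
    rw [smul_eq_mul, mul_comm]
    congr 3
    simp
    ring
  refine ⟨q, hq, fun ξ => by positivity, hi, ?_, hinv⟩
  have h0 := hinv 0
  simp only [mul_zero, Complex.ofReal_zero, zero_mul, Complex.exp_zero, mul_one, abs_zero, Real.exp_zero, Complex.ofReal_one] at h0
  rw [integral_complex_ofReal] at h0
  exact_mod_cast h0

variable {F : Type*} [NormedAddCommGroup F] [InnerProductSpace ℂ F]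

/-- The exponential (Yukawa) energy of a vector-valued density. -/
noncomputable def yukawa (a : ℝ) (h : ℝ → F) : ℝ :=
  ∫ p : ℝ × ℝ, Real.exp (-a * |p.1 - p.2|) * (⟪h p.1, h p.2⟫_ℂ).re

/-- Multiplication by a character. -/
noncomputable def modulate (ξ : ℝ) (h : ℝ → F) (x : ℝ) : F :=
  Complex.exp (↑(2 * Real.pi * ξ * x) * Complex.I) • h x

theorem continuous_modulate {h : ℝ → F} (hc : Continuous h) (ξ : ℝ) : Continuous (modulate ξ h) := by
  unfold modulate; fun_prop

theorem inner_modulate (ξ : ℝ) (g h : ℝ → F) (x y : ℝ) :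
    ⟪modulate ξ g x, modulate ξ h y⟫_ℂ =
      Complex.exp (↑(2 * Real.pi * ξ * (y - x)) * Complex.I) * ⟪g x, h y⟫_ℂ := by
  unfold modulate
  rw [inner_smul_left, inner_smul_right, ← Complex.exp_conj, ← mul_assoc, ← Complex.exp_add]
  congr 2
  simp only [map_mul, Complex.conj_ofReal, Complex.conj_I]
  push_cast; ring

theorem integrable_yukawa_norm {h : ℝ → F} (hc : Continuous h) (hs : HasCompactSupport h) (a : ℝ) :
    Integrable fun p : ℝ × ℝ => Real.exp (-a * |p.1 - p.2|) * ‖⟪h p.1, h p.2⟫_ℂ‖ := by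
  refine Continuous.integrable_of_hasCompactSupport (by fun_prop) ?_
  refine HasCompactSupport.intro (hs.isCompact.prod hs.isCompact) fun p hp => ?_
  have : p.1 ∉ tsupport h ∨ p.2 ∉ tsupport h := by
    by_contra! H; exact hp ⟨H.1, H.2⟩
  rcases this with H | H <;> simp [image_eq_zero_of_notMem_tsupport H]

theorem integrable_yukawa {h : ℝ → F} (hc : Continuous h) (hs : HasCompactSupport h) (a : ℝ) :
    Integrable fun p : ℝ × ℝ => Real.exp (-a * |p.1 - p.2|) * (⟪h p.1, h p.2⟫_ℂ).re := by
  refine (integrable_yukawa_norm hc hs a).mono'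
    (Continuous.aestronglyMeasurable (by fun_prop)) (ae_of_all _ fun p => ?_)
  rw [norm_mul, Real.norm_of_nonneg (Real.exp_pos _).le]
  exact mul_le_mul_of_nonneg_left (Complex.abs_re_le_norm _) (Real.exp_pos _).le

theorem yukawa_zero [CompleteSpace F] {h : ℝ → F} (hc : Continuous h) (hs : HasCompactSupport h) :
    yukawa 0 h = ‖∫ x, h x‖ ^ 2 := by
  have hi := hc.integrable_of_hasCompactSupport hs (μ := volume)
  have h1 : Integrable fun p : ℝ × ℝ => (⟪h p.1, h p.2⟫_ℂ).re := by
    simpa using integrable_yukawa hc hs 0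
  have : yukawa 0 h = ∫ x, ∫ y, (⟪h x, h y⟫_ℂ).re := by
    unfold yukawa
    simp only [neg_zero, zero_mul, Real.exp_zero, one_mul]
    exact integral_prod _ h1
  rw [this, show ‖∫ x, h x‖ ^ 2 = (⟪∫ x, h x, ∫ x, h x⟫_ℂ).re by
    rw [inner_self_eq_norm_sq_to_K]; simp [← Complex.ofReal_pow]]
  have e1 : ∀ x, ∫ y, (⟪h x, h y⟫_ℂ).re = (⟪h x, ∫ y, h y⟫_ℂ).re := fun x => by
    rw [← integral_inner hi]
    exact integral_re (𝕜 := ℂ) (hi.const_inner (𝕜 := ℂ) (h x))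
  simp only [e1]
  have e2 : ∀ x, (⟪h x, ∫ y, h y⟫_ℂ).re = (⟪∫ y, h y, h x⟫_ℂ).re := fun x => by
    rw [← inner_conj_symm, Complex.conj_re]
  simp only [e2]
  rw [← integral_inner hi]
  exact integral_re (𝕜 := ℂ) (hi.const_inner (𝕜 := ℂ) (∫ y, h y))

theorem yukawa_eq_integral_modulate {h : ℝ → F} (hc : Continuous h) (hs : HasCompactSupport h)
    {a b : ℝ} {q : ℝ → ℝ} (hq : Continuous q) (hq0 : ∀ ξ, 0 < q ξ) (hqi : Integrable q)
    (hP : ∀ t : ℝ, ∫ ξ, (q ξ : ℂ) * Complex.exp (↑(2 * Real.pi * ξ * t) * Complex.I) =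
      (Real.exp (-(b - a) * |t|) : ℂ)) :
    Integrable (fun ξ => q ξ * yukawa a (modulate ξ h)) ∧
    yukawa b h = ∫ ξ, q ξ * yukawa a (modulate ξ h) := by
  set G : (ℝ × ℝ) × ℝ → ℝ := fun z => q z.2 * (Real.exp (-a * |z.1.1 - z.1.2|) *
    (Complex.exp (↑(2 * Real.pi * z.2 * (z.1.2 - z.1.1)) * Complex.I) * ⟪h z.1.1, h z.1.2⟫_ℂ).re)
  have hG : Integrable G := by
    refine ((integrable_yukawa_norm hc hs a).mul_prod hqi).mono'
      (Continuous.aestronglyMeasurable (by fun_prop)) (ae_of_all _ fun z => ?_)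
    simp only [G]
    rw [norm_mul, norm_mul, Real.norm_of_nonneg (Real.exp_pos _).le,
      Real.norm_of_nonneg (hq0 _).le, mul_comm]
    refine mul_le_mul_of_nonneg_right (mul_le_mul_of_nonneg_left ?_ (Real.exp_pos _).le) (hq0 _).le
    refine (Complex.abs_re_le_norm _).trans ?_
    rw [norm_mul, Complex.norm_exp_ofReal_mul_I, one_mul]
  have e1 : ∀ ξ, q ξ * yukawa a (modulate ξ h) = ∫ p : ℝ × ℝ, G (p, ξ) := by
    intro ξ
    simp only [yukawa, inner_modulate, G]
    rw [integral_const_mul]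
  simp only [e1]
  refine ⟨hG.integral_prod_right, ?_⟩
  rw [← integral_prod_symm _ hG, integral_prod _ hG]
  unfold yukawa
  congr 1; ext p
  have e2 : ∀ ξ, G (p, ξ) = Real.exp (-a * |p.1 - p.2|) *
      (((q ξ : ℂ) * Complex.exp (↑(2 * Real.pi * ξ * (p.2 - p.1)) * Complex.I)) * ⟪h p.1, h p.2⟫_ℂ).re := by
    intro ξ
    simp only [G]
    rw [mul_assoc (q ξ : ℂ), Complex.re_ofReal_mul]; ring
  simp only [e2]
  rw [integral_const_mul]
  have hi : Integrable fun ξ => ((q ξ : ℂ) * Complex.exp (↑(2 * Real.pi * ξ * (p.2 - p.1)) * Complex.I)) := by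
    refine hqi.mono (Continuous.aestronglyMeasurable (by fun_prop)) (ae_of_all _ fun ξ => ?_)
    rw [norm_mul, Complex.norm_exp_ofReal_mul_I, mul_one, Complex.norm_real]
  have e3 := integral_re (hi.mul_const ⟪h p.1, h p.2⟫_ℂ)
  simp only [RCLike.re_to_complex] at e3
  rw [e3, integral_mul_const, hP, Complex.re_ofReal_mul, ← mul_assoc, ← Real.exp_add]
  congr 2
  rw [abs_sub_comm p.2 p.1]; ring

theorem exists_modulate_yukawa_le {ι : Type*} [Fintype ι] {h : ι → ℝ → F} (hc : ∀ i, Continuous (h i))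
    (hs : ∀ i, HasCompactSupport (h i)) {a b : ℝ} (hab : a ≤ b) :
    ∃ ξ : ℝ, ∑ i, yukawa b (h i) ≤ ∑ i, yukawa a (modulate ξ (h i)) := by
  rcases hab.eq_or_lt with rfl | hab
  · refine ⟨0, le_of_eq ?_⟩
    refine Finset.sum_congr rfl fun i _ => ?_
    congr 1; ext x; simp [modulate]
  · obtain ⟨q, hq, hq0, hqi, hq1, hP⟩ := exists_poisson_kernel (sub_pos.2 hab)
    have H := fun i => yukawa_eq_integral_modulate (hc i) (hs i) (a := a) (b := b) hq hq0 hqi hP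
    by_contra! hlt
    set M := ∑ i, yukawa b (h i)
    have hM : M = ∫ ξ, q ξ * ∑ i, yukawa a (modulate ξ (h i)) := by
      simp only [Finset.mul_sum]
      rw [integral_finsetSum _ fun i _ => (H i).1]
      exact Finset.sum_congr rfl fun i _ => (H i).2
    have hi : Integrable fun ξ => q ξ * ∑ i, yukawa a (modulate ξ (h i)) := by
      simp only [Finset.mul_sum]
      exact integrable_finsetSum _ fun i _ => (H i).1
    have hpos : 0 < ∫ ξ, (q ξ * M - q ξ * ∑ i, yukawa a (modulate ξ (h i))) := by
      have hp : ∀ ξ, 0 < q ξ * M - q ξ * ∑ i, yukawa a (modulate ξ (h i)) := fun ξ => by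
        rw [← mul_sub]; exact mul_pos (hq0 ξ) (sub_pos.2 (hlt ξ))
      rw [integral_pos_iff_support_of_nonneg (fun ξ => (hp ξ).le) ((hqi.mul_const M).sub hi)]
      rw [show Function.support (fun ξ => q ξ * M - q ξ * ∑ i, yukawa a (modulate ξ (h i))) = univ from
        Set.eq_univ_of_forall fun ξ => (hp ξ).ne']
      simp
    rw [integral_sub (hqi.mul_const M) hi, integral_mul_const, hq1, ← hM] at hpos
    simp at hpos

end

section

open MeasureTheory Filter Topology Set
open scoped ComplexOrder InnerProductSpace

variable {F : Type*} [NormedAddCommGroup F] [InnerProductSpace ℂ F]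

theorem exists_exponential_convolution [CompleteSpace F] {h : ℝ → F} (hc : Continuous h) {R κ : ℝ} (hR : 0 < R)
    (hκ : 0 < κ) (h0 : ∀ x, R < |x| → h x = 0) : ∃ u : ℝ → F,
      (∀ x, HasDerivAt u (-κ • u x + h x) x) ∧ MemLp u 2 ∧
      ∀ x, u x = ∫ y in (-R)..x, Real.exp (-κ * (x - y)) • h y := by
  set W : ℝ → F := fun x => ∫ y in (-R)..x, Real.exp (κ * y) • h y
  have hW : ∀ x, HasDerivAt W (Real.exp (κ * x) • h x) x := fun x =>
    intervalIntegral.integral_hasDerivAt_right (Continuous.intervalIntegrable (by fun_prop) _ _)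
      (Continuous.stronglyMeasurableAtFilter (by fun_prop) _ _) (Continuous.continuousAt (by fun_prop))
  have hWc : Continuous W := continuous_iff_continuousAt.2 fun x => (hW x).continuousAt
  have hexp : ∀ x, HasDerivAt (fun x => Real.exp (-κ * x)) (Real.exp (-κ * x) * -κ) x := fun x => by
    simpa using ((hasDerivAt_id x).const_mul (-κ)).exp
  set u : ℝ → F := fun x => Real.exp (-κ * x) • W x
  have hu : ∀ x, HasDerivAt u (-κ • u x + h x) x := fun x => by
    have h1 := (hexp x).smul (hW x)
    refine h1.congr_deriv ?_
    rw [smul_smul, ← Real.exp_add, show -κ * x + κ * x = 0 by ring, Real.exp_zero, one_smul,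
      add_comm]
    simp only [u]
    rw [smul_smul, mul_comm]
  refine ⟨u, hu, ?_, fun x => ?_⟩
  · have hzero : ∀ x ≤ -R, W x = 0 := fun x hx => by
      refine intervalIntegral.integral_zero_ae (ae_of_all _ fun y hy => ?_)
      rw [uIoc_of_ge hx] at hy
      rcases hy.2.eq_or_lt with rfl | hlt
      · have : Tendsto h (𝓝[<] (-R)) (𝓝 0) := by
          refine tendsto_nhds_of_eventually_eq ?_
          filter_upwards [self_mem_nhdsWithin] with z hz
          exact h0 z (by rw [abs_of_neg (by linarith [mem_Iio.1 hz])]; linarith [mem_Iio.1 hz])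
        rw [tendsto_nhds_unique (hc.tendsto (-R) |>.mono_left nhdsWithin_le_nhds) this, smul_zero]
      · rw [h0 y (by rw [abs_of_neg (by linarith)]; linarith), smul_zero]
    have hconst : ∀ x, R < x → W x = W R := fun x hx => by
      have e := intervalIntegral.integral_add_adjacent_intervals (μ := volume)
        (f := fun y => Real.exp (κ * y) • h y) (a := -R) (b := R) (c := x)
        (Continuous.intervalIntegrable (by fun_prop) _ _) (Continuous.intervalIntegrable (by fun_prop) _ _)
      have e2 : ∫ y in R..x, Real.exp (κ * y) • h y = 0 := by
        refine intervalIntegral.integral_zero_ae (ae_of_all _ fun y hy => ?_)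
        rw [uIoc_of_le hx.le] at hy
        rw [h0 y (by rw [abs_of_pos (by linarith [hy.1])]; exact hy.1), smul_zero]
      simp only [W]
      rw [← e, e2, add_zero]
    have huc : Continuous u := continuous_iff_continuousAt.2 fun x => (hu x).continuousAt
    have hg : MemLp ((Ioi R).indicator u) 2 := by
      refine (memLp_congr_ae (ae_of_all _ fun x => ?_)).1 (memLp_exp_tail hκ R (Real.exp (-κ * R) • W R))
      by_cases hx : x ∈ Ioi R
      · rw [indicator_of_mem hx, indicator_of_mem hx, smul_smul, ← Real.exp_add]
        simp only [u]
        rw [hconst x hx]; ring_nf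
      · rw [indicator_of_notMem hx, indicator_of_notMem hx]
    have hm := memLp_glue (show -R < R by linarith) huc hg
    refine (memLp_congr_ae (ae_of_all _ fun x => ?_)).1 hm
    unfold glue
    split_ifs with h1 h2
    · simp [u, hzero x h1]
    · rfl
    · rfl
  · simp only [u, W]
    rw [← intervalIntegral.integral_smul]
    congr 1; ext y
    rw [smul_smul, ← Real.exp_add]; ring_nf

/-- The constant potential. -/
noncomputable def Potential.const (F : Type*) [NormedAddCommGroup F] [InnerProductSpace ℂ F] (c : ℝ) : Potential F where
  op _ := (c : ℂ) • ContinuousLinearMap.id ℂ F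
  cont := continuous_const
  symm x u v := by
    rw [_root_.smul_apply, _root_.smul_apply, inner_smul_left, inner_smul_right, Complex.conj_ofReal]
    rfl
  bdd := ⟨_, fun _ => le_rfl⟩

theorem yukawa_lower_bound [CompleteSpace F] {h : ℝ → F} (hc : Continuous h) {R κ : ℝ} (hR : 0 < R) (hκ : 0 < κ)
    (h0 : ∀ x, R < |x| → h x = 0) (v : H1 F) :
    2 * κ * (2 * (∫ x, ⟪h x, v.fn x⟫_ℂ).re - (H1.form (Potential.const F (κ ^ 2)) v v).re) ≤ yukawa κ h := by
  have hs : HasCompactSupport h := HasCompactSupport.intro (isCompact_Icc (a := -R) (b := R)) fun x hx =>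
    h0 x (by by_contra! H; exact hx (abs_le.1 H))
  obtain ⟨u₁, d₁, m₁, f₁⟩ := exists_exponential_convolution hc hR hκ h0
  obtain ⟨w, dw, mw, fw⟩ := exists_exponential_convolution (h := fun x => h (-x)) (by fun_prop) hR hκ
    fun x hx => h0 _ (by rwa [abs_neg])
  set u₂ : ℝ → F := fun x => w (-x)
  have d₂ : ∀ x, HasDerivAt u₂ (κ • u₂ x - h x) x := fun x => by
    have := (dw (-x)).scomp x (hasDerivAt_neg x)
    refine this.congr_deriv ?_
    simp only [neg_neg, u₂]; module
  have m₂ : MemLp u₂ 2 := mw.comp_measurePreserving (Measure.measurePreserving_neg volume)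
  have f₂ : ∀ x, u₂ x = ∫ y in x..R, Real.exp (-κ * (y - x)) • h y := fun x => by
    simp only [u₂, fw]
    have e := intervalIntegral.integral_comp_neg (fun y => Real.exp (-κ * (y - x)) • h y) (a := -R) (b := -x)
    rw [neg_neg, neg_neg] at e
    rw [← e]
    congr 1; ext y; ring_nf
  have c₁ : Continuous u₁ := continuous_iff_continuousAt.2 fun x => (d₁ x).continuousAt
  have c₂ : Continuous u₂ := continuous_iff_continuousAt.2 fun x => (d₂ x).continuousAt
  have hmh : MemLp h 2 := hc.memLp_of_hasCompactSupport hs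
  set U : H1 F := H1.mk (fun x => u₁ x + u₂ x) (fun x => -κ • u₁ x + κ • u₂ x) (c₁.add c₂)
    ⟨∅, countable_empty, fun x _ => ((d₁ x).add (d₂ x)).congr_deriv (by abel)⟩ (m₁.add m₂)
    ((m₁.const_smul (-κ)).add (m₂.const_smul κ)) with hU
  set U' : H1 F := H1.mk (fun x => -κ • u₁ x + κ • u₂ x) (fun x => κ ^ 2 • (u₁ x + u₂ x) - (2 * κ) • h x)
    (by fun_prop)
    ⟨∅, countable_empty, fun x _ => (((d₁ x).const_smul (-κ)).add ((d₂ x).const_smul κ)).congr_deriv (by module)⟩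
    ((m₁.const_smul (-κ)).add (m₂.const_smul κ)) (((m₁.add m₂).const_smul (κ ^ 2)).sub (hmh.const_smul (2 * κ))) with hU'
  set Q := Potential.const F (κ ^ 2)
  have hform : ∀ z : H1 F, H1.form Q U z = 2 * κ * ∫ x, ⟪h x, z.fn x⟫_ℂ := by
    intro z
    have hp := H1.integral_by_parts U' z
    have i1 : Integrable fun x => ⟪U.dv x, z.dv x⟫_ℂ := U.memLp'.integrable_inner_two z.memLp'
    have i2 : Integrable fun x => ⟪U.fn x, Q.op x (z.fn x)⟫_ℂ := U.memLp.integrable_inner_two (Q.memLp z.memLp)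
    rw [H1.form_apply, integral_add i1 i2]
    have e1 : ∫ x, ⟪U.dv x, z.dv x⟫_ℂ = -∫ x, ⟪U'.dv x, z.fn x⟫_ℂ := hp
    have i3 : Integrable fun x => ⟪U'.dv x, z.fn x⟫_ℂ := U'.memLp'.integrable_inner_two z.memLp
    rw [e1, ← integral_neg]
    have e6 := integral_add i3.neg i2
    simp only [Pi.neg_apply] at e6
    rw [← e6, ← integral_const_mul]
    congr 1; ext x
    have e2 : U'.dv x = (κ ^ 2) • U.fn x - (2 * κ) • h x := rfl
    have e3 : Q.op x (z.fn x) = ((κ ^ 2 : ℝ) : ℂ) • z.fn x := rfl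
    rw [e2, e3, inner_sub_left, inner_smul_right, ← Complex.coe_smul, ← Complex.coe_smul, inner_smul_left, inner_smul_left]
    simp only [Complex.conj_ofReal]
    push_cast; ring
  have hyuk : (∫ x, ⟪h x, U.fn x⟫_ℂ).re = yukawa κ h := by
    unfold yukawa
    refine Eq.trans ?_ (integral_prod _ (integrable_yukawa hc hs κ)).symm
    have i1 : Integrable fun x => ⟪h x, U.fn x⟫_ℂ := hmh.integrable_inner_two U.memLp
    have e0 := integral_re (𝕜 := ℂ) i1
    simp only [RCLike.re_to_complex] at e0
    rw [← e0]
    congr 1; ext x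
    by_cases hx : R < |x|
    · simp [h0 x hx]
    · have hx' := abs_le.1 (not_lt.1 hx)
      have hce : Continuous fun y => Real.exp (-κ * |x - y|) • h y := by fun_prop
      have key : U.fn x = ∫ y, Real.exp (-κ * |x - y|) • h y := by
        have e1 : ∫ y, Real.exp (-κ * |x - y|) • h y = ∫ y in (-R)..R, Real.exp (-κ * |x - y|) • h y := by
          rw [intervalIntegral.integral_of_le (by linarith), ← integral_Icc_eq_integral_Ioc]
          refine (setIntegral_eq_integral_of_forall_compl_eq_zero fun y hy => ?_).symm
          rw [h0 y (by by_contra! H; exact hy (abs_le.1 H)), smul_zero]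
        rw [e1, ← intervalIntegral.integral_add_adjacent_intervals (b := x) (hce.intervalIntegrable _ _) (hce.intervalIntegrable _ _)]
        have e2 : U.fn x = u₁ x + u₂ x := rfl
        rw [e2, f₁, f₂]
        congr 1
        · refine intervalIntegral.integral_congr fun y hy => ?_
          rw [uIcc_of_le hx'.1] at hy
          rw [abs_of_nonneg (by linarith [hy.2])]
        · refine intervalIntegral.integral_congr fun y hy => ?_
          rw [uIcc_of_le hx'.2] at hy
          rw [abs_of_nonpos (by linarith [hy.1])]; ring_nf
      have hie : Integrable fun y => Real.exp (-κ * |x - y|) • h y :=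
        hce.integrable_of_hasCompactSupport hs.smul_left
      rw [key, ← integral_inner hie]
      have e4 := integral_re (𝕜 := ℂ) (hie.const_inner (𝕜 := ℂ) (h x))
      simp only [RCLike.re_to_complex] at e4
      rw [← e4]
      congr 1; ext y
      rw [← Complex.coe_smul, inner_smul_right, Complex.re_ofReal_mul]
  have hnn : ∀ z : H1 F, 0 ≤ (H1.form Q z z).re := fun z => by
    rw [H1.form_self_re]
    refine integral_nonneg fun x => ?_
    have e3 : Q.op x (z.fn x) = ((κ ^ 2 : ℝ) : ℂ) • z.fn x := rfl
    beta_reduce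
    rw [e3, inner_smul_right, Complex.re_ofReal_mul, inner_self_eq_norm_sq_to_K]
    simp only [Complex.coe_algebraMap, ← Complex.ofReal_pow, Complex.ofReal_re]
    positivity
  have hfin := hnn (U + ((-2 * κ : ℝ) : ℂ) • v)
  have hsym : H1.form Q v U = starRingEnd ℂ (H1.form Q U v) := (H1.form_symm Q U v).symm
  have e5 : ∀ z : ℂ, ((2 : ℂ) * κ * z).re = 2 * κ * z.re := fun z => by
    rw [show (2 : ℂ) * κ = ((2 * κ : ℝ) : ℂ) by push_cast; ring, Complex.re_ofReal_mul]
  simp only [map_add, LinearMap.add_apply, map_smul, LinearMap.map_smulₛₗ, LinearMap.smul_apply, smul_eq_mul,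
    hsym, Complex.conj_ofReal, Complex.add_re, Complex.re_ofReal_mul, Complex.conj_re] at hfin
  rw [hform, hform, e5, e5, hyuk] at hfin
  have h3 : 0 ≤ 2 * κ * (yukawa κ h -
      2 * κ * (2 * (∫ x, ⟪h x, v.fn x⟫_ℂ).re - (H1.form Q v v).re)) := by
    refine hfin.trans (le_of_eq ?_)
    ring
  have h4 := nonneg_of_mul_nonneg_right h3 (by positivity)
  linarith

end

section

open MeasureTheory Filter Topology Set
open scoped ComplexOrder InnerProductSpace

variable {F : Type*} [NormedAddCommGroup F] [InnerProductSpace ℂ F]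

theorem continuous_op_apply (V : Potential F) {f : ℝ → F} (hf : Continuous f) :
    Continuous fun x => V.op x (f x) := V.cont.clm_apply hf

/-- The sesquilinear form of `-V` over `[-R, R]` on continuous functions. -/
noncomputable def weightForm (V : Potential F) (R : ℝ) : C(ℝ, F) →ₗ⋆[ℂ] C(ℝ, F) →ₗ[ℂ] ℂ :=
  have hi : ∀ u v : C(ℝ, F), IntervalIntegrable (fun x => ⟪u x, -V.op x (v x)⟫_ℂ) volume (-R) R :=
    fun u v => (u.continuous.inner (continuous_op_apply V v.continuous).neg).intervalIntegrable _ _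
  LinearMap.mk₂'ₛₗ (starRingEnd ℂ) (RingHom.id ℂ) (fun u v => ∫ x in (-R)..R, ⟪u x, -V.op x (v x)⟫_ℂ)
    (fun u v w => by
      rw [← intervalIntegral.integral_add (hi _ _) (hi _ _)]; simp only [ContinuousMap.add_apply, inner_add_left])
    (fun c u v => by
      rw [smul_eq_mul, ← intervalIntegral.integral_const_mul]; simp [inner_smul_left])
    (fun u v w => by
      rw [← intervalIntegral.integral_add (hi _ _) (hi _ _)]
      simp only [ContinuousMap.add_apply, map_add, neg_add, inner_add_right])
    (fun c u v => by
      rw [smul_eq_mul, ← intervalIntegral.integral_const_mul]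
      simp only [ContinuousMap.smul_apply, map_smul, ← smul_neg, inner_smul_right, RingHom.id_apply])

theorem weightForm_apply (V : Potential F) (R : ℝ) (u v : C(ℝ, F)) :
    weightForm V R u v = ∫ x in (-R)..R, ⟪u x, -V.op x (v x)⟫_ℂ := rfl

theorem weightForm_symm (V : Potential F) (R : ℝ) (u v : C(ℝ, F)) :
    starRingEnd ℂ (weightForm V R u v) = weightForm V R v u := by
  rw [weightForm_apply, weightForm_apply, intervalIntegral.intervalIntegral_eq_integral_uIoc,
    intervalIntegral.intervalIntegral_eq_integral_uIoc, Complex.real_smul, map_mul, ← integral_conj, Complex.conj_ofReal]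
  rw [Complex.real_smul]
  congr 2; ext x
  rw [inner_conj_symm, inner_neg_left, inner_neg_right, V.symm]

theorem weightForm_eq_integral (V : Potential F) {R : ℝ} (hR : 0 < R) (h0 : ∀ x, R < |x| → V.op x = 0) (u v : C(ℝ, F)) :
    weightForm V R u v = ∫ x, ⟪u x, -V.op x (v x)⟫_ℂ := by
  rw [weightForm_apply, intervalIntegral.integral_of_le (by linarith), ← integral_Icc_eq_integral_Ioc]
  refine setIntegral_eq_integral_of_forall_compl_eq_zero fun y hy => ?_
  rw [h0 y (by by_contra! H; exact hy (abs_le.1 H))]; simp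

theorem weightForm_self_re (V : Potential F) (R : ℝ) (u : C(ℝ, F)) :
    (weightForm V R u u).re = ∫ x in (-R)..R, -(⟪u x, V.op x (u x)⟫_ℂ).re := by
  have h := Complex.reCLM.intervalIntegral_comp_comm (μ := volume) (a := -R) (b := R)
    (f := fun x => ⟪u x, -V.op x (u x)⟫_ℂ)
    ((u.continuous.inner (continuous_op_apply V u.continuous).neg).intervalIntegrable _ _)
  rw [weightForm_apply]
  simp only [Complex.reCLM_apply] at h
  rw [← h]; simp

theorem weightForm_self_nonneg {V : Potential F} {R : ℝ} (hR : 0 < R)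
    (hneg : ∀ x v, (⟪v, V.op x v⟫_ℂ).re ≤ 0) (u : C(ℝ, F)) : 0 ≤ (weightForm V R u u).re := by
  rw [weightForm_self_re]
  exact intervalIntegral.integral_nonneg (by linarith) fun x _ => by linarith [hneg x (u x)]

theorem weightForm_bessel {V : Potential F} {R : ℝ} (hR : 0 < R)
    (hneg : ∀ x v, (⟪v, V.op x v⟫_ℂ).re ≤ 0) {N : ℕ} {χ : Fin N → C(ℝ, F)}
    (ho : ∀ i j, weightForm V R (χ i) (χ j) = if i = j then 1 else 0) (e : C(ℝ, F)) :
    ∑ i, ‖weightForm V R (χ i) e‖ ^ 2 ≤ (weightForm V R e e).re := by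
  set B := weightForm V R
  set s := ∑ i, B (χ i) e • χ i
  have h1 : ∀ i, B (χ i) s = B (χ i) e := fun i => by simp [s, map_sum, ho]
  have h2 : ∀ f, B s f = ∑ i, starRingEnd ℂ (B (χ i) e) * B (χ i) f := fun f => by
    simp [s, map_sum, LinearMap.sum_apply, LinearMap.map_smulₛₗ]
  have h3 : B s e = ((∑ i, ‖B (χ i) e‖ ^ 2 : ℝ) : ℂ) := by
    rw [h2]; push_cast
    exact Finset.sum_congr rfl fun i _ => by rw [Complex.conj_mul']
  have h4 : B s s = B s e := by rw [h2, h2]; simp only [h1]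
  have h5 : B e s = B s e := by rw [← weightForm_symm]; rw [h3, Complex.conj_ofReal]
  have h6 := weightForm_self_nonneg hR hneg (e - s)
  change 0 ≤ (B (e - s) (e - s)).re at h6
  simp only [map_sub, LinearMap.sub_apply, h4, h5, sub_self, sub_zero] at h6
  rw [Complex.sub_re, h3, Complex.ofReal_re] at h6
  linarith

theorem hasCompactSupport_op {V : Potential F} {R : ℝ} (h0 : ∀ x, R < |x| → V.op x = 0) (f : ℝ → F) :
    HasCompactSupport fun x => -V.op x (f x) :=
  HasCompactSupport.intro (isCompact_Icc (a := -R) (b := R)) fun x hx => by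
    rw [h0 x (by by_contra! H; exact hx (abs_le.1 H))]; simp

theorem form_const_eq {V : Potential F} {R κ : ℝ} (hR : 0 < R) (h0 : ∀ x, R < |x| → V.op x = 0) (u : H1 F) :
    (H1.form (Potential.const F (κ ^ 2)) u u).re = (H1.form V u u).re +
      (weightForm V R ⟨u.fn, u.continuous⟩ ⟨u.fn, u.continuous⟩).re + κ ^ 2 * (H1.mass u u).re := by
  have h1 : H1.form (Potential.const F (κ ^ 2)) u u = H1.form V u u +
      weightForm V R ⟨u.fn, u.continuous⟩ ⟨u.fn, u.continuous⟩ + ((κ ^ 2 : ℝ) : ℂ) * H1.mass u u := by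
    rw [weightForm_eq_integral V hR h0, H1.form_apply, H1.form_apply, H1.mass_apply, ← integral_const_mul]
    have i1 := H1.integrable_form V u u
    have i2 : Integrable fun x => ⟪u.fn x, -V.op x (u.fn x)⟫_ℂ :=
      u.memLp.integrable_inner_two (V.memLp u.memLp).neg
    have i3 := (u.memLp.integrable_inner_two u.memLp).const_mul ((κ ^ 2 : ℝ) : ℂ)
    have e1 := integral_add i1 i2
    have e2 := integral_add (i1.add i2) i3
    simp only [Pi.add_apply] at e2
    simp only [ContinuousMap.coe_mk]
    rw [← e1, ← e2]
    congr 1; ext x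
    have e3 : (Potential.const F (κ ^ 2)).op x (u.fn x) = ((κ ^ 2 : ℝ) : ℂ) • u.fn x := rfl
    rw [e3, inner_smul_right, inner_neg_right]; ring
  rw [h1, Complex.add_re, Complex.add_re, Complex.re_ofReal_mul]

theorem exists_weight_orthonormal [CompleteSpace F] {V : Potential F} {R : ℝ} (hR : 0 < R)
    (h0 : ∀ x, R < |x| → V.op x = 0) {N : ℕ} :
    ∀ {E κ : Fin N → ℝ} {ψ : Fin N → H1 F} (_ : H1.IsEigenFamily V E ψ) (_ : ∀ j, 0 < κ j)
    (_ : ∀ j, E j = κ j ^ 2) (_ : Monotone κ) {a : ℝ} (_ : ∀ j, a ≤ κ j),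
    ∃ χ : Fin N → C(ℝ, F), (∀ i j, weightForm V R (χ i) (χ j) = if i = j then 1 else 0) ∧
      2 * ∑ j, κ j ≤ ∑ j, yukawa a fun x => -V.op x (χ j x) := by
  induction N with
  | zero => intro E κ ψ _ _ _ _ a _; exact ⟨Fin.elim0, fun i => i.elim0, by simp⟩
  | succ N ih =>
    intro E κ ψ hψ hκ hE hmono a ha
    have hφ : H1.IsEigenFamily V (fun j : Fin N => E j.succ) (fun j => ψ j.succ) :=
      ⟨fun j => hψ.eig _, fun i j => by rw [hψ.ortho]; simp⟩
    obtain ⟨χ, hχ, hy⟩ := ih hφ (fun j => hκ j.succ) (fun j => hE j.succ)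
      (fun i j hij => hmono (Fin.succ_le_succ_iff.2 hij)) (a := κ 0) (fun j => hmono (Fin.zero_le _))
    set B := weightForm V R
    set toC : H1 F → C(ℝ, F) := fun u => ⟨u.fn, u.continuous⟩
    let L : (Fin (N + 1) → ℂ) →ₗ[ℂ] (Fin N → ℂ) :=
      LinearMap.pi fun i => ∑ j, (B (χ i) (toC (ψ j))) • LinearMap.proj j
    obtain ⟨c, hc, hc0⟩ : ∃ c, L c = 0 ∧ c ≠ 0 := by
      have h := LinearMap.ker_ne_bot_of_finrank_lt (f := L) (by simp)
      obtain ⟨c, hc, hc0⟩ := Submodule.exists_mem_ne_zero_of_ne_bot h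
      exact ⟨c, hc, hc0⟩
    set f : H1 F := ∑ j, c j • ψ j
    have toC_f : toC f = ∑ j, c j • toC (ψ j) := by
      ext x
      let ev : H1 F →ₗ[ℂ] F := ⟨⟨fun u => u.fn x, fun u v => rfl⟩, fun c v => rfl⟩
      have : ev f = ∑ j, c j • ev (ψ j) := by simp only [f, map_sum, map_smul]
      rw [ContinuousMap.sum_apply]
      exact this
    have hperp : ∀ i, B (χ i) (toC f) = 0 := fun i => by
      rw [toC_f, map_sum]
      have := congrFun hc i
      simp only [L, LinearMap.pi_apply, LinearMap.sum_apply, LinearMap.smul_apply, LinearMap.proj_apply,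
        smul_eq_mul, Pi.zero_apply] at this
      rw [← this]
      exact Finset.sum_congr rfl fun j _ => by rw [map_smul, smul_eq_mul, mul_comm]
    set m := (B (toC f) (toC f)).re
    set Q := Potential.const F (κ 0 ^ 2)
    have hsum : 0 < ∑ j, ‖c j‖ ^ 2 := by
      obtain ⟨j, hj⟩ := Function.ne_iff.1 hc0
      exact Finset.sum_pos' (fun i _ => by positivity) ⟨j, Finset.mem_univ _, by
        have : 0 < ‖c j‖ := norm_pos_iff.2 hj
        positivity⟩
    have hQ := form_const_eq (κ := κ 0) hR h0 f
    rw [H1.form_sum_smul hψ, H1.mass_sum_smul_self hψ] at hQ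
    have hEk : κ 0 ^ 2 * ∑ j, ‖c j‖ ^ 2 ≤ ∑ j, E j * ‖c j‖ ^ 2 := by
      rw [Finset.mul_sum]
      refine Finset.sum_le_sum fun j _ => mul_le_mul_of_nonneg_right ?_ (by positivity)
      rw [hE]
      exact pow_le_pow_left₀ (hκ 0).le (hmono (Fin.zero_le _)) 2
    have hQm : (H1.form Q f f).re ≤ m := by
      change (H1.form Q f f).re = _ + m + _ at hQ
      linarith
    have hQ0 : κ 0 ^ 2 * (H1.mass f f).re ≤ (H1.form Q f f).re := by
      rw [H1.form_self_re, H1.mass_self, Complex.ofReal_re, ← integral_const_mul]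
      refine integral_mono (f.memLp.integrable_sq_norm.const_mul _) (H1.integrable_form_self Q f) fun x => ?_
      have e3 : Q.op x (f.fn x) = ((κ 0 ^ 2 : ℝ) : ℂ) • f.fn x := rfl
      beta_reduce
      rw [e3, inner_smul_right, Complex.re_ofReal_mul, inner_self_eq_norm_sq_to_K]
      simp only [Complex.coe_algebraMap, ← Complex.ofReal_pow, Complex.ofReal_re]
      have : 0 ≤ ‖f.dv x‖ ^ 2 := by positivity
      linarith
    rw [H1.mass_sum_smul_self hψ] at hQ0
    have hm : 0 < m := lt_of_lt_of_le (mul_pos (pow_pos (hκ 0) 2) hsum) (hQ0.trans hQm)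
    set t : ℂ := (((Real.sqrt m)⁻¹ : ℝ) : ℂ)
    have ht : starRingEnd ℂ t = t := Complex.conj_ofReal _
    have htt' : (Real.sqrt m)⁻¹ * (Real.sqrt m)⁻¹ * m = 1 := by
      rw [← mul_inv, Real.mul_self_sqrt hm.le, inv_mul_cancel₀ hm.ne']
    have htt : t * t * m = 1 := by
      simp only [t]
      rw [← Complex.ofReal_mul, ← Complex.ofReal_mul, htt', Complex.ofReal_one]
    have hBf : B (toC f) (toC f) = (m : ℂ) := by
      refine Complex.ext (by simp [m]) ?_
      have := congrArg Complex.im (weightForm_symm V R (toC f) (toC f))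
      rw [Complex.conj_im] at this
      rw [Complex.ofReal_im]
      change -(B (toC f) (toC f)).im = (B (toC f) (toC f)).im at this
      linarith
    set g : H1 F := t • f
    have hg : toC g = t • toC f := by ext x; rfl
    have hgg : B (toC g) (toC g) = 1 := by
      rw [hg, map_smul, LinearMap.map_smulₛₗ, LinearMap.smul_apply, ht, hBf, smul_eq_mul, smul_eq_mul, ← mul_assoc, htt]
    have hQg : (H1.form Q g g).re ≤ 1 := by
      simp only [g]
      rw [map_smul, LinearMap.map_smulₛₗ, LinearMap.smul_apply, ht, smul_eq_mul, smul_eq_mul, ← mul_assoc]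
      simp only [t]
      rw [← Complex.ofReal_mul, Complex.re_ofReal_mul, ← htt']
      exact mul_le_mul_of_nonneg_left hQm (by positivity)
    have hχg : ∀ i, B (χ i) (toC g) = 0 := fun i => by rw [hg, map_smul, hperp, smul_zero]
    have hgχ : ∀ i, B (toC g) (χ i) = 0 := fun i => by
      rw [← weightForm_symm]
      change starRingEnd ℂ (B (χ i) (toC g)) = 0
      rw [hχg, map_zero]
    have hyg : 2 * κ 0 ≤ yukawa (κ 0) fun x => -V.op x (g.fn x) := by
      have h := yukawa_lower_bound (h := fun x => -V.op x (g.fn x)) (continuous_op_apply V g.continuous).neg hR (hκ 0)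
        (fun x hx => by rw [h0 x hx]; simp) g
      have e : ∫ x, ⟪-V.op x (g.fn x), g.fn x⟫_ℂ = 1 := by
        rw [← hgg]
        simp only [B]
        rw [weightForm_eq_integral V hR h0]
        congr 1; ext x
        rw [inner_neg_left, inner_neg_right, V.symm]; rfl
      rw [e, Complex.one_re] at h
      nlinarith [hκ 0]
    set X : Fin (N + 1) → C(ℝ, F) := Fin.cons (toC g) χ
    have hX : ∀ i j, B (X i) (X j) = if i = j then 1 else 0 := by
      intro i j
      refine Fin.cases ?_ (fun i => ?_) i <;> refine Fin.cases ?_ (fun j => ?_) j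
      · simp [X, hgg]
      · simp [X, hgχ, (Fin.succ_ne_zero j).symm]
      · simp [X, hχg]
      · simp [X, B, hχ]
    have hXy : 2 * ∑ j, κ j ≤ ∑ j, yukawa (κ 0) fun x => -V.op x (X j x) := by
      rw [Fin.sum_univ_succ, Fin.sum_univ_succ (fun j => yukawa (κ 0) fun x => -V.op x (X j x))]
      simp only [X, Fin.cons_zero, Fin.cons_succ]
      rw [mul_add]
      exact add_le_add hyg hy
    obtain ⟨ξ, hξ⟩ := exists_modulate_yukawa_le (h := fun j x => -V.op x (X j x))
      (fun j => (continuous_op_apply V (X j).continuous).neg) (fun j => hasCompactSupport_op h0 _) (ha 0)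
    refine ⟨fun j => ⟨modulate ξ (X j), continuous_modulate (X j).continuous ξ⟩, fun i j => ?_, ?_⟩
    · rw [← hX i j]
      simp only [B]
      rw [weightForm_apply, weightForm_apply]
      congr 1; ext x
      simp only [ContinuousMap.coe_mk]
      have e : -V.op x (modulate ξ (X j) x) = modulate ξ (fun y => -V.op y (X j y)) x := by
        unfold modulate; rw [map_smul, smul_neg]
      rw [e, inner_modulate]; simp
    · refine (hXy.trans hξ).trans (le_of_eq ?_)
      refine Finset.sum_congr rfl fun j _ => ?_
      congr 1; ext x
      simp only [ContinuousMap.coe_mk]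
      unfold modulate; rw [map_smul, smul_neg]

/-- The sharp Lieb-Thirring inequality for the moment `1/2`. -/
theorem sum_sqrt_le [FiniteDimensional ℂ F] {V : Potential F} {R : ℝ} (hR : 0 < R)
    (h0 : ∀ x, R < |x| → V.op x = 0) (hneg : ∀ x v, (⟪v, V.op x v⟫_ℂ).re ≤ 0) {N : ℕ}
    {E κ : Fin N → ℝ} {ψ : Fin N → H1 F} (hψ : H1.IsEigenFamily V E ψ) (hκ : ∀ j, 0 < κ j)
    (hE : ∀ j, E j = κ j ^ 2) : 2 * ∑ j, κ j ≤ ∫ x in (-R)..R, -(tr (V.op x)).re := by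
  have : CompleteSpace F := FiniteDimensional.complete ℂ F
  set σ := Tuple.sort κ
  have hφ : H1.IsEigenFamily V (E ∘ σ) (ψ ∘ σ) :=
    ⟨fun j => hψ.eig _, fun i j => by simp [hψ.ortho]⟩
  obtain ⟨χ, hχ, hy⟩ := exists_weight_orthonormal hR h0 hφ (κ := κ ∘ σ) (fun j => hκ _) (fun j => hE _)
    (Tuple.monotone_sort κ) (a := 0) (fun j => (hκ _).le)
  rw [show ∑ j, (κ ∘ σ) j = ∑ j, κ j from Equiv.sum_comp σ κ] at hy
  refine hy.trans ?_
  set b := stdOrthonormalBasis ℂ F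
  set e : _ → C(ℝ, F) := fun k => ContinuousMap.const ℝ (b k)
  have h1 : ∀ j, (yukawa 0 fun x => -V.op x (χ j x)) = ∑ k, ‖weightForm V R (χ j) (e k)‖ ^ 2 := fun j => by
    have hs := hasCompactSupport_op h0 (χ j)
    have hc : Continuous fun x => -V.op x (χ j x) := (continuous_op_apply V (χ j).continuous).neg
    rw [yukawa_zero hc hs, ← b.sum_sq_norm_inner_right]
    refine Finset.sum_congr rfl fun k _ => ?_
    congr 1
    rw [← weightForm_symm, RCLike.norm_conj, weightForm_eq_integral V hR h0,
      ← integral_inner (hc.integrable_of_hasCompactSupport hs)]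
    rfl
  simp only [h1]
  rw [Finset.sum_comm]
  refine (Finset.sum_le_sum fun k _ => weightForm_bessel hR hneg hχ (e k)).trans (le_of_eq ?_)
  simp only [weightForm_self_re]
  rw [← intervalIntegral.integral_finsetSum]
  · congr 1; ext x
    rw [tr_eq_sum_inner, Complex.re_sum, Finset.sum_neg_distrib]
    rfl
  · intro k _
    have := V.cont
    exact Continuous.intervalIntegrable (by fun_prop) _ _

end

section

open MeasureTheory Filter Topology Set
open scoped ComplexOrder InnerProductSpace

theorem sqrt_cube_le {ι : Type*} (s : Finset ι) {w κ : ι → ℝ} {a : ℝ} (hw : ∀ k, 0 ≤ w k)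
    (hw1 : ∑ k ∈ s, w k ≤ 1) (hκ : ∀ k, 0 ≤ κ k) (ha : a ≤ ∑ k ∈ s, κ k ^ 2 * w k) :
    √a ^ 3 ≤ ∑ k ∈ s, κ k ^ 3 * w k := by
  rcases le_or_gt a 0 with h | h
  · rw [Real.sqrt_eq_zero_of_nonpos h]
    simpa using Finset.sum_nonneg fun k _ => mul_nonneg (pow_nonneg (hκ k) 3) (hw k)
  have ht := Real.sqrt_nonneg a
  have hs : √a ^ 2 = a := Real.sq_sqrt h.le
  set t := √a
  have h1 : 3 * t * ∑ k ∈ s, κ k ^ 2 * w k ≤ 2 * (∑ k ∈ s, κ k ^ 3 * w k) + t ^ 3 * ∑ k ∈ s, w k := by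
    simp only [Finset.mul_sum, ← Finset.sum_add_distrib]
    refine Finset.sum_le_sum fun k _ => ?_
    have h2 : 0 ≤ (κ k - t) ^ 2 * (2 * κ k + t) * w k :=
      mul_nonneg (mul_nonneg (sq_nonneg _) (by linarith [hκ k])) (hw k)
    nlinarith
  have h2 : t ^ 3 * ∑ k ∈ s, w k ≤ t ^ 3 * 1 := mul_le_mul_of_nonneg_left hw1 (by positivity)
  have h3 : 3 * t * t ^ 2 ≤ 3 * t * ∑ k ∈ s, κ k ^ 2 * w k :=
    mul_le_mul_of_nonneg_left (hs.trans_le ha) (by positivity)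
  nlinarith

namespace H1
variable {F : Type*} [NormedAddCommGroup F] [InnerProductSpace ℂ F]

theorem IsEigenFamily.form_self {V : Potential F} {N : ℕ} {E : Fin N → ℝ} {ψ : Fin N → H1 F}
    (h : IsEigenFamily V E ψ) (j : Fin N) : (form V (ψ j) (ψ j)).re = -E j := by
  rw [(h.eig j).form_eq, h.ortho]; simp

theorem norm_mass_comm (u v : H1 F) : ‖mass u v‖ = ‖mass v u‖ := by
  rw [← mass_symm, RCLike.norm_conj]

/-- Comparison of moments of eigenvalue families after a spectral shift. -/
theorem sum_sqrt_cube_le {V V₂ : Potential F} {N M : ℕ} {E : Fin N → ℝ} {ψ : Fin N → H1 F}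
    (hψ : IsEigenFamily V E ψ) {e κ : Fin M → ℝ} {χ : Fin M → H1 F} (hχ : IsEigenFamily V₂ e χ)
    (hκ : ∀ k, 0 ≤ κ k) {τ : ℝ}
    (h : ∀ u, -(∑ k, κ k ^ 2 * ‖mass (χ k) u‖ ^ 2) - τ * (mass u u).re ≤ (form V u u).re) :
    ∑ j, √(E j - τ) ^ 3 ≤ ∑ k, κ k ^ 3 := by
  have h1 : ∀ j, √(E j - τ) ^ 3 ≤ ∑ k, κ k ^ 3 * ‖mass (χ k) (ψ j)‖ ^ 2 := fun j => by
    have h2 := h (ψ j)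
    have h3 := bessel hχ (ψ j)
    rw [hψ.form_self, hψ.ortho, if_pos rfl, Complex.one_re] at h2
    rw [hψ.ortho, if_pos rfl, Complex.one_re] at h3
    exact sqrt_cube_le _ (fun k => sq_nonneg _) h3 hκ (by linarith)
  refine (Finset.sum_le_sum fun j _ => h1 j).trans ?_
  rw [Finset.sum_comm]
  refine Finset.sum_le_sum fun k _ => ?_
  rw [← Finset.mul_sum]
  refine (mul_le_mul_of_nonneg_left (?_ : _ ≤ (1 : ℝ)) (pow_nonneg (hκ k) 3)).trans (mul_one _).le
  simp only [fun j => norm_mass_comm (χ k) (ψ j)]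
  refine (bessel hψ (χ k)).trans ?_
  rw [hχ.ortho, if_pos rfl, Complex.one_re]

theorem form_le_form_add {A B : Potential F} {τ : ℝ} (h : ∀ x v, (⟪v, A.op x v⟫_ℂ).re - τ * ‖v‖ ^ 2
    ≤ (⟪v, B.op x v⟫_ℂ).re) (u : H1 F) :
    (form A u u).re - τ * (mass u u).re ≤ (form B u u).re := by
  rw [form_self_re, form_self_re, mass_self, Complex.ofReal_re, ← integral_const_mul,
    ← integral_sub (integrable_form_self A u) (u.memLp.integrable_sq_norm.const_mul _)]
  refine integral_mono ((integrable_form_self A u).sub (u.memLp.integrable_sq_norm.const_mul _))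
    (integrable_form_self B u) fun x => ?_
  have := h x (u.fn x)
  simp only; linarith

theorem _root_.Potential.decays_of_eq_zero {V : Potential F} {R : ℝ} (hR : 0 < R)
    (h0 : ∀ x, R ≤ |x| → V.op x = 0) : V.Decays :=
  fun η hη => ⟨R, hR, fun x hx => by rw [h0 x hx, norm_zero]; exact hη.le⟩

theorem _root_.Potential.tame_of_eq_zero {V : Potential F} {R : ℝ}
    (h0 : ∀ x, R ≤ |x| → V.op x = 0) : V.Tame R where
  zero x hx := h0 x (hx.trans (le_abs_self x))
  lim := tendsto_const_nhds.congr' ((eventually_le_atBot (-R)).mono fun x hx =>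
    (h0 x ((le_neg.1 hx).trans (neg_le_abs x))).symm)

/-- A maximal family of bound states of a compactly supported potential. -/
theorem exists_complete_family [FiniteDimensional ℂ F] {V : Potential F} {R : ℝ} (hR : 0 < R)
    (h0 : ∀ x, R ≤ |x| → V.op x = 0) : ∃ (N : ℕ) (E κ : Fin N → ℝ) (ψ : Fin N → H1 F),
      IsEigenFamily V E ψ ∧ (∀ j, 0 < κ j) ∧ (∀ j, E j = κ j ^ 2) ∧
      ∀ u, -(∑ j, E j * ‖mass (ψ j) u‖ ^ 2) ≤ (form V u u).re := by
  obtain ⟨N, E, ψ, h1, h2, h3⟩ := exists_maximal_family (Potential.decays_of_eq_zero hR h0) le_rfl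
    (L := R) (fun x hx v => by rw [h0 x hx]; simp)
  exact ⟨N, E, fun j => √(E j), ψ, h1, fun j => Real.sqrt_pos.2 (h2 j),
    fun j => (Real.sq_sqrt (h2 j).le).symm, fun u => by simpa using h3 u⟩

end H1

theorem hasDerivAt_intervalIntegral {f : ℝ → ℝ} (hf : Continuous f) (a x : ℝ) :
    HasDerivAt (fun x => ∫ y in a..x, f y) (f x) x :=
  intervalIntegral.integral_hasDerivAt_right (hf.intervalIntegrable _ _)
    hf.stronglyMeasurable.stronglyMeasurableAtFilter hf.continuousAt

theorem HasDerivAt.complex_re {f : ℝ → ℂ} {f' : ℂ} {x : ℝ} (h : HasDerivAt f f' x) :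
    HasDerivAt (fun x => (f x).re) f'.re x :=
  Complex.reCLM.hasFDerivAt.comp_hasDerivAt x h

theorem tendsto_intervalIntegral_atBot_zero {f : ℝ → ℝ} {R : ℝ} (h0 : ∀ x ≤ -R, f x = 0) :
    Tendsto (fun x => ∫ y in (-R)..x, f y) atBot (𝓝 0) := by
  refine tendsto_const_nhds.congr' ((eventually_le_atBot (-R)).mono fun x hx => ?_)
  beta_reduce
  rw [intervalIntegral.integral_congr (g := fun _ => 0) fun y hy => ?_]
  · simp
  · rw [uIcc_of_ge hx] at hy; exact h0 y hy.2

namespace H1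
variable {F : Type*} [NormedAddCommGroup F] [InnerProductSpace ℂ F]

/-- The sharp Lieb-Thirring inequality for the moment `3/2`. -/
theorem sum_cube_le [FiniteDimensional ℂ F] {V : Potential F} {R : ℝ}
    (h0 : ∀ x, R ≤ |x| → V.op x = 0) {N : ℕ}
    {E κ : Fin N → ℝ} {ψ : Fin N → H1 F} (hψ : IsEigenFamily V E ψ) (hκ : ∀ j, 0 < κ j)
    (hE : ∀ j, E j = κ j ^ 2) (hmax : ∀ u, -(∑ j, E j * ‖mass (ψ j) u‖ ^ 2) ≤ (form V u u).re) :
    16 / 3 * ∑ j, κ j ^ 3 ≤ ∫ x in (-R)..R, (tr (V.op x * V.op x)).re := by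
  obtain ⟨U, hU, -, -, ⟨θ, hθ, hθ0, hθR⟩, -⟩ :=
    exists_stripped (Potential.tame_of_eq_zero h0) hψ hκ hE hmax
  have hc : Continuous fun x => (tr (V.op x * V.op x)).re := by have := V.cont; fun_prop
  set M : ℝ → ℝ := fun x => (θ x).re + ∫ y in (-R)..x, (tr (V.op y * V.op y)).re
  have hM : ∀ x, HasDerivAt M (tr (U.op x * U.op x)).re x := fun x => by
    refine ((hθ x).complex_re.add (hasDerivAt_intervalIntegral hc (-R) x)).congr_deriv ?_
    rw [Complex.sub_re]; ring
  have hm : Monotone M := monotone_of_hasDerivAt_nonneg hM fun x => tr_mul_self_nonneg (U.symm x)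
  have hl : Tendsto M atBot (𝓝 0) := by
    have h1 := (Complex.continuous_re.tendsto 0).comp hθ0
    have h2 := h1.add (tendsto_intervalIntegral_atBot_zero (f := fun y => (tr (V.op y * V.op y)).re)
      (R := R) fun x hx => by rw [h0 x ((le_neg.1 hx).trans (neg_le_abs x))]; simp)
    simpa using h2
  have h3 := hm.le_of_tendsto hl R
  simp only [M, hθR, Complex.ofReal_re] at h3
  linarith

end H1

end

section

open MeasureTheory Filter Topology Set
open scoped ComplexOrder InnerProductSpace

section PosPart

variable {F : Type*} [NormedAddCommGroup F] [InnerProductSpace ℂ F] [CompleteSpace F]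

theorem isSelfAdjoint_of_symm {A : F →L[ℂ] F} (hA : ∀ u v, ⟪A u, v⟫_ℂ = ⟪u, A v⟫_ℂ) :
    IsSelfAdjoint A := ContinuousLinearMap.isSelfAdjoint_iff_isSymmetric.2 hA

theorem IsSelfAdjoint.inner_symm {A : F →L[ℂ] F} (hA : IsSelfAdjoint A) (u v : F) :
    ⟪A u, v⟫_ℂ = ⟪u, A v⟫_ℂ := ContinuousLinearMap.isSelfAdjoint_iff_isSymmetric.1 hA u v

omit [CompleteSpace F] in
theorem re_inner_nonneg_of_nonneg {A : F →L[ℂ] F} (hA : 0 ≤ A) (v : F) : 0 ≤ (⟪v, A v⟫_ℂ).re :=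
  ((ContinuousLinearMap.nonneg_iff_isPositive A).1 hA).re_inner_nonneg_right v

theorem posPart_symm (A : F →L[ℂ] F) (u v : F) : ⟪A⁺ u, v⟫_ℂ = ⟪u, A⁺ v⟫_ℂ :=
  (CFC.posPart_nonneg A).isSelfAdjoint.inner_symm u v

theorem continuous_posPart_clm {X : Type*} [TopologicalSpace X] {f : X → F →L[ℂ] F} (hf : Continuous f)
    (h : ∀ p, IsSelfAdjoint (f p)) : Continuous fun p => (f p)⁺ := by
  have e : (fun p => (f p)⁺) = fun p => cfc (fun x : ℝ => x⁺) (f p) := by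
    ext1 p
    rw [CFC.posPart_def, cfcₙ_eq_cfc]
  rw [e]
  exact hf.cfc_of_mem_nhdsSet (s := univ) _ (by simp) h

theorem posPart_apply_of_eigen {A : F →L[ℂ] F} (hA : IsSelfAdjoint A) {μ : ℝ} {b : F}
    (hb : A b = (μ : ℂ) • b) : A⁺ b = ((max μ 0 : ℝ) : ℂ) • b := by
  have hd : A⁺ b - A⁻ b = (μ : ℂ) • b := by
    rw [← hb, ← _root_.sub_apply, CFC.posPart_sub_negPart A hA]
  have hP : A⁺ (A⁺ b) = (μ : ℂ) • A⁺ b := by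
    have h1 : A⁺ (A⁻ b) = 0 := by rw [← mul_apply_eq_comp, CFC.posPart_mul_negPart, _root_.zero_apply]
    rw [← map_smul, ← hd, map_sub, h1, sub_zero]
  have hN : A⁻ (A⁻ b) = -(μ : ℂ) • A⁻ b := by
    have h1 : A⁻ (A⁺ b) = 0 := by rw [← mul_apply_eq_comp, CFC.negPart_mul_posPart, _root_.zero_apply]
    rw [neg_smul, ← map_smul, ← hd, map_sub, h1, zero_sub, neg_neg]
  have hz : ∀ {B : F →L[ℂ] F} {ν : ℝ}, 0 ≤ B → ν ≤ 0 → B (B b) = (ν : ℂ) • B b → B b = 0 := by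
    intro B ν hB hν h
    have h1 : (⟪B b, B b⟫_ℂ).re = ν * (⟪b, B b⟫_ℂ).re := by
      rw [hB.isSelfAdjoint.inner_symm, h, inner_smul_right, Complex.re_ofReal_mul]
    have h2 := re_inner_nonneg_of_nonneg hB b
    have h3 : (⟪B b, B b⟫_ℂ).re = ‖B b‖ ^ 2 := inner_self_eq_norm_sq (𝕜 := ℂ) _
    rw [h3] at h1
    have h4 : ‖B b‖ ^ 2 ≤ 0 := h1.trans_le (mul_nonpos_of_nonpos_of_nonneg hν h2)
    exact norm_eq_zero.1 (pow_eq_zero_iff two_ne_zero |>.1 (le_antisymm h4 (sq_nonneg _)))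
  rcases le_total 0 μ with h | h
  · have : A⁻ b = 0 := hz (CFC.negPart_nonneg A) (neg_nonpos.2 h) (by rw [hN]; push_cast; rfl)
    rw [max_eq_left h, ← hd, this, sub_zero]
  · rw [hz (CFC.posPart_nonneg A) h hP, max_eq_right h]; simp

end PosPart

section scalar

theorem integral_max_sq {a T : ℝ} (h0 : 0 ≤ a) (hT : a ≤ T) :
    ∫ τ in (0)..T, max (a - τ) 0 ^ 2 = a ^ 3 / 3 := by
  have hc : Continuous fun τ => max (a - τ) 0 ^ 2 := by fun_prop
  rw [← intervalIntegral.integral_add_adjacent_intervals (b := a) (hc.intervalIntegrable _ _)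
    (hc.intervalIntegrable _ _)]
  have h1 : ∫ τ in a..T, max (a - τ) 0 ^ 2 = 0 := by
    rw [intervalIntegral.integral_congr (g := fun _ => 0) fun y hy => ?_]
    · simp
    · rw [uIcc_of_le hT] at hy
      simp [max_eq_right (sub_nonpos.2 hy.1)]
  have h2 : ∫ τ in (0)..a, max (a - τ) 0 ^ 2 = ∫ τ in (0)..a, (a - τ) ^ 2 :=
    intervalIntegral.integral_congr fun y hy => by
      rw [uIcc_of_le h0] at hy
      simp only [max_eq_left (sub_nonneg.2 hy.2)]
  rw [h1, h2, intervalIntegral.integral_comp_sub_left (fun x => x ^ 2) a]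
  norm_num

theorem two_fifths_mul_pow_le {κ T : ℝ} (h0 : 0 < κ) (hT : κ ^ 2 ≤ T) :
    2 / 5 * κ ^ 5 ≤ ∫ τ in (0)..T, √(κ ^ 2 - τ) ^ 3 := by
  have hc : Continuous fun τ => √(κ ^ 2 - τ) ^ 3 := by fun_prop
  rw [← intervalIntegral.integral_add_adjacent_intervals (b := κ ^ 2) (hc.intervalIntegrable _ _)
    (hc.intervalIntegrable _ _)]
  have h1 : 0 ≤ ∫ τ in (κ ^ 2)..T, √(κ ^ 2 - τ) ^ 3 :=
    intervalIntegral.integral_nonneg hT fun x _ => by positivity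
  have h2 : ∫ τ in (0)..(κ ^ 2), √(κ ^ 2 - τ) ^ 3 = 2 / 5 * κ ^ 5 := by
    rw [intervalIntegral.integral_eq_sub_of_hasDerivAt_of_le (f := fun τ => -(2 / 5) * √(κ ^ 2 - τ) ^ 5)
      (by positivity) (by fun_prop) (fun x hx => ?_) (hc.intervalIntegrable _ _)]
    · simp [Real.sqrt_sq h0.le]
    · have hs : 0 < κ ^ 2 - x := sub_pos.2 hx.2
      have hs' := Real.sqrt_pos.2 hs
      refine ((((((hasDerivAt_id x).const_sub (κ ^ 2)).sqrt hs.ne').pow 5).const_mul _).congr_deriv ?_)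
      simp only [id]
      field_simp
      norm_num
  linarith

end scalar

section trace

variable {F : Type*} [NormedAddCommGroup F] [InnerProductSpace ℂ F] [FiniteDimensional ℂ F]

theorem tr_eq_sum_basis {n : ℕ} (b : OrthonormalBasis (Fin n) ℂ F) (A : F →L[ℂ] F) {l : Fin n → ℝ}
    (h : ∀ i, A (b i) = (l i : ℂ) • b i) : tr A = ((∑ i, l i : ℝ) : ℂ) := by
  rw [tr_apply, LinearMap.trace_eq_sum_inner _ b]
  push_cast
  refine Finset.sum_congr rfl fun i _ => ?_
  change ⟪b i, A (b i)⟫_ℂ = _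
  rw [h, inner_smul_right, inner_self_eq_norm_sq_to_K, b.norm_eq_one]; simp

/-- Layer-cake formula for the trace of the cube of a nonnegative operator. -/
theorem integral_tr_posPart_sq [CompleteSpace F] {W : F →L[ℂ] F} (hW : ∀ u v, ⟪W u, v⟫_ℂ = ⟪u, W v⟫_ℂ)
    (hpos : ∀ v, 0 ≤ (⟪v, W v⟫_ℂ).re) {T : ℝ} (hT : ‖W‖ ≤ T) :
    ∫ τ in (0)..T, (tr ((W - (τ : ℂ) • 1)⁺ * (W - (τ : ℂ) • 1)⁺)).re = (tr (W * W * W)).re / 3 := by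
  have hs : (W : F →ₗ[ℂ] F).IsSymmetric := hW
  set b := hs.eigenvectorBasis rfl
  set l := hs.eigenvalues rfl
  have hb : ∀ i, W (b i) = (l i : ℂ) • b i := fun i => hs.apply_eigenvectorBasis rfl i
  have hl : ∀ i, (⟪b i, W (b i)⟫_ℂ).re = l i := fun i => by
    rw [hb, inner_smul_right, inner_self_eq_norm_sq_to_K, b.norm_eq_one]; simp
  have hl0 : ∀ i, 0 ≤ l i := fun i => (hpos (b i)).trans_eq (hl i)
  have hlT : ∀ i, l i ≤ T := fun i => by
    refine le_trans ?_ hT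
    have h1 := W.le_opNorm (b i)
    rwa [hb, norm_smul, b.norm_eq_one, mul_one, mul_one, Complex.norm_real, Real.norm_eq_abs,
      abs_of_nonneg (hl0 i)] at h1
  have h3 : tr (W * W * W) = ((∑ i, l i ^ 3 : ℝ) : ℂ) := tr_eq_sum_basis b _ fun i => by
    simp only [mul_apply_eq_comp, hb, map_smul, smul_smul]; push_cast; ring_nf
  have h2 : ∀ τ : ℝ, tr ((W - (τ : ℂ) • 1)⁺ * (W - (τ : ℂ) • 1)⁺)
      = ((∑ i, max (l i - τ) 0 ^ 2 : ℝ) : ℂ) := fun τ => tr_eq_sum_basis b _ fun i => by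
    have hsa : IsSelfAdjoint (W - (τ : ℂ) • 1) := isSelfAdjoint_of_symm fun u v => by
      simp [hW]
    have h4 := posPart_apply_of_eigen hsa (μ := l i - τ) (b := b i) (by
      rw [_root_.sub_apply, hb, _root_.smul_apply, one_apply_eq_self]; push_cast; rw [sub_smul])
    rw [mul_apply_eq_comp, h4, map_smul, h4, smul_smul]; push_cast; ring_nf
  simp only [h2, h3, Complex.ofReal_re]
  rw [intervalIntegral.integral_finsetSum fun i _ => Continuous.intervalIntegrable (by fun_prop) _ _,
    Finset.sum_div]
  exact Finset.sum_congr rfl fun i _ => integral_max_sq (hl0 i) (hlT i)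

end trace

namespace H1

variable {F : Type*} [NormedAddCommGroup F] [InnerProductSpace ℂ F] [FiniteDimensional ℂ F]

omit [FiniteDimensional ℂ F] in
theorem shift_symm (V : Potential F) (τ x : ℝ) (u v : F) :
    ⟪(-V.op x - (τ : ℂ) • 1) u, v⟫_ℂ = ⟪u, (-V.op x - (τ : ℂ) • 1) v⟫_ℂ := by
  simp [V.symm]

variable [CompleteSpace F]

omit [FiniteDimensional ℂ F] in
theorem posPart_shift_zero {τ : ℝ} (hτ : 0 ≤ τ) : (-(0 : F →L[ℂ] F) - (τ : ℂ) • 1)⁺ = 0 := by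
  have hs : IsSelfAdjoint (-(0 : F →L[ℂ] F) - (τ : ℂ) • 1) := isSelfAdjoint_of_symm fun u v => by simp
  rw [CFC.posPart_eq_zero_iff _ hs, ← sub_nonneg, ContinuousLinearMap.nonneg_iff_isPositive]
  have e : 0 - (-(0 : F →L[ℂ] F) - (τ : ℂ) • 1) = (τ : ℂ) • 1 := by simp
  rw [e, ← ContinuousLinearMap.nonneg_iff_isPositive]
  have h1 : (0 : F →L[ℂ] F) ≤ 1 := by
    rw [ContinuousLinearMap.nonneg_iff_isPositive]; exact ContinuousLinearMap.isPositive_one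
  exact smul_nonneg (by simpa using hτ) h1

/-- The part of a potential below the level `-τ`, shifted to zero. -/
noncomputable def _root_.Potential.cut (V : Potential F) {R : ℝ}
    (h0 : ∀ x, R ≤ |x| → V.op x = 0) {τ : ℝ} (hτ : 0 ≤ τ) : Potential F :=
  have hc : Continuous fun x => -(-V.op x - (τ : ℂ) • 1)⁺ :=
      (continuous_posPart_clm (V.cont.neg.sub continuous_const) fun x =>
        isSelfAdjoint_of_symm (shift_symm V τ x)).neg
  { op := fun x => -(-V.op x - (τ : ℂ) • 1)⁺
    cont := hc
    symm := fun x u v => by simp [posPart_symm]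
    bdd := HasCompactSupport.exists_bound_of_continuous
      (HasCompactSupport.intro (isCompact_Icc (a := -R) (b := R)) fun x hx => by
        rw [h0 x (not_lt.1 fun h => hx (abs_le.1 h.le)), posPart_shift_zero hτ, neg_zero]) hc }

theorem cut_op (V : Potential F) {R : ℝ} (h0 : ∀ x, R ≤ |x| → V.op x = 0) {τ : ℝ} (hτ : 0 ≤ τ) (x : ℝ) :
    (V.cut h0 hτ).op x = -(-V.op x - (τ : ℂ) • 1)⁺ := rfl

theorem sum_sqrt_sub_le {V : Potential F} {R : ℝ} (hR : 0 < R) (h0 : ∀ x, R ≤ |x| → V.op x = 0) {N : ℕ}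
    {E : Fin N → ℝ} {ψ : Fin N → H1 F} (hψ : IsEigenFamily V E ψ) {τ : ℝ} (hτ : 0 ≤ τ) :
    16 / 3 * ∑ j, √(E j - τ) ^ 3 ≤ ∫ x in (-R)..R,
      (tr ((-V.op x - (τ : ℂ) • 1)⁺ * (-V.op x - (τ : ℂ) • 1)⁺)).re := by
  have hz : ∀ x, R ≤ |x| → (V.cut h0 hτ).op x = 0 := fun x hx => by
    rw [cut_op, h0 x hx, posPart_shift_zero hτ, neg_zero]
  obtain ⟨M, e, κ, χ, hχ, hκ, he, hmax⟩ := exists_complete_family hR hz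
  have h1 := sum_cube_le hz hχ hκ he hmax
  simp only [cut_op, neg_mul_neg] at h1
  refine le_trans (mul_le_mul_of_nonneg_left (sum_sqrt_cube_le hψ hχ (fun k => (hκ k).le) fun u => ?_)
    (by norm_num)) h1
  have h2 := hmax u
  simp only [he] at h2
  refine (sub_le_sub_right h2 _).trans (form_le_form_add (fun x v => ?_) u)
  have h3 := re_inner_nonneg_of_nonneg (CFC.negPart_nonneg (-V.op x - (τ : ℂ) • 1)) v
  have h4 := CFC.posPart_sub_negPart _ (isSelfAdjoint_of_symm (shift_symm V τ x))
  have h5 := congrArg (fun A : F →L[ℂ] F => (⟪v, A v⟫_ℂ).re) h4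
  simp only [_root_.sub_apply, _root_.neg_apply, _root_.smul_apply, one_apply_eq_self, inner_sub_right,
    inner_neg_right, inner_smul_right, Complex.sub_re, Complex.neg_re, Complex.re_ofReal_mul] at h5
  have h6 : (⟪v, v⟫_ℂ).re = ‖v‖ ^ 2 := inner_self_eq_norm_sq (𝕜 := ℂ) _
  rw [cut_op, _root_.neg_apply, inner_neg_right, Complex.neg_re]
  rw [h6] at h5
  linarith

/-- The sharp Lieb-Thirring inequality for the moment `5/2`. -/
theorem sum_pow_five_le {V : Potential F} {R : ℝ} (hR : 0 < R) (h0 : ∀ x, R ≤ |x| → V.op x = 0)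
    (hneg : ∀ x v, (⟪v, V.op x v⟫_ℂ).re ≤ 0) {N : ℕ}
    {E κ : Fin N → ℝ} {ψ : Fin N → H1 F} (hψ : IsEigenFamily V E ψ) (hκ : ∀ j, 0 < κ j)
    (hE : ∀ j, E j = κ j ^ 2) :
    32 / 5 * ∑ j, κ j ^ 5 ≤ ∫ x in (-R)..R, -(tr (V.op x * V.op x * V.op x)).re := by
  obtain ⟨K, hK⟩ := V.bdd
  have hE0 : ∀ j, 0 ≤ E j := fun j => by rw [hE]; positivity
  have hK0 : 0 ≤ K := (norm_nonneg _).trans (hK 0)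
  set T := K + ∑ j, E j
  have hT : 0 ≤ T := add_nonneg hK0 (Finset.sum_nonneg fun j _ => hE0 j)
  have hET : ∀ j, κ j ^ 2 ≤ T := fun j => by
    rw [← hE]
    have := Finset.single_le_sum (fun j _ => hE0 j) (Finset.mem_univ j)
    simp only [T]; linarith
  set G : ℝ → ℝ → ℝ := fun τ x =>
    (tr ((-V.op x - (τ : ℂ) • 1)⁺ * (-V.op x - (τ : ℂ) • 1)⁺)).re
  have hG : Continuous G.uncurry := by
    have hc : Continuous fun p : ℝ × ℝ => (-V.op p.2 - (p.1 : ℂ) • 1)⁺ := by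
      refine continuous_posPart_clm ?_ fun p => isSelfAdjoint_of_symm (shift_symm V p.1 p.2)
      have := V.cont
      fun_prop
    have : Continuous fun p : ℝ × ℝ =>
      (tr ((-V.op p.2 - (p.1 : ℂ) • 1)⁺ * (-V.op p.2 - (p.1 : ℂ) • 1)⁺)).re := by fun_prop
    exact this
  have h1 : ∫ τ in (0)..T, 16 / 3 * ∑ j, √(E j - τ) ^ 3 ≤ ∫ τ in (0)..T, ∫ x in (-R)..R, G τ x := by
    refine intervalIntegral.integral_mono_on hT (Continuous.intervalIntegrable (by fun_prop) _ _)
      (Continuous.intervalIntegrable ?_ _ _) fun τ hτ => sum_sqrt_sub_le hR h0 hψ hτ.1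
    exact intervalIntegral.continuous_parametric_intervalIntegral_of_continuous' hG _ _
  have h2 : ∫ τ in (0)..T, ∫ x in (-R)..R, G τ x
      = ∫ x in (-R)..R, -(tr (V.op x * V.op x * V.op x)).re / 3 := by
    rw [intervalIntegral_intervalIntegral_swap]
    · congr 1; ext x
      have := integral_tr_posPart_sq (W := -V.op x) (T := T) (fun u v => by simp [V.symm])
        (fun v => by simpa using hneg x v) (by
          rw [norm_neg]
          have := Finset.sum_nonneg fun j (_ : j ∈ Finset.univ) => hE0 j
          simp only [T]; linarith [hK x])
      refine this.trans ?_
      simp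
    · exact (hG.continuousOn.integrableOn_compact (isCompact_uIcc.prod isCompact_uIcc)).mono_set
        (prod_mono uIoc_subset_uIcc uIoc_subset_uIcc)
  rw [h2, intervalIntegral.integral_div, intervalIntegral.integral_const_mul,
    intervalIntegral.integral_finsetSum fun j _ => Continuous.intervalIntegrable (by fun_prop) _ _] at h1
  have h3 : ∑ j, 2 / 5 * κ j ^ 5 ≤ ∑ j, ∫ τ in (0)..T, √(E j - τ) ^ 3 := Finset.sum_le_sum fun j _ => by
    rw [hE]; exact two_fifths_mul_pow_le (hκ j) (hET j)
  rw [← Finset.mul_sum] at h3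
  linarith

end H1

end

section

open MeasureTheory Filter Topology Set
open scoped ComplexOrder InnerProductSpace

theorem le_sqrt_mul_sqrt_of_forall {A B X : ℝ} (hA : 0 ≤ A) (hB : 0 ≤ B)
    (h : ∀ c : ℝ, 0 ≤ c → 2 * c * X ≤ B + c ^ 2 * A) : X ≤ √A * √B := by
  rcases le_or_gt X 0 with hX | hX
  · exact hX.trans (by positivity)
  rw [← Real.sqrt_mul hA]
  refine Real.le_sqrt_of_sq_le ?_
  rcases hA.eq_or_lt with rfl | hA
  · have := h ((B + 1) / (2 * X)) (by positivity)
    field_simp at this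
    nlinarith
  · have := h (X / A) (by positivity)
    field_simp at this
    nlinarith

namespace H1

variable {F : Type*} [NormedAddCommGroup F] [InnerProductSpace ℂ F] [FiniteDimensional ℂ F]

theorem re_tr_nonpos {A : F →L[ℂ] F} (h : ∀ v, (⟪v, A v⟫_ℂ).re ≤ 0) : (tr A).re ≤ 0 := by
  rw [tr_eq_sum_inner, Complex.re_sum]
  exact Finset.sum_nonpos fun i _ => h _

set_option maxHeartbeats 800000 in
/-- Lower bound for the moment `3/2` of a compactly supported potential. -/
theorem moment_bound {V : Potential F} {R : ℝ} (hR : 0 < R)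
    (h0 : ∀ x, R ≤ |x| → V.op x = 0) (hneg : ∀ x v, (⟪v, V.op x v⟫_ℂ).re ≤ 0)
    {V' : ℝ → F →L[ℂ] F} (hV' : ∀ x, HasDerivAt V.op (V' x) x) (hcV' : Continuous V')
    (h0' : ∀ x, R ≤ |x| → V' x = 0) {N : ℕ}
    {E κ : Fin N → ℝ} {ψ : Fin N → H1 F} (hψ : IsEigenFamily V E ψ) (hκ : ∀ j, 0 < κ j)
    (hE : ∀ j, E j = κ j ^ 2) (hmax : ∀ u, -(∑ j, E j * ‖mass (ψ j) u‖ ^ 2) ≤ (form V u u).re)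
    (c : ℝ) :
    2 * c * ((∫ x in (-R)..R, (tr (V.op x * V.op x)).re) - 16 / 3 * ∑ j, κ j ^ 3)
      ≤ (∫ x in (-R)..R, (tr (V' x * V' x)).re) + c ^ 2 * ∫ x in (-R)..R, -(tr (V.op x)).re := by
  have : CompleteSpace F := FiniteDimensional.complete ℂ F
  have hV := Potential.tame_of_eq_zero h0
  have hab : ∀ x ≤ -R, R ≤ |x| := fun x hx => (le_neg.1 hx).trans (neg_le_abs x)
  obtain ⟨U, hU, hpos, ⟨θ₁, d1, l1, r1⟩, ⟨θ₃, d3, l3, r3⟩, hder⟩ := exists_stripped hV hψ hκ hE hmax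
  obtain ⟨U', hU', -, -, ⟨θ₅, d5, l5, r5⟩⟩ := hder V' hV' hcV'
    (tendsto_const_nhds.congr' ((eventually_le_atBot (-R)).mono fun x hx => (h0' x (hab x hx)).symm))
  have hcV := V.cont
  have hc1 : Continuous fun x => (tr (V.op x)).re := by fun_prop
  have hc2 : Continuous fun x => (tr (V.op x * V.op x)).re := by fun_prop
  have hc3 : Continuous fun x => (tr (V.op x * V.op x * V.op x)).re := by fun_prop
  have hcd : Continuous fun x => (tr (V' x * V' x)).re := by fun_prop
  have hcf : Continuous fun x => (tr (V' x * V' x)).re + 2 * (tr (V.op x * V.op x * V.op x)).re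
    - 2 * c * (tr (V.op x * V.op x)).re + c ^ 2 * (tr (V.op x)).re := by fun_prop
  have hP : ∀ x, HasDerivAt (fun x => (θ₁ x).re + ∫ y in (-R)..x, (tr (V.op y)).re)
      (tr (U.op x)).re x := fun x => by
    refine ((d1 x).complex_re.add (hasDerivAt_intervalIntegral hc1 (-R) x)).congr_deriv ?_
    rw [Complex.sub_re]; ring
  have hQ : ∀ x, HasDerivAt (fun x => (θ₅ x).re - 2 * c * (θ₃ x).re + c ^ 2 * (θ₁ x).re
      + ∫ y in (-R)..x, ((tr (V' y * V' y)).re + 2 * (tr (V.op y * V.op y * V.op y)).re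
    - 2 * c * (tr (V.op y * V.op y)).re + c ^ 2 * (tr (V.op y)).re))
      (tr (U' x * U' x) + 2 * tr (U.op x * U.op x * U.op x) - 2 * c * tr (U.op x * U.op x)
        + c ^ 2 * tr (U.op x)).re x := fun x => by
    refine ((((d5 x).complex_re.sub ((d3 x).complex_re.const_mul (2 * c))).add
      ((d1 x).complex_re.const_mul (c ^ 2))).add
      (hasDerivAt_intervalIntegral hcf (-R) x)).congr_deriv ?_
    have e1 : ∀ z : ℂ, (2 * (c : ℂ) * z).re = 2 * c * z.re := fun z => by
      rw [show 2 * (c : ℂ) = ((2 * c : ℝ) : ℂ) by push_cast; rfl, Complex.re_ofReal_mul]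
    have e2 : ∀ z : ℂ, ((c : ℂ) ^ 2 * z).re = c ^ 2 * z.re := fun z => by
      rw [← Complex.ofReal_pow, Complex.re_ofReal_mul]
    have e3 : ∀ z : ℂ, (2 * z).re = 2 * z.re := fun z => by
      rw [show (2 : ℂ) = ((2 : ℝ) : ℂ) by push_cast; rfl, Complex.re_ofReal_mul]
    simp only [Complex.add_re, Complex.sub_re, e1, e2, e3]
    ring
  have hre : ∀ {θ : ℝ → ℂ}, Tendsto θ atBot (𝓝 0) → Tendsto (fun x => (θ x).re) atBot (𝓝 0) :=
    fun h => (Complex.continuous_re.tendsto 0).comp h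
  have hql : Tendsto (fun x => (θ₅ x).re - 2 * c * (θ₃ x).re + c ^ 2 * (θ₁ x).re
      + ∫ y in (-R)..x, ((tr (V' y * V' y)).re + 2 * (tr (V.op y * V.op y * V.op y)).re
    - 2 * c * (tr (V.op y * V.op y)).re + c ^ 2 * (tr (V.op y)).re)) atBot (𝓝 0) := by
    have h1 := (((hre l5).sub ((hre l3).const_mul (2 * c))).add ((hre l1).const_mul (c ^ 2))).add
      (tendsto_intervalIntegral_atBot_zero (R := R)
        (f := fun y => (tr (V' y * V' y)).re + 2 * (tr (V.op y * V.op y * V.op y)).re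
    - 2 * c * (tr (V.op y * V.op y)).re + c ^ 2 * (tr (V.op y)).re) fun x hx => by
        rw [h0 x (hab x hx), h0' x (hab x hx)]; simp)
    simpa using h1
  obtain ⟨C, hC⟩ := StripData.exists_sq_bound (R := R) (f := fun x => (θ₁ x).re)
    (continuous_iff_continuousAt.2 fun x => (d1 x).complex_re.continuousAt) (hre l1)
  have key := terminal_inequality hU hpos hU' (C := (θ₁ R).re + C) hP (fun a ha => by
    have h1 : |(θ₁ a).re| ≤ C := hC a ha
    have h2 : (∫ y in (-R)..R, (tr (V.op y)).re) - (∫ y in (-R)..a, (tr (V.op y)).re)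
        = ∫ y in a..R, (tr (V.op y)).re :=
      intervalIntegral.integral_interval_sub_left (hc1.intervalIntegrable _ _)
        (hc1.intervalIntegrable _ _)
    have h3 : 0 ≤ ∫ y in a..R, -(tr (V.op y)).re :=
      intervalIntegral.integral_nonneg ha fun y _ => by linarith [re_tr_nonpos (hneg y)]
    rw [intervalIntegral.integral_neg] at h3
    have h4 := (abs_le.1 h1).1
    linarith) (c := c) hQ hql
  have f1 := sum_sqrt_le hR (fun x hx => h0 x hx.le) hneg hψ hκ hE
  have f5 := sum_pow_five_le hR h0 hneg hψ hκ hE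
  have hi : ∀ {f : ℝ → ℝ}, Continuous f → IntervalIntegrable f volume (-R) R :=
    fun h => h.intervalIntegrable _ _
  rw [intervalIntegral.integral_add (hi (by fun_prop)) (hi (by fun_prop)),
    intervalIntegral.integral_sub (hi (by fun_prop)) (hi (by fun_prop)),
    intervalIntegral.integral_add (hi (by fun_prop)) (hi (by fun_prop)),
    intervalIntegral.integral_const_mul, intervalIntegral.integral_const_mul,
    intervalIntegral.integral_const_mul, r1, r3, r5, Complex.ofReal_re, Complex.ofReal_re,
    Complex.ofReal_re] at key
  rw [intervalIntegral.integral_neg] at f1 f5 ⊢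
  have f2 := mul_le_mul_of_nonneg_left f1 (sq_nonneg c)
  nlinarith

/-- The remainder estimate for compactly supported potentials. -/
theorem sub_sum_cube_le {V : Potential F} {R : ℝ} (hR : 0 < R)
    (h0 : ∀ x, R ≤ |x| → V.op x = 0) (hneg : ∀ x v, (⟪v, V.op x v⟫_ℂ).re ≤ 0)
    {V' : ℝ → F →L[ℂ] F} (hV' : ∀ x, HasDerivAt V.op (V' x) x) (hcV' : Continuous V')
    (h0' : ∀ x, R ≤ |x| → V' x = 0) {N : ℕ}
    {E κ : Fin N → ℝ} {ψ : Fin N → H1 F} (hψ : IsEigenFamily V E ψ) (hκ : ∀ j, 0 < κ j)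
    (hE : ∀ j, E j = κ j ^ 2) (hmax : ∀ u, -(∑ j, E j * ‖mass (ψ j) u‖ ^ 2) ≤ (form V u u).re) :
    (∫ x in (-R)..R, (tr (V.op x * V.op x)).re) - 16 / 3 * ∑ j, κ j ^ 3
      ≤ √(∫ x in (-R)..R, -(tr (V.op x)).re) * √(∫ x in (-R)..R, (tr (V' x * V' x)).re) := by
  refine le_sqrt_mul_sqrt_of_forall (intervalIntegral.integral_nonneg (by linarith) fun y _ => ?_)
    (intervalIntegral.integral_nonneg (by linarith) fun y _ => ?_)
    fun c _ => moment_bound hR h0 hneg hV' hcV' h0' hψ hκ hE hmax c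
  · linarith [re_tr_nonpos (hneg y)]
  · exact tr_mul_self_nonneg (symm_of_hasDerivAt (s := univ) univ_mem (hV' y) fun y _ => V.symm y)

end H1

end

section

open MeasureTheory Filter Topology Set
open scoped ComplexOrder InnerProductSpace

theorem exists_cutoff : ∃ (η η' : ℝ → ℝ) (K : ℝ), (∀ x, HasDerivAt η (η' x) x) ∧ Continuous η' ∧
    (∀ x, 0 ≤ η x) ∧ (∀ x, η x ≤ 1) ∧ (∀ x, |x| ≤ 1 → η x = 1) ∧ (∀ x, 2 ≤ |x| → η x = 0) ∧
    (∀ x, 2 ≤ |x| → η' x = 0) ∧ ∀ x, |η' x| ≤ K := by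
  let η : ContDiffBump (0 : ℝ) := ⟨1, 3 / 2, by norm_num, by norm_num⟩
  have hd : ContDiff ℝ 1 η := η.contDiff
  have hcd : Continuous (deriv η) := hd.continuous_deriv le_rfl
  obtain ⟨K, hK⟩ := η.hasCompactSupport.deriv.exists_bound_of_continuous hcd
  have hz : ∀ x : ℝ, 3 / 2 ≤ |x| → η x = 0 := fun x hx => η.zero_of_le_dist (by simpa using hx)
  refine ⟨η, deriv η, K, fun x => (hd.differentiable one_ne_zero x).hasDerivAt, hcd,
    fun x => η.nonneg, fun x => η.le_one, fun x hx => η.one_of_mem_closedBall (by simpa [η] using hx),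
    fun x hx => hz x (by linarith), fun x hx => ?_, hK⟩
  have he : (η : ℝ → ℝ) =ᶠ[𝓝 x] fun _ => 0 := by
    have : ∀ᶠ y in 𝓝 x, 3 / 2 < |y| := (continuous_abs.tendsto x).eventually (lt_mem_nhds (by linarith))
    exact this.mono fun y hy => hz y hy.le
  rw [he.deriv_eq, deriv_const]

variable {F : Type*} [NormedAddCommGroup F] [InnerProductSpace ℂ F] [FiniteDimensional ℂ F]

theorem tr_quadratic (A B : F →L[ℂ] F) (p q : ℝ) :
    (tr (((p : ℂ) • A + (q : ℂ) • B) * ((p : ℂ) • A + (q : ℂ) • B))).re =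
      p ^ 2 * (tr (A * A)).re + 2 * (p * q) * (tr (A * B)).re + q ^ 2 * (tr (B * B)).re := by
  have e : tr (((p : ℂ) • A + (q : ℂ) • B) * ((p : ℂ) • A + (q : ℂ) • B)) =
      ((p ^ 2 : ℝ) : ℂ) * tr (A * A) + ((2 * (p * q) : ℝ) : ℂ) * tr (A * B)
        + ((q ^ 2 : ℝ) : ℂ) * tr (B * B) := by
    simp only [add_mul, mul_add, smul_mul_assoc, mul_smul_comm, map_add, map_smul, smul_eq_mul,
      tr_mul_comm B A]
    push_cast; ring
  rw [e, Complex.add_re, Complex.add_re, Complex.re_ofReal_mul, Complex.re_ofReal_mul,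
    Complex.re_ofReal_mul]

theorem tr_quadratic_nonneg {A B : F →L[ℂ] F} (hA : ∀ u v, ⟪A u, v⟫_ℂ = ⟪u, A v⟫_ℂ)
    (hB : ∀ u v, ⟪B u, v⟫_ℂ = ⟪u, B v⟫_ℂ) (p q : ℝ) :
    0 ≤ p ^ 2 * (tr (A * A)).re + 2 * (p * q) * (tr (A * B)).re + q ^ 2 * (tr (B * B)).re := by
  rw [← tr_quadratic]
  exact tr_mul_self_nonneg fun u v => by
    simp [hA, hB]

theorem tr_cutoff_le {A B : F →L[ℂ] F} (hA : ∀ u v, ⟪A u, v⟫_ℂ = ⟪u, A v⟫_ℂ)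
    (hB : ∀ u v, ⟪B u, v⟫_ℂ = ⟪u, B v⟫_ℂ) {p q R K : ℝ} (hR : 0 < R) (hp : |p| ≤ K / R) (hq0 : 0 ≤ q)
    (hq1 : q ≤ 1) :
    (tr (((p : ℂ) • A + (q : ℂ) • B) * ((p : ℂ) • A + (q : ℂ) • B))).re ≤
      (1 + R⁻¹) * (tr (B * B)).re + (R⁻¹ ^ 2 + R⁻¹) * (K ^ 2 * (tr (A * A)).re) := by
  rw [tr_quadratic]
  have h1 := tr_quadratic_nonneg hA hB (R * p) (-q)
  have ha := tr_mul_self_nonneg hA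
  have hb := tr_mul_self_nonneg hB
  set a := (tr (A * A)).re
  set b := (tr (B * B)).re
  set m := (tr (A * B)).re
  have h2 : 2 * (p * q) * m ≤ R * p ^ 2 * a + R⁻¹ * (q ^ 2 * b) := by
    have : 0 ≤ R⁻¹ * ((R * p) ^ 2 * a + 2 * (R * p * -q) * m + (-q) ^ 2 * b) :=
      mul_nonneg (inv_nonneg.2 hR.le) h1
    have e : R⁻¹ * ((R * p) ^ 2 * a + 2 * (R * p * -q) * m + (-q) ^ 2 * b)
        = R * p ^ 2 * a - 2 * (p * q) * m + R⁻¹ * (q ^ 2 * b) := by field_simp; ring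
    linarith
  have h3 : p ^ 2 ≤ (K / R) ^ 2 := by rw [← sq_abs]; exact pow_le_pow_left₀ (abs_nonneg p) hp 2
  have h4 : q ^ 2 * b ≤ b := mul_le_of_le_one_left hb (pow_le_one₀ hq0 hq1)
  have h5 : (1 + R) * p ^ 2 * a ≤ (1 + R) * (K / R) ^ 2 * a :=
    mul_le_mul_of_nonneg_right (mul_le_mul_of_nonneg_left h3 (by linarith)) ha
  have h6 : (1 + R) * (K / R) ^ 2 * a = (R⁻¹ ^ 2 + R⁻¹) * (K ^ 2 * a) := by field_simp
  have h7 : (1 + R⁻¹) * (q ^ 2 * b) ≤ (1 + R⁻¹) * b :=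
    mul_le_mul_of_nonneg_left h4 (by have := inv_pos.2 hR; linarith)
  linarith

/-- A potential whose square and squared derivative have integrable traces vanishes at infinity. -/
theorem Potential.decays_of_integrable [CompleteSpace F] {V : ℝ → F →L[ℂ] F}
    (hs : ∀ x u v, ⟪V x u, v⟫_ℂ = ⟪u, V x v⟫_ℂ)
    {V' : ℝ → F →L[ℂ] F} (hV' : ∀ x, HasDerivAt V (V' x) x) (hcV' : Continuous V')
    (h2 : Integrable fun x => (tr (V x * V x)).re) (h2' : Integrable fun x => (tr (V' x * V' x)).re) :
    ∀ η > 0, ∃ L > 0, ∀ x, L ≤ |x| → ‖V x‖ ≤ η := by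
  have hs' : ∀ x u v, ⟪V' x u, v⟫_ℂ = ⟪u, V' x v⟫_ℂ := fun x =>
    symm_of_hasDerivAt (s := univ) univ_mem (hV' x) fun y _ => hs y
  have hcV : Continuous V := continuous_iff_continuousAt.2 fun x => (hV' x).continuousAt
  have hd : ∀ x, HasDerivAt (fun x => (tr (V x * V x)).re) (2 * (tr (V x * V' x)).re) x := fun x => by
    refine ((hV' x).mul (hV' x)).tr.complex_re.congr_deriv ?_
    rw [map_add, tr_mul_comm (V' x), Complex.add_re]; ring
  have hm : Integrable fun x => 2 * (tr (V x * V' x)).re := by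
    refine (h2.add h2').mono' ((by fun_prop : Continuous _).aestronglyMeasurable) (ae_of_all _ fun x => ?_)
    have a1 := tr_quadratic_nonneg (hs x) (hs' x) 1 1
    have a2 := tr_quadratic_nonneg (hs x) (hs' x) 1 (-1)
    rw [Real.norm_eq_abs, abs_le]
    simp only [Pi.add_apply]
    constructor <;> linarith
  have t1 := tendsto_zero_of_hasDerivAt_of_integrableOn_Ioi (a := 0) (fun x _ => hd x) hm.integrableOn
    h2.integrableOn
  have t2 := tendsto_zero_of_hasDerivAt_of_integrableOn_Iic (a := 0) (fun x _ => hd x) hm.integrableOn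
    h2.integrableOn
  intro η hη
  obtain ⟨a, ha⟩ := eventually_atTop.1 (t1.eventually (gt_mem_nhds (pow_pos hη 2)))
  obtain ⟨b, hb⟩ := eventually_atBot.1 (t2.eventually (gt_mem_nhds (pow_pos hη 2)))
  refine ⟨max 1 (max a (-b)), by positivity, fun x hx => ?_⟩
  have h3 : (tr (V x * V x)).re < η ^ 2 := by
    rcases le_total 0 x with h | h
    · rw [abs_of_nonneg h] at hx
      exact ha x ((le_max_left _ _).trans ((le_max_right _ _).trans hx))
    · rw [abs_of_nonpos h] at hx
      have := (le_max_right _ _).trans ((le_max_right _ _).trans hx)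
      exact hb x (by linarith)
  exact (pow_le_pow_iff_left₀ (norm_nonneg _) hη.le two_ne_zero).1 ((sq_norm_le_tr (hs x)).trans h3.le)

end

section

open MeasureTheory Filter Topology Set
open scoped ComplexOrder InnerProductSpace

namespace H1

variable {F : Type*} [NormedAddCommGroup F] [InnerProductSpace ℂ F] [FiniteDimensional ℂ F]

/-- Truncating the potential to a bounded interval. -/
theorem exists_truncated_family {V V' : ℝ → F →L[ℂ] F}
    (hs : ∀ x u v, ⟪V x u, v⟫_ℂ = ⟪u, V x v⟫_ℂ) (hneg : ∀ x v, (⟪v, V x v⟫_ℂ).re ≤ 0)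
    (hV' : ∀ x, HasDerivAt V (V' x) x) (hcV' : Continuous V')
    (h1 : Integrable fun x => -(tr (V x)).re) (h2 : Integrable fun x => (tr (V x * V x)).re)
    (h2' : Integrable fun x => (tr (V' x * V' x)).re) : ∃ K : ℝ, ∀ R > 0,
    ∃ (W : Potential F) (N : ℕ) (E κ : Fin N → ℝ) (ψ : Fin N → H1 F), IsEigenFamily W E ψ ∧
      (∀ j, 0 < κ j) ∧ (∀ j, E j = κ j ^ 2) ∧
      (∀ x v, (⟪v, V x v⟫_ℂ).re ≤ (⟪v, W.op x v⟫_ℂ).re) ∧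
      (∫ x in (-R)..R, (tr (V x * V x)).re) - 16 / 3 * ∑ j, κ j ^ 3 ≤
        √(∫ x, -(tr (V x)).re) * √((1 + R⁻¹) * (∫ x, (tr (V' x * V' x)).re) +
          (R⁻¹ ^ 2 + R⁻¹) * (K ^ 2 * ∫ x, (tr (V x * V x)).re)) := by
  obtain ⟨η, η', K, hη, hcη', hη0, hη1, hone, hz, hz', hK⟩ := exists_cutoff
  refine ⟨K, fun R hR => ?_⟩
  have hs' : ∀ x u v, ⟪V' x u, v⟫_ℂ = ⟪u, V' x v⟫_ℂ := fun x =>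
    symm_of_hasDerivAt (s := univ) univ_mem (hV' x) fun y _ => hs y
  have hcV : Continuous V := continuous_iff_continuousAt.2 fun x => (hV' x).continuousAt
  have hcη : Continuous η := continuous_iff_continuousAt.2 fun x => (hη x).continuousAt
  have h2R : (0 : ℝ) < 2 * R := by linarith
  have habs : ∀ {x : ℝ}, 2 * R ≤ |x| → 2 ≤ |x / R| := fun {x} hx => by
    rw [abs_div, abs_of_pos hR]; exact (le_div_iff₀ hR).2 hx
  have hzero : ∀ x, 2 * R ≤ |x| → ((η (x / R) : ℝ) : ℂ) • V x = 0 := fun x hx => by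
    rw [hz _ (habs hx)]; simp
  have hcW : Continuous fun x => ((η (x / R) : ℝ) : ℂ) • V x := by fun_prop
  let W : Potential F :=
    { op := fun x => ((η (x / R) : ℝ) : ℂ) • V x
      cont := hcW
      symm := fun x u v => by simp [hs x u v]
      bdd := by
        obtain ⟨C, hC⟩ := (isCompact_Icc (a := -(2 * R)) (b := 2 * R)).exists_bound_of_continuousOn
          hcW.continuousOn
        refine ⟨max C 0, fun x => ?_⟩
        rcases le_or_gt |x| (2 * R) with h | h
        · exact (hC x (abs_le.1 h)).trans (le_max_left _ _)
        · rw [hzero x h.le, norm_zero]; exact le_max_right _ _ }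
  have hre : ∀ x v, (⟪v, W.op x v⟫_ℂ).re = η (x / R) * (⟪v, V x v⟫_ℂ).re := fun x v => by
    change (⟪v, (((η (x / R) : ℝ) : ℂ) • V x) v⟫_ℂ).re = _
    rw [_root_.smul_apply, inner_smul_right, Complex.re_ofReal_mul]
  have hle : ∀ x v, (⟪v, V x v⟫_ℂ).re ≤ (⟪v, W.op x v⟫_ℂ).re := fun x v => by
    rw [hre]; nlinarith [hneg x v, hη1 (x / R)]
  have hWneg : ∀ x v, (⟪v, W.op x v⟫_ℂ).re ≤ 0 := fun x v => by
    rw [hre]; exact mul_nonpos_of_nonneg_of_nonpos (hη0 _) (hneg x v)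
  let W' : ℝ → F →L[ℂ] F := fun x =>
    ((η' (x / R) / R : ℝ) : ℂ) • V x + ((η (x / R) : ℝ) : ℂ) • V' x
  have hW' : ∀ x, HasDerivAt W.op (W' x) x := fun x => by
    have e1 : HasDerivAt (fun x : ℝ => η (x / R)) (η' (x / R) / R) x := by
      have := (hη (x / R)).comp x ((hasDerivAt_id x).div_const R)
      exact this.congr_deriv (by ring)
    refine (e1.ofReal_comp.smul (hV' x)).congr_deriv ?_
    exact add_comm _ _
  have hcW' : Continuous W' := by fun_prop
  have hW'0 : ∀ x, 2 * R ≤ |x| → W' x = 0 := fun x hx => by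
    simp only [W']; rw [hz _ (habs hx), hz' _ (habs hx)]; simp
  obtain ⟨N, E, κ, ψ, hψ, hκ, hE, hmax⟩ := exists_complete_family (V := W) h2R hzero
  refine ⟨W, N, E, κ, ψ, hψ, hκ, hE, hle, ?_⟩
  have key := sub_sum_cube_le h2R hzero hWneg hW' hcW' hW'0 hψ hκ hE hmax
  have htr : ∀ x, (tr (W.op x * W.op x)).re = η (x / R) ^ 2 * (tr (V x * V x)).re := fun x => by
    have : tr (W.op x * W.op x) = ((η (x / R) ^ 2 : ℝ) : ℂ) * tr (V x * V x) := by
      change tr ((((η (x / R) : ℝ) : ℂ) • V x) * (((η (x / R) : ℝ) : ℂ) • V x)) = _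
      simp only [smul_mul_assoc, mul_smul_comm, map_smul, smul_eq_mul]
      push_cast; ring
    rw [this, Complex.re_ofReal_mul]
  have htr1 : ∀ x, -(tr (W.op x)).re = η (x / R) * -(tr (V x)).re := fun x => by
    change -(tr (((η (x / R) : ℝ) : ℂ) • V x)).re = _
    rw [map_smul, smul_eq_mul, Complex.re_ofReal_mul]; ring
  have hcW0 := W.cont
  have b1 : (∫ x in (-R)..R, (tr (V x * V x)).re) ≤
      ∫ x in (-(2 * R))..(2 * R), (tr (W.op x * W.op x)).re := by
    have e : (∫ x in (-R)..R, (tr (V x * V x)).re) = ∫ x in (-R)..R, (tr (W.op x * W.op x)).re := by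
      refine intervalIntegral.integral_congr fun x hx => ?_
      rw [uIcc_of_le (by linarith)] at hx
      rw [htr, hone, one_pow, one_mul]
      rw [abs_div, abs_of_pos hR, div_le_one hR]
      exact abs_le.2 hx
    rw [e]
    refine intervalIntegral.integral_mono_interval (by linarith) (by linarith) (by linarith)
      (ae_of_all _ fun x => tr_mul_self_nonneg (W.symm x)) ?_
    exact (by fun_prop : Continuous fun x => (tr (W.op x * W.op x)).re).intervalIntegrable _ _
  have b2 : (∫ x in (-(2 * R))..(2 * R), -(tr (W.op x)).re) ≤ ∫ x, -(tr (V x)).re := by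
    have hn : ∀ x, 0 ≤ -(tr (V x)).re := fun x => by linarith [re_tr_nonpos (hneg x)]
    refine (intervalIntegral.integral_mono_on (g := fun x => -(tr (V x)).re) (by linarith)
      ((by fun_prop : Continuous _).intervalIntegrable _ _)
      ((by fun_prop : Continuous _).intervalIntegrable _ _) fun x _ => ?_).trans ?_
    · rw [htr1]; exact mul_le_of_le_one_left (hn x) (hη1 _)
    · rw [intervalIntegral.integral_of_le (by linarith)]
      exact setIntegral_le_integral h1 (ae_of_all _ hn)
  have b3 : (∫ x in (-(2 * R))..(2 * R), (tr (W' x * W' x)).re) ≤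
      (1 + R⁻¹) * (∫ x, (tr (V' x * V' x)).re) +
          (R⁻¹ ^ 2 + R⁻¹) * (K ^ 2 * ∫ x, (tr (V x * V x)).re) := by
    have hi : Integrable fun x => (1 + R⁻¹) * (tr (V' x * V' x)).re +
        (R⁻¹ ^ 2 + R⁻¹) * (K ^ 2 * (tr (V x * V x)).re) :=
      (h2'.const_mul _).add ((h2.const_mul _).const_mul _)
    have hn : ∀ x, 0 ≤ (1 + R⁻¹) * (tr (V' x * V' x)).re +
        (R⁻¹ ^ 2 + R⁻¹) * (K ^ 2 * (tr (V x * V x)).re) := fun x => by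
      have := tr_mul_self_nonneg (hs x)
      have := tr_mul_self_nonneg (hs' x)
      positivity
    have e : ∫ x, ((1 + R⁻¹) * (tr (V' x * V' x)).re +
        (R⁻¹ ^ 2 + R⁻¹) * (K ^ 2 * (tr (V x * V x)).re)) = _ :=
      integral_add (h2'.const_mul _) ((h2.const_mul _).const_mul _)
    simp only [integral_const_mul] at e
    rw [← e]
    refine (intervalIntegral.integral_mono_on (by linarith)
      ((by fun_prop : Continuous _).intervalIntegrable _ _)
      (hi.intervalIntegrable) fun x _ => ?_).trans ?_
    · refine tr_cutoff_le (hs x) (hs' x) hR ?_ (hη0 _) (hη1 _)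
      rw [abs_div, abs_of_pos hR]
      exact div_le_div_of_nonneg_right (hK _) hR.le
    · rw [intervalIntegral.integral_of_le (by linarith)]
      exact setIntegral_le_integral hi (ae_of_all _ hn)
  have b4 := mul_le_mul (Real.sqrt_le_sqrt b2) (Real.sqrt_le_sqrt b3) (Real.sqrt_nonneg _)
    (Real.sqrt_nonneg _)
  linarith

/-- The remainder estimate for operator-valued potentials. -/
theorem exists_family_remainder {V V' : ℝ → F →L[ℂ] F}
    (hs : ∀ x u v, ⟪V x u, v⟫_ℂ = ⟪u, V x v⟫_ℂ) (hneg : ∀ x v, (⟪v, V x v⟫_ℂ).re ≤ 0)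
    (hV' : ∀ x, HasDerivAt V (V' x) x) (hcV' : Continuous V')
    (h1 : Integrable fun x => -(tr (V x)).re) (h2 : Integrable fun x => (tr (V x * V x)).re)
    (h2' : Integrable fun x => (tr (V' x * V' x)).re) {δ : ℝ} (hδ : 0 < δ) :
    ∃ U : Potential F, U.op = V ∧ ∃ (N : ℕ) (E : Fin N → ℝ) (ψ : Fin N → H1 F),
      IsEigenFamily U E ψ ∧ (∀ j, 0 < E j) ∧
      3 / 16 * (∫ x, (tr (V x * V x)).re) - ∑ j, √(E j) ^ 3 ≤
        3 / 16 * √(∫ x, -(tr (V x)).re) * √(∫ x, (tr (V' x * V' x)).re) + δ := by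
  have : CompleteSpace F := FiniteDimensional.complete ℂ F
  have hcV : Continuous V := continuous_iff_continuousAt.2 fun x => (hV' x).continuousAt
  have hdec := Potential.decays_of_integrable hs hV' hcV' h2 h2'
  let U : Potential F :=
    { op := V
      cont := hcV
      symm := hs
      bdd := by
        obtain ⟨L, -, hL⟩ := hdec 1 one_pos
        obtain ⟨C, hC⟩ := (isCompact_Icc (a := -L) (b := L)).exists_bound_of_continuousOn
          hcV.continuousOn
        refine ⟨max C 1, fun x => ?_⟩
        rcases le_total |x| L with h | h
        · exact (hC x (abs_le.1 h)).trans (le_max_left _ _)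
        · exact (hL x h).trans (le_max_right _ _) }
  refine ⟨U, rfl, ?_⟩
  obtain ⟨K, hK⟩ := exists_truncated_family hs hneg hV' hcV' h1 h2 h2'
  set S := ∫ x, (tr (V x * V x)).re
  set A := ∫ x, -(tr (V x)).re
  set B := ∫ x, (tr (V' x * V' x)).re
  have hlim : Tendsto (fun R : ℝ => √A * √((1 + R⁻¹) * B + (R⁻¹ ^ 2 + R⁻¹) * (K ^ 2 * S))
      - ∫ x in (-R)..R, (tr (V x * V x)).re) atTop (𝓝 (√A * √B - S)) := by
    have t := tendsto_inv_atTop_zero (𝕜 := ℝ)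
    have t1 : Tendsto (fun R : ℝ => (1 + R⁻¹) * B + (R⁻¹ ^ 2 + R⁻¹) * (K ^ 2 * S)) atTop
        (𝓝 ((1 + 0) * B + (0 ^ 2 + 0) * (K ^ 2 * S))) :=
      ((t.const_add 1).mul_const _).add (((t.pow 2).add t).mul_const _)
    have t2 := intervalIntegral_tendsto_integral h2 tendsto_neg_atTop_atBot tendsto_id
    have t3 := ((t1.sqrt).const_mul (√A)).sub t2
    simpa using t3
  obtain ⟨R, hR0, hR⟩ := ((eventually_gt_atTop (0 : ℝ)).and
    (hlim.eventually (gt_mem_nhds (lt_add_of_pos_right _ hδ)))).exists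
  obtain ⟨W, M, e, κ, χ, hχ, hκ, he, hle, hW⟩ := hK R hR0
  have hlim2 : Tendsto (fun ε : ℝ => ∑ k, √(e k - ε) ^ 3) (𝓝[>] 0) (𝓝 (∑ k, κ k ^ 3)) := by
    have hc : Continuous fun ε : ℝ => ∑ k, √(e k - ε) ^ 3 := by fun_prop
    have := (hc.tendsto 0).mono_left (nhdsWithin_le_nhds (s := Ioi 0))
    simpa [he, Real.sqrt_sq (hκ _).le] using this
  obtain ⟨ε, hε0, hε⟩ := ((eventually_mem_nhdsWithin (a := (0 : ℝ)) (s := Ioi 0)).and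
    (hlim2.eventually (lt_mem_nhds (sub_lt_self _ (half_pos hδ))))).exists
  have hε0 : 0 < ε := hε0
  obtain ⟨L, -, hL⟩ := hdec ε hε0
  obtain ⟨N, E, ψ, hψ, hE, hmax⟩ := exists_maximal_family (V := U) hdec hε0.le (L := L)
    fun x hx v => neg_mul_sq_le_re_inner (hL x hx) v
  have hE0 : ∀ j, 0 < E j := fun j => hε0.trans (hE j)
  refine ⟨N, E, ψ, hψ, hE0, ?_⟩
  have hcmp := sum_sqrt_cube_le hχ hψ (κ := fun j => √(E j)) (fun j => Real.sqrt_nonneg _) (τ := ε)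
    fun u => by
      have a1 := form_le_form_add (A := U) (B := W) (τ := 0) (fun x v => by
        have := hle x v
        rw [zero_mul, sub_zero]; exact this) u
      have a2 := hmax u
      simp only [Real.sq_sqrt (hE0 _).le]
      linarith
  linarith

end H1

end

section

open MeasureTheory Filter Topology Set Matrix
open scoped ComplexOrder InnerProductSpace

section matrix

variable {n : ℕ}

theorem tr_toEuclideanCLM (A : Matrix (Fin n) (Fin n) ℂ) :
    tr (toEuclideanCLM (𝕜 := ℂ) A) = A.trace := by
  rw [tr_apply, coe_toEuclideanCLM_eq_toEuclideanLin]
  change LinearMap.trace ℂ _ (toLpLin 2 2 A) = _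
  rw [toLpLin_eq_toLin, trace_toLin_eq]

theorem toEuclideanCLM_eq_sum (A : Matrix (Fin n) (Fin n) ℂ) :
    toEuclideanCLM (𝕜 := ℂ) A =
      ∑ i, ∑ j, A i j • toEuclideanCLM (𝕜 := ℂ) (Matrix.single i j (1 : ℂ)) := by
  conv_lhs => rw [matrix_eq_sum_single A]
  simp only [map_sum, ← map_smul, Matrix.smul_single, smul_eq_mul, mul_one]

theorem continuous_toEuclideanCLM {V : ℝ → Matrix (Fin n) (Fin n) ℂ}
    (h : ∀ i j, Continuous fun x => V x i j) : Continuous fun x => toEuclideanCLM (𝕜 := ℂ) (V x) := by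
  simp only [toEuclideanCLM_eq_sum (V _)]
  fun_prop

theorem hasDerivAt_toEuclideanCLM {V : ℝ → Matrix (Fin n) (Fin n) ℂ}
    {V' : Matrix (Fin n) (Fin n) ℂ} {x : ℝ} (h : ∀ i j, HasDerivAt (fun x => V x i j) (V' i j) x) :
    HasDerivAt (fun x => toEuclideanCLM (𝕜 := ℂ) (V x)) (toEuclideanCLM (𝕜 := ℂ) V') x := by
  simp only [toEuclideanCLM_eq_sum (V _), toEuclideanCLM_eq_sum V']
  exact HasDerivAt.fun_sum fun i _ => HasDerivAt.fun_sum fun j _ => 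
    ((ContinuousLinearMap.toSpanSingleton ℂ (toEuclideanCLM (𝕜 := ℂ) (Matrix.single i j (1 : ℂ)))
      ).restrictScalars ℝ).hasFDerivAt.comp_hasDerivAt x (h i j)

theorem HasDerivAt.ofLp_apply {f : ℝ → EuclideanSpace ℂ (Fin n)} {f' : EuclideanSpace ℂ (Fin n)}
    {x : ℝ} (h : HasDerivAt f f' x) (i : Fin n) : HasDerivAt (fun x => f x i) (f' i) x :=
  ((EuclideanSpace.proj i : EuclideanSpace ℂ (Fin n) →L[ℂ] ℂ).restrictScalars ℝ).hasFDerivAt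
    |>.comp_hasDerivAt x h

theorem inner_toEuclideanCLM_left {A : Matrix (Fin n) (Fin n) ℂ} (hA : A.IsHermitian)
    (u v : EuclideanSpace ℂ (Fin n)) :
    ⟪toEuclideanCLM (𝕜 := ℂ) A u, v⟫_ℂ = ⟪u, toEuclideanCLM (𝕜 := ℂ) A v⟫_ℂ := by
  have e : star (toEuclideanCLM (𝕜 := ℂ) A) = toEuclideanCLM (𝕜 := ℂ) A := by
    rw [← map_star, star_eq_conjTranspose, hA.eq]
  conv_lhs => rw [← e]
  exact ContinuousLinearMap.adjoint_inner_left _ _ _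

theorem re_inner_toEuclideanCLM_nonpos {A : Matrix (Fin n) (Fin n) ℂ} (hA : (-A).PosSemidef)
    (v : EuclideanSpace ℂ (Fin n)) : (⟪v, toEuclideanCLM (𝕜 := ℂ) A v⟫_ℂ).re ≤ 0 := by
  have h := hA.re_dotProduct_nonneg (WithLp.ofLp v)
  have e : ⟪v, toEuclideanCLM (𝕜 := ℂ) A v⟫_ℂ = -(star (WithLp.ofLp v) ⬝ᵥ (-A) *ᵥ WithLp.ofLp v) := by
    rw [EuclideanSpace.inner_eq_star_dotProduct, ofLp_toEuclideanCLM, neg_mulVec, dotProduct_neg,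
      neg_neg, dotProduct_comm]
  rw [e, Complex.neg_re]
  simpa using h

end matrix

end

open MeasureTheory Matrix
open scoped ComplexOrder

/-- **Lower bound on the `3/2`-moment of the negative eigenvalues (remainder estimate):**
for a `C¹`, Hermitian nonpositive matrix potential `V` with `tr(-V)`, `tr(V²)` and
`tr(V′²)` integrable, and for every `δ > 0`, there is a finite orthonormal family of
eigenfunctions of `-d²/dx² ⊗ 1 + V` with negative eigenvalues `-E_j` such that
`(3/16) ∫ tr(V²) dx - ∑ E_j^{3/2} ≤ (3/16) [∫ tr(-V) dx]^{1/2} [∫ tr(V′²) dx]^{1/2} + δ`. -/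
theorem lieb_thirring_three_half_remainder (n : ℕ) (hn : 1 ≤ n)
    (V : ℝ → Matrix (Fin n) (Fin n) ℂ)
    (hVC1 : ∀ i j, ContDiff ℝ 1 fun x => V x i j)
    (hV : ∀ x, (-(V x)).PosSemidef)
    (hVint : Integrable fun x => ((-(V x)).trace).re)
    (hVsqInt : Integrable fun x => ((V x * V x).trace).re)
    (hV'sqInt : Integrable fun x =>
      (((Matrix.of fun i j => deriv (fun y => V y i j) x) *
        (Matrix.of fun i j => deriv (fun y => V y i j) x)).trace).re) :
    ∀ δ : ℝ, 0 < δ →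
      ∃ (N : ℕ) (ψ : Fin N → ℝ → Fin n → ℂ) (E : Fin N → ℝ),
        (∀ j, 0 < E j) ∧
        (∀ j i, ContDiff ℝ 2 fun x => ψ j x i) ∧
        (∀ j, Integrable fun x => ∑ i, Complex.normSq (ψ j x i)) ∧
        (∀ j l, (∫ x : ℝ, ∑ i, (starRingEnd ℂ) (ψ j x i) * ψ l x i)
          = if j = l then 1 else 0) ∧
        (∀ j x i,
          -(deriv (fun y => deriv (fun z => ψ j z i) y) x) + (V x *ᵥ ψ j x) i
            = -(E j : ℂ) * ψ j x i) ∧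
        (3 / 16) * (∫ x : ℝ, ((V x * V x).trace).re) - ∑ j, E j ^ ((3 : ℝ) / 2) ≤
          (3 / 16) * Real.sqrt (∫ x : ℝ, ((-(V x)).trace).re) *
            Real.sqrt (∫ x : ℝ,
              (((Matrix.of fun i j => deriv (fun y => V y i j) x) *
                (Matrix.of fun i j => deriv (fun y => V y i j) x)).trace).re) + δ := by
  intro δ hδ
  have hherm : ∀ x, (V x).IsHermitian := fun x => by simpa using (hV x).isHermitian.neg
  set V' : ℝ → Matrix (Fin n) (Fin n) ℂ := fun x => Matrix.of fun i j => deriv (fun y => V y i j) x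
    with hV'
  have e1 : ∀ x, ((-(V x)).trace).re = -(tr (toEuclideanCLM (𝕜 := ℂ) (V x))).re := fun x => by
    rw [tr_toEuclideanCLM, trace_neg, Complex.neg_re]
  have e2 : ∀ A : Matrix (Fin n) (Fin n) ℂ, ((A * A).trace).re =
      (tr (toEuclideanCLM (𝕜 := ℂ) A * toEuclideanCLM (𝕜 := ℂ) A)).re := fun A => by
    rw [← map_mul, tr_toEuclideanCLM]
  change Integrable fun x => ((V' x * V' x).trace).re at hV'sqInt
  change ∃ (N : ℕ) (ψ : Fin N → ℝ → Fin n → ℂ) (E : Fin N → ℝ), _ ∧ _ ∧ _ ∧ _ ∧ _ ∧ _ ≤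
    3 / 16 * _ * √(∫ x, ((V' x * V' x).trace).re) + δ
  simp only [e1, e2] at hVint hVsqInt hV'sqInt ⊢
  obtain ⟨U, hU, N, E, ψ, hψ, hE, hle⟩ := H1.exists_family_remainder
    (fun x => inner_toEuclideanCLM_left (hherm x)) (fun x => re_inner_toEuclideanCLM_nonpos (hV x))
    (V' := fun x => toEuclideanCLM (𝕜 := ℂ) (V' x))
    (fun x => hasDerivAt_toEuclideanCLM fun i j =>
      ((hVC1 i j).differentiable one_ne_zero x).hasDerivAt)
    (continuous_toEuclideanCLM fun i j => (hVC1 i j).continuous_deriv le_rfl)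
    hVint hVsqInt hV'sqInt hδ
  have d1 : ∀ j i x, HasDerivAt (fun x => (ψ j).fn x i) ((ψ j).dv x i) x := fun j i x =>
    ((hψ.eig j).1 x).ofLp_apply i
  have d2 : ∀ j i x, HasDerivAt (fun x => (ψ j).dv x i)
      ((V x *ᵥ WithLp.ofLp ((ψ j).fn x)) i + E j * (ψ j).fn x i) x := fun j i x => by
    have := ((hψ.eig j).2 x).ofLp_apply i
    rw [hU] at this
    exact this
  have dd1 : ∀ j i, deriv (fun x => (ψ j).fn x i) = fun x => (ψ j).dv x i := fun j i =>
    funext fun x => (d1 j i x).deriv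
  have dd2 : ∀ j i, deriv (fun x => (ψ j).dv x i) =
      fun x => (V x *ᵥ WithLp.ofLp ((ψ j).fn x)) i + E j * (ψ j).fn x i := fun j i =>
    funext fun x => (d2 j i x).deriv
  refine ⟨N, fun j x => WithLp.ofLp ((ψ j).fn x), E, hE, fun j i => ?_, fun j => ?_, fun j l => ?_,
    fun j x i => ?_, ?_⟩
  · have hc : Continuous fun x => (V x *ᵥ WithLp.ofLp ((ψ j).fn x)) i + E j * (ψ j).fn x i := by
      have := (ψ j).continuous
      have := fun i j => (hVC1 i j).continuous
      simp only [mulVec, dotProduct]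
      fun_prop
    rw [show (2 : WithTop ℕ∞) = 1 + 1 by norm_num, contDiff_succ_iff_deriv, dd1]
    refine ⟨fun x => (d1 j i x).differentiableAt, by simp, ?_⟩
    rw [contDiff_one_iff_deriv, dd2]
    exact ⟨fun x => (d2 j i x).differentiableAt, hc⟩
  · refine (ψ j).memLp.integrable_sq_norm.congr (ae_of_all _ fun x => ?_)
    simp only [EuclideanSpace.norm_sq_eq, Complex.normSq_eq_norm_sq]
  · rw [← hψ.ortho j l, H1.mass_apply]
    refine integral_congr_ae (ae_of_all _ fun x => ?_)
    simp only [PiLp.inner_apply, RCLike.inner_apply, mul_comm]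
  · have h := congrFun (dd2 j i) x
    rw [← dd1] at h
    beta_reduce at h ⊢
    rw [h]; ring
  · have e : ∀ j, E j ^ ((3 : ℝ) / 2) = √(E j) ^ 3 := fun j => by
      rw [Real.sqrt_eq_rpow, ← Real.rpow_natCast, ← Real.rpow_mul (hE j).le]; norm_num
    simp only [e]
    exact hle
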